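/- (McMullen; Venkov.) Let P be a convex d-polytope in ℝ^d (the convex hull of a finite set of points, with nonempty interior) and suppose there exists a set S ⊆ ℝ^d such that the translates {s + P : s ∈ S} form a tiling of ℝ^d. Then P admits a face-to-face lattice tiling: there exist d linearly independent vectors b_1, …, b_d such that the translates of P by the lattice L = ℤb_1 + ⋯ + ℤb_d form a locally finite face-to-face tiling of ℝ^d. -/

import Mathlib

open Set

noncomputable section

abbrev Euc (d : ℕ) := EuclideanSpace ℝ (Fin d)

/-- A tiling of `ℝ^d`: a family of closed sets covering the space with pairwise
disjoint interiors. -/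
def IsTiling {d : ℕ} (𝒯 : Set (Set (Euc d))) : Prop :=
  (∀ T ∈ 𝒯, IsClosed T) ∧ ⋃₀ 𝒯 = Set.univ ∧
    𝒯.Pairwise fun S T => interior S ∩ interior T = ∅

/-- Local finiteness: every compact set meets only finitely many tiles. -/
def LocallyFiniteTiling {d : ℕ} (𝒯 : Set (Set (Euc d))) : Prop :=
  ∀ K : Set (Euc d), IsCompact K → {T ∈ 𝒯 | (T ∩ K).Nonempty}.Finite

/-- `S` is an isometric copy of `T`. -/
def IsometricCopy {d : ℕ} (S T : Set (Euc d)) : Prop :=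
  ∃ g : Euc d ≃ᵢ Euc d, g '' T = S

/-- A monohedral tiling with prototile `T`. -/
def Monohedral {d : ℕ} (𝒯 : Set (Set (Euc d))) (T : Set (Euc d)) : Prop :=
  ∀ S ∈ 𝒯, IsometricCopy S T

/-- A convex `d`-polytope in `ℝ^d`: convex hull of a finite set, with nonempty interior. -/
def IsConvexPolytope {d : ℕ} (P : Set (Euc d)) : Prop :=
  (∃ V : Finset (Euc d), P = convexHull ℝ (V : Set (Euc d))) ∧ (interior P).Nonempty

/-- A tiling is face-to-face if the intersection of any two distinct tiles is a
face (extreme subset), possibly empty, of each of them. -/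
def FaceToFace {d : ℕ} (𝒯 : Set (Set (Euc d))) : Prop :=
  ∀ S ∈ 𝒯, ∀ T ∈ 𝒯, S ≠ T → IsExtreme ℝ S (S ∩ T) ∧ IsExtreme ℝ T (S ∩ T)

/-- Combinatorial equivalence: an order isomorphism between the face posets
(posets of extreme subsets ordered by inclusion). -/
def CombEquiv {d e : ℕ} (P : Set (Euc d)) (Q : Set (Euc e)) : Prop :=
  Nonempty ({F : Set (Euc d) // IsExtreme ℝ P F} ≃o {F : Set (Euc e) // IsExtreme ℝ Q F})

/-- A facet: a maximal proper nonempty face. -/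
def IsFacet {d : ℕ} (Q F : Set (Euc d)) : Prop :=
  IsExtreme ℝ Q F ∧ F.Nonempty ∧ F ≠ Q ∧
    ∀ G : Set (Euc d), IsExtreme ℝ Q G → G ≠ Q → F ⊆ G → G = F

set_option linter.unusedSectionVars false

namespace TranslationTiling

open scoped RealInnerProductSpace Pointwise
open Filter Topology MeasureTheory

section FacetRep

variable {E : Type*} [NormedAddCommGroup E] [InnerProductSpace ℝ E] {ι : Type*}

/-- `K` is the intersection of the half-spaces `⟪u i, x⟫ ≤ h i` with unit normals, and every
inequality defines a facet. -/
structure IsFacetRep (K : Set E) (u : ι → E) (h : ι → ℝ) : Prop where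
  norm_eq : ∀ i, ‖u i‖ = 1
  mem_iff : ∀ x, x ∈ K ↔ ∀ i, ⟪u i, x⟫ ≤ h i
  exists_facet_point : ∀ i, ∃ y, ⟪u i, y⟫ = h i ∧ ∀ j, j ≠ i → ⟪u j, y⟫ < h j

/-- The indices of the inequalities that are tight at `p`. -/
def active (u : ι → E) (h : ι → ℝ) (p : E) : Set ι := {i | ⟪u i, p⟫ = h i}

/-- Some point of `K` lies on exactly the two facets `i` and `j`. -/
def Ridge (K : Set E) (u : ι → E) (h : ι → ℝ) (i j : ι) : Prop :=
  i ≠ j ∧ ∃ p ∈ K, active u h p = {i, j}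

namespace IsFacetRep

variable {K : Set E} {u : ι → E} {h : ι → ℝ}

theorem le (hK : IsFacetRep K u h) {x : E} (hx : x ∈ K) (i : ι) : ⟪u i, x⟫ ≤ h i :=
  (hK.mem_iff x).1 hx i

theorem injective (hK : IsFacetRep K u h) : Function.Injective u := by
  intro i j hij
  by_contra hne
  obtain ⟨y, hy, hy'⟩ := hK.exists_facet_point i
  obtain ⟨z, hz, hz'⟩ := hK.exists_facet_point j
  have h1 := hy' j (Ne.symm hne)
  have h2 := hz' i hne
  rw [hij] at hy h2
  linarith

theorem mem_of_facet_point (hK : IsFacetRep K u h) {i : ι} {y : E} (hy : ⟪u i, y⟫ = h i)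
    (hy' : ∀ j, j ≠ i → ⟪u j, y⟫ < h j) : y ∈ K := by
  rw [hK.mem_iff]
  intro j
  by_cases hj : j = i
  · rw [hj, hy]
  · exact (hy' j hj).le

/-- No facet normal lies in the open cone of two other normals that are active at a common
point. -/
theorem not_mem_open_cone (hK : IsFacetRep K u h) {p : E} (hp : p ∈ K) {i j l : ι}
    (hi : i ∈ active u h p) (hj : j ∈ active u h p) (hli : l ≠ i) (hlj : l ≠ j) {a b : ℝ}
    (ha : 0 < a) (hb : 0 < b) (hl : u l = a • u i + b • u j) : False := by
  obtain ⟨y, hy, hy'⟩ := hK.exists_facet_point l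
  have h1 := hy' i hli.symm
  have h2 := hy' j hlj.symm
  have h3 := hK.le hp l
  simp only [active, mem_ofPred_eq] at hi hj
  rw [hl, inner_add_left, inner_smul_left, inner_smul_left] at h3 hy
  simp only [conj_trivial] at h3 hy
  rw [hi, hj] at h3
  nlinarith

theorem pair_independent (hK : IsFacetRep K u h) {p : E} {i j : ι}
    (hi : i ∈ active u h p) (hj : j ∈ active u h p) (hij : i ≠ j) {a b : ℝ}
    (hab : a • u i + b • u j = 0) : a = 0 ∧ b = 0 := by
  simp only [active, mem_ofPred_eq] at hi hj
  have key : ∀ y, a * (h i - ⟪u i, y⟫) + b * (h j - ⟪u j, y⟫) = 0 := by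
    intro y
    have h1 : ⟪a • u i + b • u j, p - y⟫ = 0 := by rw [hab, inner_zero_left]
    rw [inner_add_left, inner_smul_left, inner_smul_left, inner_sub_right, inner_sub_right,
      hi, hj] at h1
    simpa using h1
  constructor
  · obtain ⟨y, hy, hy'⟩ := hK.exists_facet_point j
    have h1 := key y
    have h2 := hy' i hij
    rw [hy, sub_self, mul_zero, add_zero] at h1
    rcases mul_eq_zero.1 h1 with h3 | h3
    · exact h3
    · linarith
  · obtain ⟨y, hy, hy'⟩ := hK.exists_facet_point i
    have h1 := key y
    have h2 := hy' j hij.symm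
    rw [hy, sub_self, mul_zero, zero_add] at h1
    rcases mul_eq_zero.1 h1 with h3 | h3
    · exact h3
    · linarith

theorem triple_independent (hK : IsFacetRep K u h) {p : E} {i j k : ι}
    (hi : i ∈ active u h p) (hj : j ∈ active u h p) (hk : k ∈ active u h p)
    (hij : i ≠ j) (hik : i ≠ k) (hjk : j ≠ k) {a b c : ℝ}
    (habc : a • u i + b • u j + c • u k = 0) : a = 0 ∧ b = 0 ∧ c = 0 := by
  simp only [active, mem_ofPred_eq] at hi hj hk
  have key : ∀ y, a * (h i - ⟪u i, y⟫) + b * (h j - ⟪u j, y⟫) + c * (h k - ⟪u k, y⟫) = 0 := by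
    intro y
    have h1 : ⟪a • u i + b • u j + c • u k, p - y⟫ = 0 := by rw [habc, inner_zero_left]
    rw [inner_add_left, inner_add_left, inner_smul_left, inner_smul_left, inner_smul_left,
      inner_sub_right, inner_sub_right, inner_sub_right, hi, hj, hk] at h1
    simpa using h1
  have sgn : ∀ x y r s : ℝ, 0 < r → 0 < s → x * r + y * s = 0 →
      (x = 0 ∧ y = 0) ∨ (0 < x ∧ y < 0) ∨ (x < 0 ∧ 0 < y) := by
    intro x y r s hr hs h0
    rcases lt_trichotomy x 0 with hx | hx | hx
    · right; right; refine ⟨hx, ?_⟩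
      by_contra hy; push Not at hy; nlinarith
    · left; refine ⟨hx, ?_⟩
      rw [hx, zero_mul, zero_add] at h0
      rcases mul_eq_zero.1 h0 with h | h
      · exact h
      · linarith
    · right; left; refine ⟨hx, ?_⟩
      by_contra hy; push Not at hy; nlinarith
  obtain ⟨y1, e1, f1⟩ := hK.exists_facet_point i
  obtain ⟨y2, e2, f2⟩ := hK.exists_facet_point j
  obtain ⟨y3, e3, f3⟩ := hK.exists_facet_point k
  have k1 := key y1
  have k2 := key y2
  have k3 := key y3
  rw [e1, sub_self, mul_zero, zero_add] at k1
  rw [e2, sub_self, mul_zero, add_zero] at k2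
  rw [e3, sub_self, mul_zero, add_zero] at k3
  have s1 := sgn b c _ _ (sub_pos.2 (f1 j hij.symm)) (sub_pos.2 (f1 k hik.symm)) k1
  have s2 := sgn a c _ _ (sub_pos.2 (f2 i hij)) (sub_pos.2 (f2 k hjk.symm)) k2
  have s3 := sgn a b _ _ (sub_pos.2 (f3 i hik)) (sub_pos.2 (f3 j hjk)) k3
  rcases s1 with s1 | s1 | s1 <;> rcases s2 with s2 | s2 | s2 <;> rcases s3 with s3 | s3 | s3 <;>
    first
    | exact ⟨s2.1, s1.1, s1.2⟩
    | (exfalso; linarith [s1.1, s1.2, s2.1, s2.2, s3.1, s3.2])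

end IsFacetRep

/-- Opposite pairs of facets generate a belt of length four. -/
def Quad (K : Set E) (u : ι → E) (h : ι → ℝ) (opp : ι → ι) (i j : ι) : Prop :=
  Ridge K u h i j ∧ Ridge K u h (opp i) j

/-- The facets `i`, `j`, `k` and their opposites form a belt of length six. -/
def Hex (K : Set E) (u : ι → E) (h : ι → ℝ) (opp : ι → ι) (i j k : ι) : Prop :=
  (∃ a b : ℝ, 0 < a ∧ 0 < b ∧ u j = a • u i + b • u k) ∧
    Ridge K u h i j ∧ Ridge K u h j k ∧ Ridge K u h k (opp i)

/-- A centrally symmetric polytope whose opposite facets are translates of each other and all of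
whose belts have length four or six. -/
structure IsBelted (P : Set E) (u : ι → E) (h : ι → ℝ) (opp : ι → ι) (t : ι → E) : Prop
    extends IsFacetRep P u h where
  bounded : Bornology.IsBounded P
  pos : ∀ i, 0 < h i
  u_opp : ∀ i, u (opp i) = -u i
  h_opp : ∀ i, h (opp i) = h i
  t_opp : ∀ i, t (opp i) = -t i
  inner_t : ∀ i, ⟪u i, t i⟫ = 2 * h i
  sub_mem : ∀ i, ∀ x ∈ P, i ∈ active u h x → x - t i ∈ P
  belt : ∀ i j, Ridge P u h i j → Quad P u h opp i j ∨ ∃ k, Hex P u h opp i j k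

end FacetRep

section Belts

variable {E : Type*} [NormedAddCommGroup E] [InnerProductSpace ℝ E] {ι : Type*}

/-- Cross the facet `i` of `P` and translate back to `P`. -/
def FacetStep (P : Set E) (u : ι → E) (h : ι → ℝ) (t : ι → E) (x y : E) : Prop :=
  x ∈ P ∧ ∃ i ∈ active u h x, y = x - t i

/-- The equivalence relation on `P` generated by identifying opposite facets. -/
def Glued (P : Set E) (u : ι → E) (h : ι → ℝ) (t : ι → E) : E → E → Prop :=
  Relation.ReflTransGen (FacetStep P u h t)

namespace IsBelted

variable {P : Set E} {u : ι → E} {h : ι → ℝ} {opp : ι → ι} {t : ι → E}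

theorem opp_opp (hP : IsBelted P u h opp t) (i : ι) : opp (opp i) = i :=
  hP.injective (by rw [hP.u_opp, hP.u_opp, neg_neg])

theorem mem_active_iff {p : E} {i : ι} : i ∈ active u h p ↔ ⟪u i, p⟫ = h i := Iff.rfl

theorem opp_active_sub (hP : IsBelted P u h opp t) {p : E} {i : ι} (hi : i ∈ active u h p) :
    opp i ∈ active u h (p - t i) := by
  rw [mem_active_iff] at *
  rw [hP.u_opp, hP.h_opp, inner_neg_left, inner_sub_right, hP.inner_t, hi]
  ring

theorem not_active_opp (hP : IsBelted P u h opp t) {p : E} {i : ι} (hi : i ∈ active u h p)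
    (hi' : opp i ∈ active u h p) : False := by
  rw [mem_active_iff] at *
  rw [hP.u_opp, hP.h_opp, inner_neg_left, hi] at hi'
  linarith [hP.pos i]

theorem step_mem (hP : IsBelted P u h opp t) {x y : E} (hxy : FacetStep P u h t x y) :
    y ∈ P := by
  obtain ⟨hx, i, hi, rfl⟩ := hxy
  exact hP.sub_mem i x hx hi

theorem step_symm (hP : IsBelted P u h opp t) {x y : E} (hxy : FacetStep P u h t x y) :
    FacetStep P u h t y x := by
  refine ⟨hP.step_mem hxy, ?_⟩
  obtain ⟨hx, i, hi, rfl⟩ := hxy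
  exact ⟨opp i, hP.opp_active_sub hi, by rw [hP.t_opp]; abel⟩

theorem glued_mem (hP : IsBelted P u h opp t) {x y : E} (hx : x ∈ P)
    (hxy : Glued P u h t x y) : y ∈ P := by
  induction hxy with
  | refl => exact hx
  | tail _ h _ => exact hP.step_mem h

theorem glued_symm (hP : IsBelted P u h opp t) {x y : E} (hxy : Glued P u h t x y) :
    Glued P u h t y x := by
  induction hxy with
  | refl => exact Relation.ReflTransGen.refl
  | tail _ h ih => exact (Relation.ReflTransGen.single (hP.step_symm h)).trans ih

theorem glued_trans {x y z : E} (hxy : Glued P u h t x y) (hyz : Glued P u h t y z) :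
    Glued P u h t x z := Relation.ReflTransGen.trans hxy hyz

theorem glued_refl (x : E) : Glued P u h t x x := Relation.ReflTransGen.refl

theorem glued_sub_mem (x y : E) (hxy : Glued P u h t x y) :
    x - y ∈ AddSubgroup.closure (range t) := by
  induction hxy with
  | refl => simp
  | tail _ h ih =>
    obtain ⟨_, i, _, rfl⟩ := h
    rw [← sub_add]
    exact add_mem ih (AddSubgroup.subset_closure (mem_range_self i))

theorem active_add_subset {p v : E}
    (hv : ∀ j, j ∉ active u h p → ⟪u j, p + v⟫ < h j) :
    active u h (p + v) ⊆ active u h p := by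
  intro j hj
  by_contra hn
  exact (hv j hn).ne hj

theorem add_mem_iff (hP : IsFacetRep P u h) {p v : E}
    (hv : ∀ j, j ∉ active u h p → ⟪u j, p + v⟫ < h j) :
    p + v ∈ P ↔ ∀ j ∈ active u h p, ⟪u j, v⟫ ≤ 0 := by
  rw [hP.mem_iff]
  constructor
  · intro H j hj
    have := H j
    rw [inner_add_right, mem_active_iff.1 hj] at this
    linarith
  · intro H j
    by_cases hj : j ∈ active u h p
    · have := H j hj
      rw [inner_add_right, mem_active_iff.1 hj]
      linarith
    · exact (hv j hj).le

variable [Finite ι]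

/-- Near `p` no new inequality becomes tight. -/
theorem eventually_active_subset (hP : IsFacetRep P u h) {p : E} (hp : p ∈ P) :
    ∃ δ > 0, ∀ v : E, ‖v‖ < δ → (∀ j, j ∉ active u h p → ⟪u j, p + v⟫ < h j) := by
  have h1 : ∀ j, ∀ᶠ v : E in nhds 0, j ∉ active u h p → ⟪u j, p + v⟫ < h j := by
    intro j
    by_cases hj : j ∈ active u h p
    · simp [hj]
    · have h2 : ⟪u j, p + 0⟫ < h j := by
        rw [add_zero]; exact lt_of_le_of_ne (hP.le hp j) hj
      have h3 : Continuous fun v : E => ⟪u j, p + v⟫ := by fun_prop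
      filter_upwards [(h3.tendsto 0).eventually (gt_mem_nhds h2)] with v hv _
      exact hv
  obtain ⟨δ, hδ, hd⟩ := Metric.eventually_nhds_iff.1 (Filter.eventually_all.2 h1)
  exact ⟨δ, hδ, fun v hv j => hd (by simpa using hv) j⟩

/-- A step across a facet moves the whole face containing `p` in its relative interior. -/
theorem active_subset_of_step (hP : IsBelted P u h opp t) {p y : E} (hp : p ∈ P) (hy : y ∈ P)
    (hpy : active u h p ⊆ active u h y) {i : ι} (hi : i ∈ active u h p) :
    active u h (p - t i) ⊆ active u h (y - t i) := by
  intro j hj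
  obtain ⟨δ, hδ, hd⟩ := eventually_active_subset hP.toIsFacetRep hp
  obtain ⟨ε, hε, hεy⟩ : ∃ ε : ℝ, 0 < ε ∧ ‖ε • (p - y)‖ < δ := by
    refine ⟨δ / (2 * (‖p - y‖ + 1)), by positivity, ?_⟩
    rw [norm_smul, Real.norm_of_nonneg (by positivity), div_mul_eq_mul_div,
      div_lt_iff₀ (by positivity)]
    nlinarith [norm_nonneg (p - y)]
  have hz : ∀ k ∈ active u h p, ⟪u k, ε • (p - y)⟫ = 0 := by
    intro k hk
    rw [inner_smul_right, inner_sub_right, mem_active_iff.1 hk, mem_active_iff.1 (hpy hk), sub_self,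
      mul_zero]
  have hmem : p + ε • (p - y) ∈ P := by
    rw [add_mem_iff hP.toIsFacetRep (hd _ hεy)]
    exact fun k hk => (hz k hk).le
  have hact : i ∈ active u h (p + ε • (p - y)) := by
    rw [mem_active_iff, inner_add_right, hz i hi, mem_active_iff.1 hi, add_zero]
  have h1 := hP.le (hP.sub_mem i _ hmem hact) j
  have h2 := hP.le (hP.sub_mem i _ hy (hpy hi)) j
  rw [mem_active_iff] at hj ⊢
  simp only [inner_add_right, inner_sub_right, inner_smul_right] at h1 h2 hj ⊢
  by_contra hlt
  have h3 := lt_of_le_of_ne h2 hlt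
  nlinarith

theorem glued_translate (hP : IsBelted P u h opp t) {p q : E} (hpq : Glued P u h t p q)
    {y : E} (hy : y ∈ P) (hpy : active u h p ⊆ active u h y) :
    y + (q - p) ∈ P ∧ active u h q ⊆ active u h (y + (q - p)) := by
  induction hpq with
  | refl => simpa using ⟨hy, hpy⟩
  | @tail b c hb hbc ih =>
    obtain ⟨hbP, i, hi, rfl⟩ := hbc
    have e : y + (b - t i - p) = y + (b - p) - t i := by abel
    rw [e]
    exact ⟨hP.sub_mem i _ ih.1 (ih.2 hi), hP.active_subset_of_step hbP ih.1 ih.2 hi⟩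

/-- A gluing class contains at most one point in the relative interior of each face. -/
theorem eq_of_glued_of_active_eq (hP : IsBelted P u h opp t) {p q : E}
    (hpq : Glued P u h t p q) (hp : p ∈ P) (ha : active u h p = active u h q) : q = p := by
  have key : ∀ k : ℕ, p + (k : ℝ) • (q - p) ∈ P ∧
      active u h p ⊆ active u h (p + (k : ℝ) • (q - p)) := by
    intro k
    induction k with
    | zero => simpa using hp
    | succ k ih =>
      have := hP.glued_translate hpq ih.1 ih.2
      have e : p + ((k + 1 : ℕ) : ℝ) • (q - p) = p + (k : ℝ) • (q - p) + (q - p) := by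
        push_cast; rw [add_smul, one_smul, add_assoc]
      rw [e, ha]
      exact this
  by_contra hne
  have hpos : 0 < ‖q - p‖ := norm_pos_iff.2 (sub_ne_zero.2 hne)
  obtain ⟨C, hC⟩ := hP.bounded.exists_norm_le
  obtain ⟨k, hk⟩ := exists_nat_gt ((C + ‖p‖) / ‖q - p‖)
  rw [div_lt_iff₀ hpos] at hk
  have h1 := hC _ (key k).1
  have h2 : ‖(k : ℝ) • (q - p)‖ ≤ ‖p + (k : ℝ) • (q - p)‖ + ‖p‖ := by
    have := norm_sub_le (p + (k : ℝ) • (q - p)) p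
    simpa using this
  rw [norm_smul, Real.norm_of_nonneg (by positivity)] at h2
  linarith

theorem glued_finite (hP : IsBelted P u h opp t) {p : E} (hp : p ∈ P) :
    {q | Glued P u h t p q}.Finite := by
  refine Set.Finite.of_finite_image (f := active u h) (Set.toFinite _) ?_
  intro q hq r hr hqr
  exact (hP.eq_of_glued_of_active_eq (glued_trans (hP.glued_symm hq) hr)
    (hP.glued_mem hp hq) hqr).symm

/-- A single radius for which no new inequality becomes tight near any point glued to `p`. -/
theorem exists_radius (hP : IsBelted P u h opp t) {p : E} (hp : p ∈ P) :
    ∃ δ > 0, ∀ q, Glued P u h t p q → ∀ v : E, ‖v‖ < δ →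
      ∀ j, j ∉ active u h q → ⟪u j, q + v⟫ < h j := by
  have hfin := hP.glued_finite hp
  have : ∀ q : E, Glued P u h t p q → ∀ᶠ δ in nhdsWithin (0 : ℝ) (Ioi 0),
      ∀ v : E, ‖v‖ < δ → ∀ j, j ∉ active u h q → ⟪u j, q + v⟫ < h j := by
    intro q hq
    obtain ⟨δ, hδ, hd⟩ := eventually_active_subset hP.toIsFacetRep (hP.glued_mem hp hq)
    filter_upwards [Ioo_mem_nhdsGT hδ] with ε hε v hv
    exact hd v (hv.trans hε.2)
  have h2 : ∀ᶠ δ in nhdsWithin (0 : ℝ) (Ioi 0), ∀ q ∈ {q | Glued P u h t p q},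
      ∀ v : E, ‖v‖ < δ → ∀ j, j ∉ active u h q → ⟪u j, q + v⟫ < h j :=
    (Filter.eventually_all_finite hfin).2 this
  obtain ⟨δ, hd, hδ⟩ := (h2.and self_mem_nhdsWithin).exists
  exact ⟨δ, hδ, hd⟩

/-- Gluings near `p` come from gluings at `p`. -/
theorem glued_of_near (hP : IsBelted P u h opp t) {p : E} (hp : p ∈ P) {δ : ℝ}
    (hδ : ∀ q, Glued P u h t p q → ∀ v : E, ‖v‖ < δ →
      ∀ j, j ∉ active u h q → ⟪u j, q + v⟫ < h j)
    {q v r : E} (hq : Glued P u h t p q) (hv : ‖v‖ < δ) (hr : Glued P u h t (q + v) r) :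
    Glued P u h t p (r - v) := by
  induction hr with
  | refl => simpa using hq
  | @tail b c hb hbc ih =>
    obtain ⟨hbP, i, hi, rfl⟩ := hbc
    have hact : i ∈ active u h (b - v) := by
      refine active_add_subset (hδ _ ih v hv) ?_
      rwa [sub_add_cancel]
    refine Relation.ReflTransGen.tail ih ⟨hP.glued_mem hp ih, i, hact, by abel⟩

end IsBelted

end Belts

section LocalStructure

variable {E : Type*} [NormedAddCommGroup E] [InnerProductSpace ℝ E] {ι : Type*}

theorem exists_cone_combination {a b c : E} (ha : ‖a‖ = 1)
    (H : ∀ v, ⟪a, v⟫ = 0 → ⟪b, v⟫ ≤ 0 → ⟪c, v⟫ ≤ 0) :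
    ∃ α β : ℝ, 0 ≤ β ∧ c = α • a + β • b := by
  have haa : ⟪a, a⟫ = 1 := by rw [real_inner_self_eq_norm_sq, ha]; norm_num
  set b' := b - ⟪a, b⟫ • a with hb'
  set c' := c - ⟪a, c⟫ • a with hc'
  have hab : ⟪a, b'⟫ = 0 := by
    rw [hb', inner_sub_right, inner_smul_right, haa]; ring
  have hac : ⟪a, c'⟫ = 0 := by
    rw [hc', inner_sub_right, inner_smul_right, haa]; ring
  have hbv : ∀ v, ⟪a, v⟫ = 0 → ⟪b, v⟫ = ⟪b', v⟫ := by
    intro v hv; rw [hb', inner_sub_left, inner_smul_left, hv]; simp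
  have hcv : ∀ v, ⟪a, v⟫ = 0 → ⟪c, v⟫ = ⟪c', v⟫ := by
    intro v hv; rw [hc', inner_sub_left, inner_smul_left, hv]; simp
  have main : ∃ β : ℝ, 0 ≤ β ∧ c' = β • b' := by
    by_cases h0 : b' = 0
    · refine ⟨0, le_rfl, ?_⟩
      have := H c' hac (by rw [hbv _ hac, h0, inner_zero_left])
      rw [hcv _ hac] at this
      have h2 : ⟪c', c'⟫ = 0 := le_antisymm this real_inner_self_nonneg
      rw [zero_smul]
      exact inner_self_eq_zero.1 h2
    · have hpos : 0 < ⟪b', b'⟫ := real_inner_self_pos.2 h0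
      set lam := ⟪b', c'⟫ / ⟪b', b'⟫ with hlam
      have hl : lam * ⟪b', b'⟫ = ⟪b', c'⟫ := div_mul_cancel₀ _ hpos.ne'
      have hbw : ⟪b', c' - lam • b'⟫ = 0 := by
        rw [inner_sub_right, inner_smul_right]; linarith
      have haw : ⟪a, c' - lam • b'⟫ = 0 := by
        rw [inner_sub_right, inner_smul_right, hac, hab]; simp
      have h1 := H _ haw (by rw [hbv _ haw, hbw])
      rw [hcv _ haw] at h1
      have h2 : ⟪c' - lam • b', c' - lam • b'⟫ ≤ 0 := by
        rw [inner_sub_left (c') , inner_smul_left, hbw]; simpa using h1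
      have h3 : c' - lam • b' = 0 :=
        inner_self_eq_zero.1 (le_antisymm h2 real_inner_self_nonneg)
      have h4 := sub_eq_zero.1 h3
      refine ⟨lam, ?_, h4⟩
      have hnb : ⟪a, -b'⟫ = 0 := by rw [inner_neg_right, hab, neg_zero]
      have h5 := H (-b') hnb (by rw [hbv _ hnb, inner_neg_right]; linarith)
      rw [hcv _ hnb, h4, inner_neg_right, inner_smul_left] at h5
      simp only [conj_trivial] at h5
      by_contra hneg
      push Not at hneg
      nlinarith
  obtain ⟨β, hβ, e⟩ := main
  refine ⟨⟪a, c⟫ - β * ⟪a, b⟫, β, hβ, ?_⟩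
  have : c = ⟪a, c⟫ • a + c' := by rw [hc']; abel
  rw [this, e, hb', inner_add_right, inner_smul_right, haa]
  simp only [inner_smul_right, inner_sub_right, haa]
  module

theorem Ridge.symm {K : Set E} {u : ι → E} {h : ι → ℝ} {i j : ι} (H : Ridge K u h i j) :
    Ridge K u h j i := by
  obtain ⟨hij, p, hp, e⟩ := H
  exact ⟨hij.symm, p, hp, by rw [e, pair_comm]⟩

namespace IsBelted

variable {P : Set E} {u : ι → E} {h : ι → ℝ} {opp : ι → ι} {t : ι → E}

theorem neg_mem (hP : IsBelted P u h opp t) {x : E} (hx : x ∈ P) : -x ∈ P := by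
  rw [hP.mem_iff]
  intro i
  have := hP.le hx (opp i)
  rw [hP.u_opp, hP.h_opp, inner_neg_left] at this
  rwa [inner_neg_right]

theorem mem_active_neg (hP : IsBelted P u h opp t) {x : E} {i : ι} :
    i ∈ active u h (-x) ↔ opp i ∈ active u h x := by
  rw [mem_active_iff, mem_active_iff, hP.u_opp, hP.h_opp, inner_neg_left, inner_neg_right]

theorem opp_eq_iff (hP : IsBelted P u h opp t) {i j : ι} : opp i = j ↔ i = opp j := by
  constructor
  · rintro rfl; rw [hP.opp_opp]
  · rintro rfl; rw [hP.opp_opp]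

theorem ridge_opp (hP : IsBelted P u h opp t) {i j : ι} (H : Ridge P u h i j) :
    Ridge P u h (opp i) (opp j) := by
  obtain ⟨hij, p, hp, e⟩ := H
  refine ⟨fun hh => hij ?_, -p, hP.neg_mem hp, ?_⟩
  · rw [← hP.opp_opp i, hh, hP.opp_opp]
  · ext l
    rw [hP.mem_active_neg, e]
    simp only [mem_insert_iff, mem_singleton_iff, hP.opp_eq_iff]

theorem quad_symm (hP : IsBelted P u h opp t) {i j : ι} (H : Quad P u h opp i j) :
    Quad P u h opp j i := by
  refine ⟨H.1.symm, ?_⟩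
  have := hP.ridge_opp H.2.symm
  rwa [hP.opp_opp] at this

theorem quad_opp (hP : IsBelted P u h opp t) {i j : ι} (H : Quad P u h opp i j) :
    Quad P u h opp (opp i) j := by
  refine ⟨H.2, ?_⟩
  rw [hP.opp_opp]; exact H.1

theorem hex_rotate (hP : IsBelted P u h opp t) {i j k : ι} (H : Hex P u h opp i j k) :
    Hex P u h opp j k (opp i) := by
  obtain ⟨⟨a, b, ha, hb, e⟩, h1, h2, h3⟩ := H
  refine ⟨⟨1 / b, a / b, by positivity, by positivity, ?_⟩, h2, h3, hP.ridge_opp h1⟩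
  rw [e, hP.u_opp, smul_add, smul_smul, smul_smul, smul_neg, one_div, inv_mul_cancel₀ hb.ne',
    div_eq_inv_mul]
  module

theorem hex_flip (hP : IsBelted P u h opp t) {i j k : ι} (H : Hex P u h opp i j k) :
    Hex P u h opp j i (opp k) := by
  obtain ⟨⟨a, b, ha, hb, e⟩, h1, h2, h3⟩ := H
  have h4 := hP.ridge_opp h3
  rw [hP.opp_opp] at h4
  refine ⟨⟨1 / a, b / a, by positivity, by positivity, ?_⟩, h1.symm, h4.symm, ?_⟩
  · rw [e, hP.u_opp, smul_add, smul_smul, smul_smul, smul_neg, one_div, inv_mul_cancel₀ ha.ne',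
      div_eq_inv_mul]
    module
  · exact (hP.ridge_opp h2).symm

variable [Finite ι]

theorem near_facet (hP : IsBelted P u h opp t) {p : E} (hp : p ∈ P) {i : ι}
    (hi : i ∈ active u h p) {v : E} (hv : ⟪u i, v⟫ = 0) :
    (∀ l ∈ active u h (p - t i), ⟪u l, v⟫ ≤ 0) ↔ ∀ l ∈ active u h p, ⟪u l, v⟫ ≤ 0 := by
  obtain ⟨δ, hδ, hd⟩ := hP.exists_radius hp
  obtain ⟨ε, hε, hεv⟩ : ∃ ε : ℝ, 0 < ε ∧ ‖ε • v‖ < δ := by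
    refine ⟨δ / (2 * (‖v‖ + 1)), by positivity, ?_⟩
    rw [norm_smul, Real.norm_of_nonneg (by positivity), div_mul_eq_mul_div,
      div_lt_iff₀ (by positivity)]
    nlinarith [norm_nonneg v]
  have hst : FacetStep P u h t p (p - t i) := ⟨hp, i, hi, rfl⟩
  have h1 := add_mem_iff hP.toIsFacetRep (hd p (glued_refl p) _ hεv)
  have h2 := add_mem_iff hP.toIsFacetRep (hd _ (Relation.ReflTransGen.single hst) _ hεv)
  have sc : ∀ l, ⟪u l, ε • v⟫ ≤ 0 ↔ ⟪u l, v⟫ ≤ 0 := by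
    intro l
    rw [inner_smul_right]
    constructor
    · intro H; by_contra hh; push Not at hh; nlinarith
    · intro H; nlinarith
  simp only [sc] at h1 h2
  rw [← h1, ← h2]
  have hz : ⟪u i, ε • v⟫ = 0 := by rw [inner_smul_right, hv, mul_zero]
  constructor
  · intro H
    have := hP.sub_mem (opp i) _ H (by
      have h3 := mem_active_iff.1 (hP.opp_active_sub hi)
      rw [mem_active_iff, inner_add_right, h3, hP.u_opp, inner_neg_left, hz]; simp)
    rw [hP.t_opp] at this
    convert this using 1; abel
  · intro H
    have := hP.sub_mem i _ H (by
      rw [mem_active_iff, inner_add_right, mem_active_iff.1 hi, hz, add_zero])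
    convert this using 1; abel

theorem active_sub_pair (hP : IsBelted P u h opp t) {p : E} (hp : p ∈ P) {i j : ι} (hij : i ≠ j)
    (ha : active u h p = {i, j}) :
    (∃ l ∈ active u h (p - t i), l ≠ opp i) ∧
      ∀ l ∈ active u h (p - t i), l ≠ opp i →
        ∃ α β : ℝ, 0 < β ∧ u l = α • u i + β • u j := by
  have hi : i ∈ active u h p := by rw [ha]; simp
  have hj : j ∈ active u h p := by rw [ha]; simp
  have hii : ⟪u i, u i⟫ = 1 := by rw [real_inner_self_eq_norm_sq, hP.norm_eq]; norm_num
  constructor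
  · by_contra hn
    push Not at hn
    set v := u j - ⟪u i, u j⟫ • u i with hv
    have hv0 : ⟪u i, v⟫ = 0 := by rw [hv, inner_sub_right, inner_smul_right, hii]; ring
    have h1 := (hP.near_facet hp hi hv0).1 (by
      intro l hl
      rw [hn l hl, hP.u_opp, inner_neg_left, hv0, neg_zero]) j hj
    have h2 : ⟪v, v⟫ = ⟪u j, v⟫ := by
      nth_rw 1 [hv]
      rw [inner_sub_left, inner_smul_left, hv0]; simp
    have h3 : v = 0 := inner_self_eq_zero.1 (le_antisymm (h2 ▸ h1) real_inner_self_nonneg)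
    have h4 := hP.pair_independent hi hj hij (a := -⟪u i, u j⟫) (b := 1) (by
      rw [← h3, hv]; module)
    exact one_ne_zero h4.2
  · intro l hl hne
    obtain ⟨α, β, hβ, e⟩ := exists_cone_combination (a := u i) (b := u j) (c := u l)
      (hP.norm_eq i) (by
        intro v hv hjv
        refine (hP.near_facet hp hi hv).2 ?_ l hl
        intro k hk
        rw [ha] at hk
        rcases hk with rfl | rfl
        · exact hv.le
        · exact hjv)
    refine ⟨α, β, lt_of_le_of_ne hβ ?_, e⟩
    rintro rfl
    rw [zero_smul, add_zero] at e
    have hn := hP.norm_eq l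
    rw [e, norm_smul, hP.norm_eq, mul_one, Real.norm_eq_abs] at hn
    rcases eq_or_eq_neg_of_abs_eq hn with h1 | h1
    · rw [h1, one_smul] at e
      have := hP.injective e
      subst this
      exact hP.not_active_opp hl (hP.opp_active_sub hi)
    · rw [h1, neg_one_smul, ← hP.u_opp] at e
      exact hne (hP.injective e)

theorem not_ridge_cone (hP : IsBelted P u h opp t) {i j l : ι} (H : Ridge P u h i j) {a b : ℝ}
    (ha : 0 < a) (hb : 0 < b) (hl : u l = a • u i + b • u j) : False := by
  obtain ⟨hij, p, hp, e⟩ := H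
  have hi : i ∈ active u h p := by rw [e]; simp
  have hj : j ∈ active u h p := by rw [e]; simp
  refine hP.not_mem_open_cone hp hi hj ?_ ?_ ha hb hl
  · rintro rfl
    have := hP.pair_independent hi hj hij (a := a - 1) (b := b) (by
      rw [sub_smul, one_smul, sub_add_eq_add_sub, ← hl, sub_self])
    exact hb.ne' this.2
  · rintro rfl
    have := hP.pair_independent hi hj hij (a := a) (b := b - 1) (by
      rw [sub_smul, one_smul, ← add_sub_assoc, ← hl, sub_self])
    exact ha.ne' this.1

theorem active_sub_quad (hP : IsBelted P u h opp t) {p : E} (hp : p ∈ P) {i j : ι}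
    (H : Quad P u h opp i j) (ha : active u h p = {i, j}) :
    active u h (p - t i) = {opp i, j} := by
  obtain ⟨⟨l, hl, hl'⟩, hall⟩ := hP.active_sub_pair hp H.1.1 ha
  have key : ∀ l ∈ active u h (p - t i), l ≠ opp i → l = j := by
    intro l hl hl'
    obtain ⟨α, β, hβ, e⟩ := hall l hl hl'
    rcases lt_trichotomy α 0 with hα | hα | hα
    · exact (hP.not_ridge_cone H.2 (neg_pos.2 hα) hβ (by rw [e, hP.u_opp]; module)).elim
    · rw [hα, zero_smul, zero_add] at e
      have hn := hP.norm_eq l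
      rw [e, norm_smul, hP.norm_eq, mul_one, Real.norm_of_nonneg hβ.le] at hn
      rw [hn, one_smul] at e
      exact hP.injective e
    · exact (hP.not_ridge_cone H.1 hα hβ e).elim
  have hi : i ∈ active u h p := by rw [ha]; simp
  ext m
  simp only [mem_insert_iff, mem_singleton_iff]
  constructor
  · intro hm
    by_cases hm' : m = opp i
    · exact Or.inl hm'
    · exact Or.inr (key m hm hm')
  · rintro (rfl | rfl)
    · exact hP.opp_active_sub hi
    · rw [← key l hl hl']; exact hl

theorem active_sub_hex (hP : IsBelted P u h opp t) {p : E} (hp : p ∈ P) {i j k : ι}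
    (H : Hex P u h opp i j k) (ha : active u h p = {i, j}) :
    active u h (p - t i) = {opp i, k} := by
  obtain ⟨⟨a, b, ha0, hb0, ej⟩, h1, h2, h3⟩ := H
  have hi : i ∈ active u h p := by rw [ha]; simp
  have hopp := hP.opp_active_sub hi
  obtain ⟨⟨l, hl, hl'⟩, hall⟩ := hP.active_sub_pair hp h1.1 ha
  have hmem := hP.sub_mem i p hp hi
  have key : ∀ l ∈ active u h (p - t i), l ≠ opp i → l = k := by
    intro l hl hl'
    by_contra hlk
    obtain ⟨α, β, hβ, e⟩ := hall l hl hl'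
    have hlj : l ≠ j := by
      rintro rfl
      refine hP.not_mem_open_cone (l := k) hmem hopp hl h3.1
        (Ne.symm hlk) (a := a / b) (b := 1 / b) (by positivity) (by positivity) ?_
      rw [ej, hP.u_opp, smul_add, smul_smul, smul_smul, one_div, inv_mul_cancel₀ hb0.ne',
        div_eq_inv_mul]
      module
    have unit : ∀ m, ∀ c : ℝ, 0 < c → u l = c • u m → l = m := by
      intro m c hc e
      have hn := hP.norm_eq l
      rw [e, norm_smul, hP.norm_eq, mul_one, Real.norm_of_nonneg hc.le] at hn
      rw [hn, one_smul] at e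
      exact hP.injective e
    have e2 : u l = (α + β * a) • u i + (β * b) • u k := by rw [e, ej]; module
    rcases lt_trichotomy α 0 with hα | hα | hα
    · rcases lt_trichotomy (α + β * a) 0 with hγ | hγ | hγ
      · exact hP.not_ridge_cone h3 (l := l) (mul_pos hβ hb0) (neg_pos.2 hγ)
          (by rw [e2, hP.u_opp]; module)
      · rw [hγ, zero_smul, zero_add] at e2
        exact hlk (unit k _ (mul_pos hβ hb0) e2)
      · refine hP.not_ridge_cone h2 (l := l) (a := (α + β * a) / a)
          (b := - (α * b / a)) (by positivity) ?_ ?_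
        · rw [← neg_div, ← neg_mul]
          have := neg_pos.2 hα
          positivity
        · rw [e2, ej]
          match_scalars
          · field_simp
          · field_simp; ring
    · rw [hα, zero_smul, zero_add] at e
      exact hlj (unit j _ hβ e)
    · exact hP.not_ridge_cone h1 hα hβ e
  ext m
  simp only [mem_insert_iff, mem_singleton_iff]
  constructor
  · intro hm
    by_cases hm' : m = opp i
    · exact Or.inl hm'
    · exact Or.inr (key m hm hm')
  · rintro (rfl | rfl)
    · exact hopp
    · rw [← key l hl hl']; exact hl

end IsBelted

end LocalStructure

section LocalStructureRegular

variable {E : Type*} [NormedAddCommGroup E] [InnerProductSpace ℝ E] {ι : Type*}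

/-- At most two facets pass through `p`. -/
def Regular (u : ι → E) (h : ι → ℝ) (p : E) : Prop :=
  ∀ i ∈ active u h p, ∀ j ∈ active u h p, ∀ k ∈ active u h p, i = j ∨ i = k ∨ j = k

theorem Regular.cases {u : ι → E} {h : ι → ℝ} {p : E} (H : Regular u h p) :
    active u h p = ∅ ∨ (∃ i, active u h p = {i}) ∨ ∃ i j, i ≠ j ∧ active u h p = {i, j} := by
  rcases (active u h p).eq_empty_or_nonempty with h0 | ⟨i, hi⟩
  · exact Or.inl h0
  by_cases h1 : ∃ j ∈ active u h p, i ≠ j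
  · obtain ⟨j, hj, hij⟩ := h1
    refine Or.inr (Or.inr ⟨i, j, hij, Subset.antisymm ?_ ?_⟩)
    · intro k hk
      rcases H i hi j hj k hk with e | e | e
      · exact (hij e).elim
      · simp [e]
      · simp [e]
    · rintro k (rfl | rfl) <;> assumption
  · push Not at h1
    refine Or.inr (Or.inl ⟨i, Subset.antisymm (fun k hk => (h1 k hk).symm) ?_⟩)
    rintro k rfl
    exact hi

namespace IsBelted

variable {P : Set E} {u : ι → E} {h : ι → ℝ} {opp : ι → ι} {t : ι → E}

theorem glued_mem_of_closed {p q : E} (hpq : Glued P u h t p q) {C : Set E} (hp : p ∈ C)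
    (hC : ∀ x ∈ C, ∀ i ∈ active u h x, x - t i ∈ C) : q ∈ C := by
  induction hpq with
  | refl => exact hp
  | tail _ h ih =>
    obtain ⟨_, i, hi, rfl⟩ := h
    exact hC _ ih i hi

theorem glued_add {q v : E} {i : ι} (hi : i ∈ active u h q) (hv : ⟪u i, v⟫ = 0)
    (hq : q + v ∈ P) : Glued P u h t (q + v) (q - t i + v) :=
  Relation.ReflTransGen.single ⟨hq, i, by
    rw [mem_active_iff, inner_add_right, mem_active_iff.1 hi, hv, add_zero], by abel⟩

variable [Finite ι]

theorem active_sub_singleton (hP : IsBelted P u h opp t) {p : E} (hp : p ∈ P) {i : ι}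
    (ha : active u h p = {i}) : active u h (p - t i) = {opp i} := by
  have hi : i ∈ active u h p := by rw [ha]; rfl
  refine Subset.antisymm ?_ ?_
  · intro l hl
    by_contra hne
    obtain ⟨α, β, -, e⟩ := exists_cone_combination (a := u i) (b := 0) (c := u l)
      (hP.norm_eq i) (by
        intro v hv _
        refine (hP.near_facet hp hi hv).2 ?_ l hl
        intro k hk
        rw [ha] at hk
        rw [mem_singleton_iff.1 hk, hv])
    rw [smul_zero, add_zero] at e
    have hn := hP.norm_eq l
    rw [e, norm_smul, hP.norm_eq, mul_one, Real.norm_eq_abs] at hn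
    rcases eq_or_eq_neg_of_abs_eq hn with h1 | h1
    · rw [h1, one_smul] at e
      have := hP.injective e
      subst this
      exact hP.not_active_opp hl (hP.opp_active_sub hi)
    · rw [h1, neg_one_smul, ← hP.u_opp] at e
      exact hne (hP.injective e)
  · rintro l rfl
    exact hP.opp_active_sub hi

/-- Around a regular point the polytopes of its gluing class fit together like the tiles of a
tiling. -/
def LocallyTiled (P : Set E) (u : ι → E) (h : ι → ℝ) (t : ι → E) (p v : E) : Prop :=
  (∃ q, Glued P u h t p q ∧ q + v ∈ P) ∧
    ∀ q q', Glued P u h t p q → Glued P u h t p q' → q + v ∈ P → q' + v ∈ P →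
      Glued P u h t (q + v) (q' + v)

theorem locallyTiled_quad (hP : IsBelted P u h opp t) {p : E} (hp : p ∈ P) {δ : ℝ}
    (hδ : ∀ q, Glued P u h t p q → ∀ v : E, ‖v‖ < δ →
      ∀ j, j ∉ active u h q → ⟪u j, q + v⟫ < h j) {i j : ι}
    (H : Quad P u h opp i j) (ha : active u h p = {i, j}) {v : E} (hv : ‖v‖ < δ) :
    LocallyTiled P u h t p v := by
  have hi : i ∈ active u h p := by rw [ha]; simp
  have hj : j ∈ active u h p := by rw [ha]; simp
  have a1 := hP.active_sub_quad hp H ha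
  have a2 := hP.active_sub_quad hp (hP.quad_symm H) (by rw [ha, pair_comm])
  have m1 := hP.sub_mem i p hp hi
  have m2 := hP.sub_mem j p hp hj
  have j1 : j ∈ active u h (p - t i) := by rw [a1]; simp
  have i2 : i ∈ active u h (p - t j) := by rw [a2]; simp
  have a3 := hP.active_sub_quad m1 (hP.quad_symm (hP.quad_opp H)) (by rw [a1, pair_comm])
  have m3 := hP.sub_mem j _ m1 j1
  have e3 : p - t j - t i = p - t i - t j := by abel
  have s1 : Glued P u h t p (p - t i) := Relation.ReflTransGen.single ⟨hp, i, hi, rfl⟩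
  have s2 : Glued P u h t p (p - t j) := Relation.ReflTransGen.single ⟨hp, j, hj, rfl⟩
  have s3 : Glued P u h t p (p - t i - t j) := s1.tail ⟨m1, j, j1, rfl⟩
  have cls : ∀ q, Glued P u h t p q →
      q ∈ ({p, p - t i, p - t j, p - t i - t j} : Set E) := by
    intro q hq
    refine glued_mem_of_closed hq (by simp) ?_
    rintro x (rfl | rfl | rfl | rfl) k hk
    · rw [ha] at hk; rcases hk with rfl | rfl <;> simp
    · rw [a1] at hk
      rcases hk with rfl | rfl
      · left; rw [hP.t_opp]; abel
      · simp
    · rw [a2] at hk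
      rcases hk with rfl | rfl
      · left; rw [hP.t_opp]; abel
      · rw [e3]; simp
    · rw [a3] at hk
      rcases hk with rfl | rfl
      · right; left; rw [hP.t_opp]; abel
      · right; right; left
        rw [hP.t_opp]; abel
  have f0 := add_mem_iff hP.toIsFacetRep (hδ _ (glued_refl p) v hv)
  have f1 := add_mem_iff hP.toIsFacetRep (hδ _ s1 v hv)
  have f2 := add_mem_iff hP.toIsFacetRep (hδ _ s2 v hv)
  have f3 := add_mem_iff hP.toIsFacetRep (hδ _ s3 v hv)
  rw [ha] at f0
  rw [a1] at f1
  rw [a2] at f2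
  rw [a3] at f3
  simp only [mem_insert_iff, mem_singleton_iff, forall_eq_or_imp, forall_eq, hP.u_opp,
    inner_neg_left, neg_nonpos] at f0 f1 f2 f3
  constructor
  · rcases le_total ⟪u i, v⟫ 0 with hiv | hiv <;> rcases le_total ⟪u j, v⟫ 0 with hjv | hjv
    · exact ⟨p, glued_refl p, f0.2 ⟨hiv, hjv⟩⟩
    · exact ⟨_, s2, f2.2 ⟨hjv, hiv⟩⟩
    · exact ⟨_, s1, f1.2 ⟨hiv, hjv⟩⟩
    · exact ⟨_, s3, f3.2 ⟨hjv, hiv⟩⟩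
  · have g01 : p + v ∈ P → p - t i + v ∈ P → Glued P u h t (p + v) (p - t i + v) := by
      intro h0 h1
      exact glued_add hi (le_antisymm (f0.1 h0).1 (f1.1 h1).1) h0
    have g02 : p + v ∈ P → p - t j + v ∈ P → Glued P u h t (p + v) (p - t j + v) := by
      intro h0 h1
      exact glued_add hj (le_antisymm (f0.1 h0).2 (f2.1 h1).1) h0
    have g13 : p - t i + v ∈ P → p - t i - t j + v ∈ P →
        Glued P u h t (p - t i + v) (p - t i - t j + v) := by
      intro h0 h1
      exact glued_add j1 (le_antisymm (f1.1 h0).2 (f3.1 h1).1) h0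
    have g23 : p - t j + v ∈ P → p - t i - t j + v ∈ P →
        Glued P u h t (p - t j + v) (p - t i - t j + v) := by
      intro h0 h1
      rw [← e3]
      exact glued_add i2 (le_antisymm (f2.1 h0).2 (f3.1 h1).2) h0
    have g03 : p + v ∈ P → p - t i - t j + v ∈ P →
        Glued P u h t (p + v) (p - t i - t j + v) := by
      intro h0 h1
      have h2 : p - t i + v ∈ P := f1.2 ⟨(f3.1 h1).2, (f0.1 h0).2⟩
      exact (g01 h0 h2).trans (g13 h2 h1)
    have g12 : p - t i + v ∈ P → p - t j + v ∈ P →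
        Glued P u h t (p - t i + v) (p - t j + v) := by
      intro h0 h1
      have h2 : p + v ∈ P := f0.2 ⟨(f2.1 h1).2, (f1.1 h0).2⟩
      exact (hP.glued_symm (g01 h2 h0)).trans (g02 h2 h1)
    intro q q' hq hq' hqv hqv'
    rcases cls q hq with rfl | rfl | rfl | rfl <;> rcases cls q' hq' with e | e | e | e <;>
      rw [e] at hqv' ⊢ <;>
      first
      | exact glued_refl _
      | exact g01 hqv hqv'
      | exact g02 hqv hqv'
      | exact g13 hqv hqv'
      | exact g23 hqv hqv'
      | exact g03 hqv hqv'
      | exact g12 hqv hqv'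
      | exact hP.glued_symm (g01 hqv' hqv)
      | exact hP.glued_symm (g02 hqv' hqv)
      | exact hP.glued_symm (g13 hqv' hqv)
      | exact hP.glued_symm (g23 hqv' hqv)
      | exact hP.glued_symm (g03 hqv' hqv)
      | exact hP.glued_symm (g12 hqv' hqv)

theorem locallyTiled_hex (hP : IsBelted P u h opp t) {p : E} (hp : p ∈ P) {δ : ℝ}
    (hδ : ∀ q, Glued P u h t p q → ∀ v : E, ‖v‖ < δ →
      ∀ j, j ∉ active u h q → ⟪u j, q + v⟫ < h j) {i j k : ι}
    (H : Hex P u h opp i j k) (ha : active u h p = {i, j}) {v : E} (hv : ‖v‖ < δ) :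
    LocallyTiled P u h t p v := by
  have hi : i ∈ active u h p := by rw [ha]; simp
  have hj : j ∈ active u h p := by rw [ha]; simp
  have a1 := hP.active_sub_hex hp H ha
  have a2 := hP.active_sub_hex hp (hP.hex_flip H) (by rw [ha, pair_comm])
  have m1 := hP.sub_mem i p hp hi
  have m2 := hP.sub_mem j p hp hj
  have k1 : k ∈ active u h (p - t i) := by rw [a1]; simp
  have a3 := hP.active_sub_hex m1 (hP.hex_rotate (hP.hex_rotate H)) (by rw [a1, pair_comm])
  have s1 : Glued P u h t p (p - t i) := Relation.ReflTransGen.single ⟨hp, i, hi, rfl⟩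
  have s2 : Glued P u h t p (p - t j) := Relation.ReflTransGen.single ⟨hp, j, hj, rfl⟩
  have s3 : Glued P u h t p (p - t i - t k) := s1.tail ⟨m1, k, k1, rfl⟩
  have e3 : p - t i - t k = p - t j :=
    hP.eq_of_glued_of_active_eq ((hP.glued_symm s2).trans s3) m2 (by rw [a2, a3, pair_comm])
  have cls : ∀ q, Glued P u h t p q → q ∈ ({p, p - t i, p - t j} : Set E) := by
    intro q hq
    refine glued_mem_of_closed hq (by simp) ?_
    rintro x (rfl | rfl | rfl) l hl
    · rw [ha] at hl; rcases hl with rfl | rfl <;> simp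
    · rw [a1] at hl
      rcases hl with rfl | rfl
      · left; rw [hP.t_opp]; abel
      · rw [e3]; simp
    · rw [a2] at hl
      rcases hl with rfl | rfl
      · left; rw [hP.t_opp]; abel
      · right; left; rw [← e3, hP.t_opp]; abel
  have f0 := add_mem_iff hP.toIsFacetRep (hδ _ (glued_refl p) v hv)
  have f1 := add_mem_iff hP.toIsFacetRep (hδ _ s1 v hv)
  have f2 := add_mem_iff hP.toIsFacetRep (hδ _ s2 v hv)
  rw [ha] at f0
  rw [a1] at f1
  rw [a2] at f2
  simp only [mem_insert_iff, mem_singleton_iff, forall_eq_or_imp, forall_eq, hP.u_opp,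
    inner_neg_left, neg_nonpos] at f0 f1 f2
  constructor
  · obtain ⟨⟨a, b, ha0, hb0, ej⟩, -⟩ := H
    have ev : ⟪u j, v⟫ = a * ⟪u i, v⟫ + b * ⟪u k, v⟫ := by
      rw [ej, inner_add_left, inner_smul_left, inner_smul_left]; simp
    rcases le_total ⟪u k, v⟫ 0 with hkv | hkv
    · rcases le_total ⟪u i, v⟫ 0 with hiv | hiv
      · exact ⟨p, glued_refl p, f0.2 ⟨hiv, by rw [ev]; nlinarith⟩⟩
      · exact ⟨_, s1, f1.2 ⟨hiv, hkv⟩⟩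
    · rcases le_total ⟪u j, v⟫ 0 with hjv | hjv
      · refine ⟨p, glued_refl p, f0.2 ⟨?_, hjv⟩⟩
        by_contra hh
        push Not at hh
        nlinarith [mul_pos ha0 hh, mul_nonneg hb0.le hkv]
      · exact ⟨_, s2, f2.2 ⟨hjv, hkv⟩⟩
  · have g01 : p + v ∈ P → p - t i + v ∈ P → Glued P u h t (p + v) (p - t i + v) := by
      intro h0 h1
      exact glued_add hi (le_antisymm (f0.1 h0).1 (f1.1 h1).1) h0
    have g02 : p + v ∈ P → p - t j + v ∈ P → Glued P u h t (p + v) (p - t j + v) := by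
      intro h0 h1
      exact glued_add hj (le_antisymm (f0.1 h0).2 (f2.1 h1).1) h0
    have g12 : p - t i + v ∈ P → p - t j + v ∈ P →
        Glued P u h t (p - t i + v) (p - t j + v) := by
      intro h0 h1
      rw [← e3]
      exact glued_add k1 (le_antisymm (f1.1 h0).2 (f2.1 h1).2) h0
    intro q q' hq hq' hqv hqv'
    rcases cls q hq with rfl | rfl | rfl <;> rcases cls q' hq' with e | e | e <;>
      rw [e] at hqv' ⊢ <;>
      first
      | exact glued_refl _
      | exact g01 hqv hqv'
      | exact g02 hqv hqv'
      | exact g12 hqv hqv'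
      | exact hP.glued_symm (g01 hqv' hqv)
      | exact hP.glued_symm (g02 hqv' hqv)
      | exact hP.glued_symm (g12 hqv' hqv)

theorem locallyTiled_of_regular (hP : IsBelted P u h opp t) {p : E} (hp : p ∈ P)
    (hreg : Regular u h p) {δ : ℝ}
    (hδ : ∀ q, Glued P u h t p q → ∀ v : E, ‖v‖ < δ →
      ∀ j, j ∉ active u h q → ⟪u j, q + v⟫ < h j) {v : E} (hv : ‖v‖ < δ) :
    LocallyTiled P u h t p v := by
  rcases hreg.cases with ha | ⟨i, ha⟩ | ⟨i, j, hij, ha⟩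
  · have cls : ∀ q, Glued P u h t p q → q = p := by
      intro q hq
      refine glued_mem_of_closed (C := {p}) hq rfl ?_
      rintro x rfl k hk
      rw [ha] at hk
      exact hk.elim
    have f0 := add_mem_iff hP.toIsFacetRep (hδ _ (glued_refl p) v hv)
    rw [ha] at f0
    refine ⟨⟨p, glued_refl p, f0.2 (by simp)⟩, ?_⟩
    intro q q' hq hq' _ _
    rw [cls q hq, cls q' hq']
    exact glued_refl _
  · have hi : i ∈ active u h p := by rw [ha]; rfl
    have a1 := hP.active_sub_singleton hp ha
    have s1 : Glued P u h t p (p - t i) := Relation.ReflTransGen.single ⟨hp, i, hi, rfl⟩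
    have cls : ∀ q, Glued P u h t p q → q ∈ ({p, p - t i} : Set E) := by
      intro q hq
      refine glued_mem_of_closed hq (by simp) ?_
      rintro x (rfl | rfl) l hl
      · rw [ha] at hl; rw [mem_singleton_iff.1 hl]; simp
      · rw [a1] at hl
        rw [mem_singleton_iff.1 hl]
        left; rw [hP.t_opp]; abel
    have f0 := add_mem_iff hP.toIsFacetRep (hδ _ (glued_refl p) v hv)
    have f1 := add_mem_iff hP.toIsFacetRep (hδ _ s1 v hv)
    rw [ha] at f0
    rw [a1] at f1
    simp only [mem_singleton_iff, forall_eq, hP.u_opp, inner_neg_left, neg_nonpos] at f0 f1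
    have g01 : p + v ∈ P → p - t i + v ∈ P → Glued P u h t (p + v) (p - t i + v) := by
      intro h0 h1
      exact glued_add hi (le_antisymm (f0.1 h0) (f1.1 h1)) h0
    constructor
    · rcases le_total ⟪u i, v⟫ 0 with hiv | hiv
      · exact ⟨p, glued_refl p, f0.2 hiv⟩
      · exact ⟨_, s1, f1.2 hiv⟩
    · intro q q' hq hq' hqv hqv'
      rcases cls q hq with rfl | rfl <;> rcases cls q' hq' with e | e <;>
        rw [e] at hqv' ⊢ <;>
        first
        | exact glued_refl _
        | exact g01 hqv hqv'
        | exact hP.glued_symm (g01 hqv' hqv)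
  · rcases hP.belt i j ⟨hij, p, hp, ha⟩ with H | ⟨k, H⟩
    · exact hP.locallyTiled_quad hp hδ H ha hv
    · exact hP.locallyTiled_hex hp hδ H ha hv

end IsBelted

end LocalStructureRegular

section Monodromy

variable {E : Type*} [NormedAddCommGroup E] [NormedSpace ℝ E] {Λ : Type*}

/-- `R w j k` says that the sheets `j` and `k`, copies of `P` translated by `c j` and `c k`, are
identified at the point `w`.  At points of `G` the sheets form an unramified cover. -/
structure IsGluing (P G : Set E) (c : Λ → E) (R : E → Λ → Λ → Prop) : Prop where
  isCompact : IsCompact P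
  symm : ∀ w j k, R w j k → R w k j
  trans : ∀ w i j k, R w i j → R w j k → R w i k
  refl_iff : ∀ w j, R w j j ↔ w - c j ∈ P
  finite : ∀ w i, R w i i → {j | R w i j}.Finite
  transport : ∀ p ∈ P, ∃ δ > 0, ∀ w i, w - c i = p → ∀ z, ‖z - w‖ < δ →
    ∀ j k, R w i j → R z j k → R w i k
  cover : ∀ w ∈ G, ∀ i, R w i i → ∀ᶠ z in 𝓝 w, ∃ j, R w i j ∧ R z j j
  separated : ∀ w ∈ G, ∀ i, R w i i → ∀ᶠ z in 𝓝 w,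
    ∀ j k, R w i j → R w i k → R z j j → R z k k → R z j k

/-- A locally constant choice of sheets along the path `γ`. -/
def FlatOn (R : E → Λ → Λ → Prop) (γ : ℝ → E) (κ : ℝ → Λ) (J : Set ℝ) : Prop :=
  ∀ t ∈ J, R (γ t) (κ t) (κ t) ∧ ∀ᶠ s in 𝓝[J] t, R (γ t) (κ t) (κ s)

theorem forall_of_preconnected {J : Set ℝ} (hJ : IsPreconnected J) {A : ℝ → Prop}
    (hA : ∀ t ∈ J, ∀ᶠ s in 𝓝[J] t, (A t ↔ A s)) {t s : ℝ} (ht : t ∈ J) (hs : s ∈ J)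
    (h : A t) : A s := by
  refine hJ.induction₂' (fun x y => A x → A y) ?_ ?_ ht hs h
  · intro x hx
    filter_upwards [hA x hx] with y hy
    exact ⟨hy.1, hy.2⟩
  · intro x y z _ _ _ h1 h2 h3
    exact h2 (h1 h3)

theorem FlatOn.mono {R : E → Λ → Λ → Prop} {γ : ℝ → E} {κ : ℝ → Λ} {J J' : Set ℝ}
    (H : FlatOn R γ κ J) (hJ : J' ⊆ J) : FlatOn R γ κ J' :=
  fun t ht => ⟨(H t (hJ ht)).1, nhdsWithin_mono _ hJ (H t (hJ ht)).2⟩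

namespace IsGluing

variable {P G : Set E} {c : Λ → E} {R : E → Λ → Λ → Prop}

theorem refl_left (H : IsGluing P G c R) {w : E} {i j : Λ} (h : R w i j) : R w i i :=
  H.trans _ _ _ _ h (H.symm _ _ _ h)

theorem refl_right (H : IsGluing P G c R) {w : E} {i j : Λ} (h : R w i j) : R w j j :=
  H.trans _ _ _ _ (H.symm _ _ _ h) h

theorem eventually_transport (H : IsGluing P G c R) {w : E} {i : Λ} (h : R w i i) :
    ∀ᶠ z in 𝓝 w, ∀ j k, R w i j → R z j k → R w i k := by
  obtain ⟨δ, hδ, hd⟩ := H.transport _ ((H.refl_iff w i).1 h)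
  filter_upwards [Metric.ball_mem_nhds w hδ] with z hz
  exact hd w i rfl z (by rwa [← dist_eq_norm])

theorem propagate (H : IsGluing P G c R) {γ : ℝ → E} {κ : ℝ → Λ} {J : Set ℝ}
    (hJ : IsPreconnected J) (hκ : FlatOn R γ κ J) {w : E} {i : Λ}
    (hU : ∀ t ∈ J, ∀ j k, R w i j → R (γ t) j k → R w i k) {t s : ℝ} (ht : t ∈ J) (hs : s ∈ J)
    (h : R w i (κ t)) : R w i (κ s) := by
  refine forall_of_preconnected (A := fun t => R w i (κ t)) hJ ?_ ht hs h
  intro t ht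
  filter_upwards [(hκ t ht).2] with s hs
  exact ⟨fun h => hU t ht _ _ h hs, fun h => hU t ht _ _ h (H.symm _ _ _ hs)⟩

theorem agree (H : IsGluing P G c R) {γ : ℝ → E} (hγ : Continuous γ) {κ κ' : ℝ → Λ} {J : Set ℝ}
    (hJ : IsPreconnected J) (hG : ∀ t ∈ J, γ t ∈ G) (hκ : FlatOn R γ κ J) (hκ' : FlatOn R γ κ' J)
    {t s : ℝ} (ht : t ∈ J) (hs : s ∈ J) (h : R (γ t) (κ t) (κ' t)) :
    R (γ s) (κ s) (κ' s) := by
  refine forall_of_preconnected (A := fun t => R (γ t) (κ t) (κ' t)) hJ ?_ ht hs h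
  intro t ht
  have hc : Tendsto γ (𝓝[J] t) (𝓝 (γ t)) := hγ.continuousAt.mono_left nhdsWithin_le_nhds
  filter_upwards [(hκ t ht).2, (hκ' t ht).2, self_mem_nhdsWithin,
    hc.eventually (H.eventually_transport (hκ t ht).1),
    hc.eventually (H.separated _ (hG t ht) _ (hκ t ht).1)] with s h1 h2 hs h3 h4
  constructor
  · intro h
    exact h4 _ _ h1 (H.trans _ _ _ _ h h2) (hκ s hs).1 (hκ' s hs).1
  · intro h
    exact H.trans _ _ _ _ (h3 _ _ h1 h) (H.symm _ _ _ h2)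

theorem flatOn_congr (H : IsGluing P G c R) {γ : ℝ → E} (hγ : Continuous γ) {κ κ' : ℝ → Λ}
    {J : Set ℝ} (hκ : FlatOn R γ κ J) (h : ∀ t ∈ J, R (γ t) (κ t) (κ' t)) :
    FlatOn R γ κ' J := by
  intro t ht
  have hc : Tendsto γ (𝓝[J] t) (𝓝 (γ t)) := hγ.continuousAt.mono_left nhdsWithin_le_nhds
  refine ⟨H.refl_right (h t ht), ?_⟩
  filter_upwards [(hκ t ht).2, self_mem_nhdsWithin,
    hc.eventually (H.eventually_transport (hκ t ht).1)] with s h1 hs h3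
  exact H.trans _ _ _ _ (H.symm _ _ _ (h t ht)) (h3 _ _ h1 (h s hs))

theorem agree_of_near {w z z' : E} {i a b : Λ}
    (hwz : ∀ j k, R w i j → R z j k → R w i k)
    (hwz' : ∀ j k, R w i j → R w i k → R z' j j → R z' k k → R z' j k)
    (hz : ∃ j, R z a j ∧ R z' j j) (hzz' : ∀ j k, R z a j → R z' j k → R z a k)
    (ha : R w i a) (hb : R w i b) (hb' : R z' b b) : R z a b := by
  obtain ⟨j, hj, hj'⟩ := hz
  exact hzz' _ _ hj (hwz' _ _ (hwz _ _ ha hj) hb hj' hb')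

theorem exists_local (H : IsGluing P G c R) {γ : ℝ → E} (hγ : Continuous γ) {J : Set ℝ}
    (hG : ∀ t ∈ J, γ t ∈ G) {t : ℝ} (ht : t ∈ J) {l : Λ} (hl : R (γ t) l l) :
    ∃ ε > 0, ∃ κ : ℝ → Λ, R (γ t) l (κ t) ∧ FlatOn R γ κ (J ∩ Metric.ball t ε) := by
  have h1 := (hγ.tendsto t).eventually (H.cover _ (hG t ht) l hl)
  have h2 := (hγ.tendsto t).eventually (H.separated _ (hG t ht) l hl)
  have h3 := (hγ.tendsto t).eventually (H.eventually_transport hl)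
  obtain ⟨ε, hε, hε'⟩ := Metric.eventually_nhds_iff_ball.1 (h1.and (h2.and h3))
  have hch : ∀ s, ∃ j, s ∈ Metric.ball t ε → R (γ t) l j ∧ R (γ s) j j := by
    intro s
    by_cases hs : s ∈ Metric.ball t ε
    · obtain ⟨j, hj⟩ := (hε' s hs).1
      exact ⟨j, fun _ => hj⟩
    · exact ⟨l, fun h => (hs h).elim⟩
  choose κ hκ using hch
  refine ⟨ε, hε, κ, (hκ t (Metric.mem_ball_self hε)).1, ?_⟩
  rintro s ⟨hsJ, hs⟩
  refine ⟨(hκ s hs).2, ?_⟩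
  have hc : Tendsto γ (𝓝[J ∩ Metric.ball t ε] s) (𝓝 (γ s)) :=
    hγ.continuousAt.mono_left nhdsWithin_le_nhds
  filter_upwards [self_mem_nhdsWithin,
    hc.eventually (H.eventually_transport (hκ s hs).2),
    hc.eventually (H.cover _ (hG s hsJ) _ (hκ s hs).2)] with r hr h4 h5
  exact agree_of_near (hε' s hs).2.2 (hε' r hr.2).2.1 h5 h4 (hκ s hs).1 (hκ r hr.2).1
    (hκ r hr.2).2

theorem flatOn_join (H : IsGluing P G c R) {γ : ℝ → E} {κ κ' : ℝ → Λ} {a b d : ℝ}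
    (hκ : FlatOn R γ κ (Icc a b)) (hκ' : FlatOn R γ κ' (Icc b d))
    (hab : a ≤ b) (hbd : b ≤ d) (h : R (γ b) (κ b) (κ' b)) :
    FlatOn R γ (fun t => if t ≤ b then κ t else κ' t) (Icc a d) := by
  intro t ht
  rcases lt_trichotomy t b with htb | htb | htb
  · simp only [htb.le, if_true]
    have h1 := hκ t ⟨ht.1, htb.le⟩
    refine ⟨h1.1, ?_⟩
    filter_upwards [eventually_nhdsWithin_iff.1 h1.2 |>.filter_mono nhdsWithin_le_nhds,
      self_mem_nhdsWithin, nhdsWithin_le_nhds (Iio_mem_nhds htb)] with s h2 h3 h4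
    rw [if_pos (le_of_lt h4)]
    exact h2 ⟨h3.1, le_of_lt h4⟩
  · subst htb
    simp only [le_refl, if_true]
    have h1 := hκ t ⟨hab, le_rfl⟩
    have h2 := hκ' t ⟨le_rfl, hbd⟩
    refine ⟨h1.1, ?_⟩
    filter_upwards [eventually_nhdsWithin_iff.1 h1.2 |>.filter_mono nhdsWithin_le_nhds,
      eventually_nhdsWithin_iff.1 h2.2 |>.filter_mono nhdsWithin_le_nhds,
      self_mem_nhdsWithin] with s h3 h4 h5
    by_cases hs : s ≤ t
    · rw [if_pos hs]; exact h3 ⟨h5.1, hs⟩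
    · rw [if_neg hs]
      exact H.trans _ _ _ _ h (h4 ⟨(not_le.1 hs).le, h5.2⟩)
  · simp only [not_le.2 htb, if_false]
    have h1 := hκ' t ⟨htb.le, ht.2⟩
    refine ⟨h1.1, ?_⟩
    filter_upwards [eventually_nhdsWithin_iff.1 h1.2 |>.filter_mono nhdsWithin_le_nhds,
      self_mem_nhdsWithin, nhdsWithin_le_nhds (Ioi_mem_nhds htb)] with s h2 h3 h4
    rw [if_neg (not_le.2 h4)]
    exact h2 ⟨le_of_lt h4, h3.2⟩

theorem exists_limit_sheet (H : IsGluing P G c R) {γ : ℝ → E} (hγ : Continuous γ)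
    {κ : ℝ → Λ} {T : ℝ} (hT : 0 < T) (hκ : FlatOn R γ κ (Ico 0 T)) :
    ∃ j, R (γ T) j j ∧ ∃ t₀ ∈ Ico 0 T, ∀ t ∈ Ico t₀ T, R (γ T) j (κ t) := by
  have hne : (𝓝[Ico 0 T] T).NeBot := by
    rw [← mem_closure_iff_nhdsWithin_neBot, closure_Ico hT.ne]
    exact right_mem_Icc.2 hT.le
  have hc : Tendsto γ (𝓝[Ico 0 T] T) (𝓝 (γ T)) := hγ.continuousAt.mono_left nhdsWithin_le_nhds
  have near : ∀ δ > 0, ∃ r ∈ Ico 0 T, ∀ t ∈ Ico r T, ‖γ t - γ T‖ < δ := by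
    intro δ hδ
    have := (hγ.tendsto T).eventually (Metric.ball_mem_nhds (γ T) hδ)
    obtain ⟨η, hη, hη'⟩ := Metric.eventually_nhds_iff.1 this
    refine ⟨max 0 (T - η / 2), ⟨le_max_left _ _, max_lt hT (by linarith)⟩, ?_⟩
    intro t ht
    have h1 : T - η / 2 ≤ t := (le_max_right _ _).trans ht.1
    rw [← dist_eq_norm]
    apply hη'
    rw [Real.dist_eq, abs_lt]
    constructor <;> linarith [ht.2]
  have tail : ∀ r ∈ Ico 0 T, ∀ᶠ t in 𝓝[Ico 0 T] T, t ∈ Ico r T := by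
    intro r hr
    filter_upwards [self_mem_nhdsWithin, nhdsWithin_le_nhds (Ioi_mem_nhds hr.2)] with t h1 h2
    exact ⟨le_of_lt h2, h1.2⟩
  have hsub : ∀ r ∈ Ico 0 T, Ico r T ⊆ Ico 0 T := fun r hr => Ico_subset_Ico_left hr.1
  obtain ⟨p, hp, hpc⟩ := H.isCompact.exists_mapClusterPt (f := 𝓝[Ico 0 T] T)
    (u := fun t => γ t - c (κ t)) (by
      refine tendsto_principal.2 ?_
      filter_upwards [self_mem_nhdsWithin] with t ht
      exact (H.refl_iff _ _).1 (hκ t ht).1)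
  obtain ⟨δ, hδ, hd⟩ := H.transport p hp
  obtain ⟨r, hr, hr'⟩ := near (δ / 4) (by positivity)
  obtain ⟨t₀, ht₀, ht₀r⟩ := ((hpc.frequently (Metric.ball_mem_nhds p (half_pos hδ))).and_eventually
    (tail r hr)).exists
  have ht₀T : t₀ ∈ Ico 0 T := hsub r hr ht₀r
  have hRi : R (p + c (κ t₀)) (κ t₀) (κ t₀) := by
    rw [H.refl_iff, add_sub_cancel_right]; exact hp
  have star : ∀ t ∈ Ico t₀ T, R (p + c (κ t₀)) (κ t₀) (κ t) := by
    intro t ht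
    refine H.propagate isPreconnected_Ico (hκ.mono (hsub t₀ ht₀T)) ?_ (left_mem_Ico.2 ht₀T.2) ht
      hRi
    intro s hs
    refine hd _ _ (add_sub_cancel_right _ _) _ ?_
    have h1 := hr' s ⟨ht₀r.1.trans hs.1, hs.2⟩
    have h2 := hr' t₀ ht₀r
    rw [dist_eq_norm] at ht₀
    have e : γ s - (p + c (κ t₀)) = (γ s - γ T) - (γ t₀ - γ T) + (γ t₀ - c (κ t₀) - p) := by abel
    rw [e]
    calc _ ≤ ‖(γ s - γ T) - (γ t₀ - γ T)‖ + ‖γ t₀ - c (κ t₀) - p‖ := norm_add_le _ _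
      _ ≤ ‖γ s - γ T‖ + ‖γ t₀ - γ T‖ + ‖γ t₀ - c (κ t₀) - p‖ := by
        gcongr; exact norm_sub_le _ _
      _ < δ := by linarith
  obtain ⟨j, hj⟩ : ∃ j, ∃ᶠ t in 𝓝[Ico 0 T] T, κ t = j := by
    by_contra hn
    push Not at hn
    have h1 : ∀ᶠ t in 𝓝[Ico 0 T] T, ∀ j ∈ {j | R (p + c (κ t₀)) (κ t₀) j}, κ t ≠ j :=
      (eventually_all_finite (H.finite _ _ hRi)).2 fun j _ => hn j
    obtain ⟨t, ht, ht'⟩ := (h1.and (tail t₀ ht₀T)).exists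
    exact ht _ (star t ht') rfl
  have hjP : R (γ T) j j := by
    rw [H.refl_iff]
    have hcj : Tendsto (fun t => γ t - c j) (𝓝[Ico 0 T] T) (𝓝 (γ T - c j)) :=
      hc.sub_const _
    refine H.isCompact.isClosed.mem_of_frequently_of_tendsto ?_ hcj
    refine (hj.and_eventually self_mem_nhdsWithin).mono ?_
    rintro t ⟨rfl, ht⟩
    exact (H.refl_iff _ _).1 (hκ t ht).1
  obtain ⟨δ', hδ', hd'⟩ := H.transport _ ((H.refl_iff _ _).1 hjP)
  obtain ⟨r', hr₁, hr₂⟩ := near δ' hδ'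
  obtain ⟨t₁, ht₁, ht₁r⟩ := (hj.and_eventually (tail r' hr₁)).exists
  have ht₁T := hsub r' hr₁ ht₁r
  refine ⟨j, hjP, t₁, ht₁T, ?_⟩
  intro t ht
  refine H.propagate isPreconnected_Ico (hκ.mono (hsub t₁ ht₁T)) ?_ (left_mem_Ico.2 ht₁T.2) ht
    (by rw [ht₁]; exact hjP)
  intro s hs
  exact hd' _ _ rfl _ (hr₂ s ⟨ht₁r.1.trans hs.1, hs.2⟩)

theorem exists_flatOn (H : IsGluing P G c R) {γ : ℝ → E} (hγ : Continuous γ)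
    (hG : ∀ t ∈ Icc (0 : ℝ) 1, γ t ∈ G) {l : Λ} (hl : R (γ 0) l l) :
    ∃ κ : ℝ → Λ, R (γ 0) l (κ 0) ∧ FlatOn R γ κ (Icc 0 1) := by
  set A : ℝ → Prop := fun T => ∃ κ : ℝ → Λ, R (γ 0) l (κ 0) ∧ FlatOn R γ κ (Icc 0 T) with hA
  have down : ∀ S T, S ≤ T → A T → A S := by
    rintro S T hST ⟨κ, h1, h2⟩
    exact ⟨κ, h1, h2.mono (Icc_subset_Icc_right hST)⟩
  have zero : A 0 := by
    refine ⟨fun _ => l, hl, ?_⟩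
    intro t ht
    have : t = 0 := le_antisymm ht.2 ht.1
    subst this
    exact ⟨hl, Eventually.of_forall fun _ => hl⟩
  refine forall_of_preconnected (A := A) (J := Icc 0 1) isPreconnected_Icc ?_
    (left_mem_Icc.2 zero_le_one) (right_mem_Icc.2 zero_le_one) zero
  intro T hT
  by_cases hex : ∃ y ∈ Ico 0 T, ¬ A y
  · obtain ⟨y, hy, hAy⟩ := hex
    filter_upwards [nhdsWithin_le_nhds (Ioi_mem_nhds hy.2)] with s hs
    exact iff_of_false (fun h => hAy (down _ _ hy.2.le h)) (fun h => hAy (down _ _ (le_of_lt hs) h))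
  push Not at hex
  have hAT : A T := by
    rcases hT.1.eq_or_lt with h0 | h0
    · rw [← h0]; exact zero
    have hch : ∀ y, ∃ κ : ℝ → Λ, y ∈ Ico 0 T → R (γ 0) l (κ 0) ∧ FlatOn R γ κ (Icc 0 y) := by
      intro y
      by_cases hy : y ∈ Ico 0 T
      · obtain ⟨κ, hκ⟩ := hex y hy
        exact ⟨κ, fun _ => hκ⟩
      · exact ⟨fun _ => l, fun h => (hy h).elim⟩
    choose K hK using hch
    set κ : ℝ → Λ := fun y => K y y with hκdef
    have hκ : FlatOn R γ κ (Ico 0 T) := by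
      intro t ht
      obtain ⟨T', h1, h2⟩ := exists_between ht.2
      have hT' : T' ∈ Ico 0 T := ⟨ht.1.trans h1.le, h2⟩
      have hflat : FlatOn R γ κ (Icc 0 T') := by
        refine H.flatOn_congr hγ (hK T' hT').2 ?_
        intro s hs
        have hsT : s ∈ Ico 0 T := ⟨hs.1, hs.2.trans_lt h2⟩
        refine H.agree hγ (J := Icc 0 s) isPreconnected_Icc
          (fun r hr => hG r ⟨hr.1, hr.2.trans (hsT.2.le.trans hT.2)⟩)
          ((hK T' hT').2.mono (Icc_subset_Icc_right hs.2)) (hK s hsT).2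
          (left_mem_Icc.2 hs.1) (right_mem_Icc.2 hs.1) ?_
        exact H.trans _ _ _ _ (H.symm _ _ _ (hK T' hT').1) (hK s hsT).1
      have h3 := hflat t ⟨ht.1, h1.le⟩
      refine ⟨h3.1, ?_⟩
      filter_upwards [eventually_nhdsWithin_iff.1 h3.2 |>.filter_mono nhdsWithin_le_nhds,
        self_mem_nhdsWithin, nhdsWithin_le_nhds (Iio_mem_nhds h1)] with s h4 h5 h6
      exact h4 ⟨h5.1, le_of_lt h6⟩
    obtain ⟨j, hj, t₀, ht₀, hj'⟩ := H.exists_limit_sheet hγ h0 hκ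
    refine ⟨fun t => if t < T then κ t else j, ?_, ?_⟩
    · simp only [h0, if_true]
      exact (hK 0 ⟨le_rfl, h0⟩).1
    · intro t ht
      rcases ht.2.lt_or_eq with htT | htT
      · simp only [htT, if_true]
        have h3 := hκ t ⟨ht.1, htT⟩
        refine ⟨h3.1, ?_⟩
        filter_upwards [eventually_nhdsWithin_iff.1 h3.2 |>.filter_mono nhdsWithin_le_nhds,
          self_mem_nhdsWithin, nhdsWithin_le_nhds (Iio_mem_nhds htT)] with s h4 h5 h6
        rw [if_pos (mem_Iio.1 h6)]
        exact h4 ⟨h5.1, h6⟩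
      · subst htT
        simp only [lt_irrefl, if_false]
        refine ⟨hj, ?_⟩
        filter_upwards [self_mem_nhdsWithin, nhdsWithin_le_nhds (Ioi_mem_nhds ht₀.2)] with s h4 h5
        by_cases hs : s < t
        · rw [if_pos hs]; exact hj' s ⟨le_of_lt h5, hs⟩
        · rw [if_neg hs]; exact hj
  obtain ⟨κ, hκ0, hκ⟩ := hAT
  obtain ⟨ε, hε, κ', h1, h2⟩ := H.exists_local hγ hG hT (hκ T ⟨hT.1, le_rfl⟩).1
  filter_upwards [self_mem_nhdsWithin, nhdsWithin_le_nhds (Metric.ball_mem_nhds T hε)] with s hs hsb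
  refine iff_of_true ⟨κ, hκ0, hκ⟩ ?_
  rcases le_total s T with hsT | hTs
  · exact down _ _ hsT ⟨κ, hκ0, hκ⟩
  · refine ⟨_, ?_, H.flatOn_join hκ (h2.mono ?_) hT.1 hTs h1⟩
    · simpa [hT.1] using hκ0
    · intro r hr
      refine ⟨⟨hT.1.trans hr.1, hr.2.trans hs.2⟩, ?_⟩
      rw [Metric.mem_ball, Real.dist_eq, abs_lt] at hsb ⊢
      constructor <;> linarith [hr.1, hr.2, hsb.1, hsb.2]

/-- Continuing the same sheet along a continuous family of paths gives a flat choice of sheets at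
the endpoints. -/
theorem tube (H : IsGluing P G c R) {Γ : ℝ → ℝ → E}
    (hΓ : Continuous fun q : ℝ × ℝ => Γ q.1 q.2)
    (hG : ∀ t ∈ Icc (0 : ℝ) 1, ∀ s ∈ Icc (0 : ℝ) 1, Γ t s ∈ G) {x : E} (hx : ∀ s, Γ 0 s = x)
    {l : Λ} {κ : ℝ → ℝ → Λ}
    (hκ : ∀ s ∈ Icc (0 : ℝ) 1, R x l (κ s 0) ∧ FlatOn R (fun t => Γ t s) (κ s) (Icc 0 1)) :
    FlatOn R (fun s => Γ 1 s) (fun s => κ s 1) (Icc 0 1) := by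
  intro s₀ hs₀
  refine ⟨((hκ s₀ hs₀).2 1 (right_mem_Icc.2 zero_le_one)).1, ?_⟩
  refine forall_of_preconnected (J := Icc 0 1)
    (A := fun t => ∀ᶠ s in 𝓝[Icc 0 1] s₀, R (Γ t s₀) (κ s₀ t) (κ s t)) isPreconnected_Icc ?_
    (left_mem_Icc.2 zero_le_one) (right_mem_Icc.2 zero_le_one) ?_
  · intro t₀ ht₀
    set w := Γ t₀ s₀ with hw
    set i := κ s₀ t₀ with hi
    have hii := ((hκ s₀ hs₀).2 t₀ ht₀).1
    have hcont : ContinuousAt (fun q : ℝ × ℝ => Γ q.1 q.2) (t₀, s₀) := hΓ.continuousAt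
    have e1 := hcont.eventually (H.eventually_transport hii)
    have e2 := hcont.eventually (H.separated _ (hG _ ht₀ _ hs₀) _ hii)
    obtain ⟨η, hη, hη'⟩ := Metric.eventually_nhds_iff_ball.1 (e1.and e2)
    obtain ⟨η₂, hη₂, hη₂'⟩ := Metric.eventually_nhds_iff_ball.1
      (eventually_nhdsWithin_iff.1 ((hκ s₀ hs₀).2 t₀ ht₀).2)
    have hprod : ∀ t s, t ∈ Metric.ball t₀ (min η η₂) → s ∈ Metric.ball s₀ η →
        (t, s) ∈ Metric.ball (t₀, s₀) η := by
      intro t s ht hs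
      rw [← ball_prod_same]
      exact ⟨Metric.ball_subset_ball (min_le_left _ _) ht, hs⟩
    have hs₀η : s₀ ∈ Metric.ball s₀ η := Metric.mem_ball_self hη
    set U := Icc (0 : ℝ) 1 ∩ Metric.ball t₀ (min η η₂) with hU
    have hUc : IsPreconnected U :=
      ((convex_Icc (0 : ℝ) 1).inter (convex_ball t₀ _)).isPreconnected
    have ht₀U : t₀ ∈ U := ⟨ht₀, Metric.mem_ball_self (lt_min hη hη₂)⟩
    have base : ∀ t ∈ U, R w i (κ s₀ t) := fun t ht =>
      hη₂' t (Metric.ball_subset_ball (min_le_right _ _) ht.2) ht.1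
    set Q' : ℝ → Prop := fun t => ∀ᶠ s in 𝓝[Icc 0 1] s₀, R w i (κ s t) with hQ'
    have a1 : ∀ t ∈ U, (∀ᶠ s in 𝓝[Icc 0 1] s₀, R (Γ t s₀) (κ s₀ t) (κ s t)) → Q' t := by
      intro t ht h
      filter_upwards [h] with s hs
      exact (hη' _ (hprod t s₀ ht.2 hs₀η)).1 _ _ (base t ht) hs
    have a2 : ∀ t ∈ U, ∀ t' ∈ U, Q' t → Q' t' := by
      intro t ht t' ht' h
      filter_upwards [h, self_mem_nhdsWithin, nhdsWithin_le_nhds (Metric.ball_mem_nhds s₀ hη)]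
        with s hs hsI hsη
      refine H.propagate hUc ((hκ s hsI).2.mono inter_subset_left) ?_ ht ht' hs
      intro r hr
      exact (hη' _ (hprod r s hr.2 hsη)).1
    have a3 : ∀ t ∈ U, Q' t → ∀ᶠ s in 𝓝[Icc 0 1] s₀, R (Γ t s₀) (κ s₀ t) (κ s t) := by
      intro t ht h
      have hct : Tendsto (fun s => Γ t s) (𝓝[Icc 0 1] s₀) (𝓝 (Γ t s₀)) := by
        have : Continuous fun s => Γ t s := hΓ.comp (by fun_prop : Continuous fun s : ℝ => (t, s))
        exact this.continuousAt.mono_left nhdsWithin_le_nhds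
      have hz := ((hκ s₀ hs₀).2 t ht.1).1
      filter_upwards [h, self_mem_nhdsWithin, nhdsWithin_le_nhds (Metric.ball_mem_nhds s₀ hη),
        hct.eventually (H.eventually_transport hz),
        hct.eventually (H.cover _ (hG t ht.1 s₀ hs₀) _ hz)] with s hs hsI hsη h4 h5
      exact agree_of_near (hη' _ (hprod t s₀ ht.2 hs₀η)).1 (hη' _ (hprod t s ht.2 hsη)).2 h5 h4
        (base t ht) hs ((hκ s hsI).2 t ht.1).1
    filter_upwards [self_mem_nhdsWithin,
      nhdsWithin_le_nhds (Metric.ball_mem_nhds t₀ (lt_min hη hη₂))] with t ht ht'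
    exact ⟨fun h => a3 t ⟨ht, ht'⟩ (a2 t₀ ht₀U t ⟨ht, ht'⟩ (a1 t₀ ht₀U h)),
      fun h => a3 t₀ ht₀U (a2 t ⟨ht, ht'⟩ t₀ ht₀U (a1 t ⟨ht, ht'⟩ h))⟩
  · filter_upwards [self_mem_nhdsWithin] with s hs
    rw [hx]
    exact H.trans _ _ _ _ (H.symm _ _ _ (hκ s₀ hs₀).1) (hκ s hs).1

end IsGluing

/-- Continuing the sheet `l` along the segment from `x` to `y` leads to the sheet `m`. -/
def Conn (R : E → Λ → Λ → Prop) (x : E) (l : Λ) (y : E) (m : Λ) : Prop :=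
  ∃ κ : ℝ → Λ, R x l (κ 0) ∧ FlatOn R (fun t => AffineMap.lineMap x y t) κ (Icc 0 1) ∧
    R y (κ 1) m

namespace IsGluing

variable {P G : Set E} {c : Λ → E} {R : E → Λ → Λ → Prop}

theorem lineMap_mem {x y : E} {t : ℝ} (ht : t ∈ Icc (0 : ℝ) 1) :
    AffineMap.lineMap x y t ∈ segment ℝ x y := by
  rw [segment_eq_image_lineMap]
  exact mem_image_of_mem _ ht

theorem continuous_line (x y : E) : Continuous fun t : ℝ => AffineMap.lineMap x y t :=
  AffineMap.lineMap_continuous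

theorem exists_conn (H : IsGluing P G c R) {x y : E} (hG : segment ℝ x y ⊆ G) {l : Λ}
    (hl : R x l l) : ∃ l', R y l' l' ∧ Conn R x l y l' := by
  obtain ⟨κ, h1, h2⟩ := H.exists_flatOn (γ := fun t => AffineMap.lineMap x y t) (l := l)
    (continuous_line x y) (fun t ht => hG (lineMap_mem ht)) (by simpa using hl)
  have h3 := (h2 1 (right_mem_Icc.2 zero_le_one)).1
  simp only [AffineMap.lineMap_apply_one, AffineMap.lineMap_apply_zero] at h1 h3
  exact ⟨κ 1, h3, κ, h1, h2, h3⟩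

theorem conn_unique (H : IsGluing P G c R) {x y : E} (hG : segment ℝ x y ⊆ G) {l a b : Λ}
    (ha : Conn R x l y a) (hb : Conn R x l y b) : R y a b := by
  obtain ⟨κ, h1, h2, h3⟩ := ha
  obtain ⟨κ', h1', h2', h3'⟩ := hb
  have := H.agree (continuous_line x y) isPreconnected_Icc (fun t ht => hG (lineMap_mem ht)) h2 h2'
    (left_mem_Icc.2 zero_le_one) (right_mem_Icc.2 zero_le_one)
    (by simpa using H.trans _ _ _ _ (H.symm _ _ _ h1) h1')
  simp only [AffineMap.lineMap_apply_one] at this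
  exact H.trans _ _ _ _ (H.symm _ _ _ h3) (H.trans _ _ _ _ this h3')

theorem conn_trans (H : IsGluing P G c R) {x y z : E} (hG : convexHull ℝ {x, y, z} ⊆ G)
    {l a b : Λ} (ha : Conn R x l y a) (hb : Conn R y a z b) : Conn R x l z b := by
  have hx : x ∈ convexHull ℝ {x, y, z} := subset_convexHull _ _ (by simp)
  have hy : y ∈ convexHull ℝ {x, y, z} := subset_convexHull _ _ (by simp)
  have hz : z ∈ convexHull ℝ {x, y, z} := subset_convexHull _ _ (by simp)
  have hconv : Convex ℝ (convexHull ℝ {x, y, z}) := convex_convexHull _ _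
  have hyz : ∀ s ∈ Icc (0 : ℝ) 1, AffineMap.lineMap y z s ∈ convexHull ℝ {x, y, z} :=
    fun s hs => hconv.segment_subset hy hz (lineMap_mem hs)
  have hll : R x l l := by obtain ⟨κ, h1, -⟩ := ha; exact H.refl_left h1
  have hch : ∀ s : ℝ, ∃ κ : ℝ → Λ, s ∈ Icc (0 : ℝ) 1 → R x l (κ 0) ∧
      FlatOn R (fun t => AffineMap.lineMap x (AffineMap.lineMap y z s : E) t) κ (Icc 0 1) := by
    intro s
    by_cases hs : s ∈ Icc (0 : ℝ) 1
    · obtain ⟨l', -, κ, h1, h2, -⟩ :=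
        H.exists_conn ((hconv.segment_subset hx (hyz s hs)).trans hG) hll
      exact ⟨κ, fun _ => ⟨h1, h2⟩⟩
    · exact ⟨fun _ => l, fun h => (hs h).elim⟩
  choose κ hκ using hch
  have hflat := H.tube (Γ := fun t s => AffineMap.lineMap x (AffineMap.lineMap y z s : E) t)
    (x := x) (l := l) (κ := κ)
    (by simp only [AffineMap.lineMap_apply]; fun_prop)
    (fun t ht s hs => hG (hconv.segment_subset hx (hyz s hs) (lineMap_mem ht)))
    (fun s => AffineMap.lineMap_apply_zero _ _) hκ
  have h0 := hκ 0 (left_mem_Icc.2 zero_le_one)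
  have h1 := hκ 1 (right_mem_Icc.2 zero_le_one)
  simp only [AffineMap.lineMap_apply_zero] at h0
  simp only [AffineMap.lineMap_apply_one] at h1 hflat
  have r0 := (hflat 0 (left_mem_Icc.2 zero_le_one)).1
  have r1 := (hflat 1 (right_mem_Icc.2 zero_le_one)).1
  simp only [AffineMap.lineMap_apply_zero] at r0
  simp only [AffineMap.lineMap_apply_one] at r1
  have hy' : R y a (κ 0 1) := H.conn_unique ((hconv.segment_subset hx hy).trans hG) ha
    ⟨κ 0, h0.1, h0.2, r0⟩
  have hc : Conn R y a z (κ 1 1) := ⟨_, hy', hflat, r1⟩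
  exact ⟨κ 1, h1.1, h1.2, H.conn_unique ((hconv.segment_subset hy hz).trans hG) hc hb⟩

end IsGluing

end Monodromy

section Generic

theorem countable_closure {E : Type*} [AddCommGroup E] {s : Set E} (hs : s.Countable) :
    (AddSubgroup.closure s : Set E).Countable := by
  have := hs.to_subtype
  rw [← Submodule.span_int_eq_addSubgroupClosure, Submodule.coe_toAddSubgroup,
    ← Subtype.range_coe (s := s), ← Finsupp.range_linearCombination, LinearMap.coe_range]
  exact countable_range _

variable {E : Type*} [NormedAddCommGroup E] [InnerProductSpace ℝ E]

theorem dense_compl_hyperplane {n : E} (hn : n ≠ 0) (c : ℝ) : Dense {x : E | ⟪n, x⟫ ≠ c} := by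
  rw [Metric.dense_iff]
  intro x r hr
  by_cases hx : ⟪n, x⟫ = c
  · have hn' : 0 < ‖n‖ := norm_pos_iff.2 hn
    refine ⟨x + (r / 2 / ‖n‖) • n, ?_, ?_⟩
    · rw [mem_ball_iff_norm, add_sub_cancel_left, norm_smul, Real.norm_eq_abs,
        abs_of_pos (by positivity), div_mul_cancel₀ _ hn'.ne']
      linarith
    · show ⟪n, x + (r / 2 / ‖n‖) • n⟫ ≠ c
      rw [inner_add_right, inner_smul_right, real_inner_self_eq_norm_sq, hx]
      have : 0 < r / 2 / ‖n‖ * ‖n‖ ^ 2 := by positivity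
      linarith
  · exact ⟨x, Metric.mem_ball_self hr, hx⟩

theorem dense_avoid_hyperplanes [CompleteSpace E] {A : Type*} [Countable A] (n : A → E)
    (c : A → ℝ) : Dense {x : E | ∀ a, n a ≠ 0 → ⟪n a, x⟫ ≠ c a} := by
  have h : Dense (⋂ a, {x : E | n a ≠ 0 → ⟪n a, x⟫ ≠ c a}) := by
    refine dense_iInter_of_isOpen ?_ ?_
    · intro a
      by_cases ha : n a = 0
      · simp [ha]
      · simp only [ne_eq, ha, not_false_eq_true, forall_const]
        exact isOpen_ne_fun (by fun_prop) continuous_const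
    · intro a
      by_cases ha : n a = 0
      · simp [ha]
      · simp only [ne_eq, ha, not_false_eq_true, forall_const]
        exact dense_compl_hyperplane ha _
  convert h using 1
  ext x
  simp

/-- Three independent normals have a nonzero combination orthogonal to two given vectors. -/
theorem exists_orthogonal_combination (a b c v w : E) :
    ∃ α β γ : ℝ, (α ≠ 0 ∨ β ≠ 0 ∨ γ ≠ 0) ∧ ⟪α • a + β • b + γ • c, v⟫ = 0 ∧
      ⟪α • a + β • b + γ • c, w⟫ = 0 := by
  let f : (Fin 3 → ℝ) →ₗ[ℝ] (Fin 2 → ℝ) :=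
    Matrix.toLin' !![⟪a, v⟫, ⟪b, v⟫, ⟪c, v⟫; ⟪a, w⟫, ⟪b, w⟫, ⟪c, w⟫]
  obtain ⟨x, hx, hx0⟩ := (Submodule.ne_bot_iff _).1
    (LinearMap.ker_ne_bot_of_finrank_lt (f := f) (by simp))
  have h0 := congrFun (LinearMap.mem_ker.1 hx) 0
  have h1 := congrFun (LinearMap.mem_ker.1 hx) 1
  simp [f, Matrix.mulVec, dotProduct, Fin.sum_univ_succ] at h0 h1
  refine ⟨x 0, x 1, x 2, ?_, ?_, ?_⟩
  · by_contra hcon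
    push Not at hcon
    apply hx0
    ext i
    fin_cases i
    · exact hcon.1
    · exact hcon.2.1
    · exact hcon.2.2
  · simp only [inner_add_left, inner_smul_left, RCLike.conj_to_real]
    linarith
  · simp only [inner_add_left, inner_smul_left, RCLike.conj_to_real]
    linarith

end Generic

section Sheets

variable {E : Type*} [NormedAddCommGroup E] [InnerProductSpace ℝ E] {ι : Type*}

/-- The points all of whose representatives in `P` modulo `L` are regular. -/
def regularSet (P : Set E) (u : ι → E) (h : ι → ℝ) (L : AddSubgroup E) : Set E :=
  {w | ∀ l ∈ L, w - l ∈ P → Regular u h (w - l)}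

/-- The sheets `P + l` and `P + m` are identified at `w`. -/
def SheetRel (P : Set E) (u : ι → E) (h : ι → ℝ) (t : ι → E) (L : AddSubgroup E)
    (w : E) (l m : L) : Prop :=
  w - l ∈ P ∧ Glued P u h t (w - l) (w - m)

/-- A dense set of points avoiding the facets, all of whose triangles avoid the triple
intersections of facets. -/
structure IsGenericSet (P : Set E) (u : ι → E) (h : ι → ℝ) (L : AddSubgroup E) (X : Set E) :
    Prop where
  dense : Dense X
  add_mem : ∀ x ∈ X, ∀ l ∈ L, x + l ∈ X
  active_eq : ∀ x ∈ X, ∀ l ∈ L, active u h (x - l) = ∅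
  convexHull_subset : ∀ x ∈ X, ∀ y ∈ X, ∀ z ∈ X, convexHull ℝ {x, y, z} ⊆ regularSet P u h L

theorem exists_isGenericSet [FiniteDimensional ℝ E] [Finite ι] {P : Set E} {u : ι → E}
    {h : ι → ℝ} (hP : IsFacetRep P u h) {L : AddSubgroup E} (hL : (L : Set E).Countable) :
    ∃ X, IsGenericSet P u h L X := by
  obtain ⟨D₀, hD₀c, hD₀⟩ := TopologicalSpace.exists_countable_dense E
  set D := AddSubgroup.closure (D₀ ∪ L) with hD
  have hDc : (D : Set E).Countable := countable_closure (hD₀c.union hL)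
  have hDd : Dense (D : Set E) :=
    hD₀.mono (subset_union_left.trans AddSubgroup.subset_closure)
  have hLD : ∀ l ∈ L, l ∈ D := fun l hl => AddSubgroup.subset_closure (Or.inr hl)
  have : Countable D := hDc.to_subtype
  have : Countable L := hL.to_subtype
  choose α β γ hne h1 h2 using fun q : (ι × ι × ι) × (D × D × D) × L =>
    exists_orthogonal_combination (u q.1.1) (u q.1.2.1) (u q.1.2.2)
      ((q.2.1.2.1 : E) - q.2.1.1) ((q.2.1.2.2 : E) - q.2.1.1)
  have : Countable ((ι × ι × ι) × (D × D × D) × L) := inferInstance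
  obtain ⟨x₀, -, hx₀⟩ := (dense_avoid_hyperplanes (E := E)
    (A := ((ι × ι × ι) × (D × D × D) × L) ⊕ (ι × D × L))
    (Sum.elim (fun q => α q • u q.1.1 + β q • u q.1.2.1 + γ q • u q.1.2.2) (fun q => u q.1))
    (Sum.elim (fun q => α q * h q.1.1 + β q * h q.1.2.1 + γ q * h q.1.2.2 +
      ⟪α q • u q.1.1 + β q • u q.1.2.1 + γ q • u q.1.2.2, (q.2.2 : E) - q.2.1.1⟫)
      (fun q => h q.1 + ⟪u q.1, (q.2.2 : E) - q.2.1⟫))).inter_open_nonempty univ isOpen_univ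
        univ_nonempty
  refine ⟨(fun d => x₀ + d) '' D, ?_, ?_, ?_, ?_⟩
  · exact (Homeomorph.addLeft x₀).surjective.denseRange.dense_image
      (Homeomorph.addLeft x₀).continuous hDd
  · rintro _ ⟨d, hd, rfl⟩ l hl
    exact ⟨d + l, D.add_mem hd (hLD l hl), (add_assoc _ _ _).symm⟩
  · rintro _ ⟨d, hd, rfl⟩ l hl
    rw [eq_empty_iff_forall_notMem]
    intro i hi
    have hui : u i ≠ 0 := by
      intro h0
      have := hP.norm_eq i
      rw [h0, norm_zero] at this
      exact zero_ne_one this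
    refine hx₀ (Sum.inr (i, ⟨d, hd⟩, ⟨l, hl⟩)) hui ?_
    have hi' : ⟪u i, x₀ + d - l⟫ = h i := hi
    simp only [Sum.elim_inr]
    simp only [inner_sub_right, inner_add_right] at hi' ⊢
    linarith
  · rintro _ ⟨d₁, hd₁, rfl⟩ _ ⟨d₂, hd₂, rfl⟩ _ ⟨d₃, hd₃, rfl⟩ w hw l hl hwl i hi j hj k hk
    by_contra hcon
    push Not at hcon
    set q : (ι × ι × ι) × (D × D × D) × L :=
      ((i, j, k), (⟨d₁, hd₁⟩, ⟨d₂, hd₂⟩, ⟨d₃, hd₃⟩), ⟨l, hl⟩) with hq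
    have hn0 : α q • u i + β q • u j + γ q • u k ≠ 0 := by
      intro h0
      have := hP.triple_independent hi hj hk hcon.1 hcon.2.1 hcon.2.2 h0
      rcases hne q with h' | h' | h'
      · exact h' this.1
      · exact h' this.2.1
      · exact h' this.2.2
    refine hx₀ (Sum.inl q) hn0 ?_
    simp only [Sum.elim_inl]
    have e1 := h1 q
    have e2 := h2 q
    have ea : ⟪u i, w - l⟫ = h i := hi
    have eb : ⟪u j, w - l⟫ = h j := hj
    have ec : ⟪u k, w - l⟫ = h k := hk
    set n := α q • u i + β q • u j + γ q • u k with hndef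
    change ⟪n, d₂ - d₁⟫ = 0 at e1
    change ⟪n, d₃ - d₁⟫ = 0 at e2
    have e3 : ⟪n, w - l⟫ = α q * h i + β q * h j + γ q * h k := by
      rw [hndef]
      simp only [inner_add_left, inner_smul_left, RCLike.conj_to_real]
      rw [ea, eb, ec]
    change ⟪n, x₀⟫ = α q * h i + β q * h j + γ q * h k + ⟪n, l - d₁⟫
    rw [← e3]
    have hsub : convexHull ℝ {x₀ + d₁, x₀ + d₂, x₀ + d₃} ⊆ {y : E | ⟪n, y⟫ = ⟪n, x₀ + d₁⟫} := by
      refine convexHull_min ?_ ?_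
      · simp only [inner_sub_right] at e1 e2
        rintro y (rfl | rfl | rfl) <;> show ⟪n, _⟫ = ⟪n, _⟫ <;> simp only [inner_add_right] <;>
          linarith
      · exact convex_hyperplane (f := fun y => ⟪n, y⟫)
          ⟨fun a b => inner_add_right _ _ _, fun c x => by simp [inner_smul_right]⟩ _
    have e4 : ⟪n, w⟫ = ⟪n, x₀ + d₁⟫ := hsub hw
    simp only [inner_sub_right, inner_add_right] at e4 ⊢
    linarith

variable {P : Set E} {u : ι → E} {h : ι → ℝ} {opp : ι → ι} {t : ι → E}

theorem IsFacetRep.eq_iInter (hP : IsFacetRep P u h) : P = ⋂ i, {x | ⟪u i, x⟫ ≤ h i} := by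
  ext x
  simp [hP.mem_iff]

theorem IsFacetRep.isClosed (hP : IsFacetRep P u h) : IsClosed P := by
  rw [hP.eq_iInter]
  exact isClosed_iInter fun i => isClosed_le (by fun_prop) continuous_const

theorem IsFacetRep.convex (hP : IsFacetRep P u h) : Convex ℝ P := by
  rw [hP.eq_iInter]
  exact convex_iInter fun i => convex_halfSpace_le
    ⟨fun a b => inner_add_right _ _ _, fun c x => by simp [inner_smul_right]⟩ _

theorem IsFacetRep.mem_interior_iff [Finite ι] (hP : IsFacetRep P u h) {x : E} :
    x ∈ interior P ↔ ∀ i, ⟪u i, x⟫ < h i := by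
  constructor
  · intro hx i
    obtain ⟨ε, hε, hball⟩ := Metric.mem_nhds_iff.1 (mem_interior_iff_mem_nhds.1 hx)
    have hmem : x + (ε / 2) • u i ∈ P := by
      apply hball
      rw [mem_ball_iff_norm, add_sub_cancel_left, norm_smul, hP.norm_eq, mul_one,
        Real.norm_eq_abs, abs_of_pos (half_pos hε)]
      linarith
    have := hP.le hmem i
    rw [inner_add_right, inner_smul_right, real_inner_self_eq_norm_sq, hP.norm_eq] at this
    linarith
  · intro hx
    have ho : IsOpen (⋂ i, {x | ⟪u i, x⟫ < h i}) :=
      isOpen_iInter_of_finite fun i => isOpen_lt (by fun_prop) continuous_const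
    refine interior_maximal ?_ ho (mem_iInter.2 hx)
    intro y hy
    exact (hP.mem_iff y).2 fun i => le_of_lt (mem_iInter.1 hy i)

namespace IsBelted

theorem isCompact [FiniteDimensional ℝ E] (hP : IsBelted P u h opp t) : IsCompact P :=
  Metric.isCompact_of_isClosed_isBounded hP.toIsFacetRep.isClosed hP.bounded

theorem zero_mem_interior [Finite ι] (hP : IsBelted P u h opp t) : (0 : E) ∈ interior P := by
  rw [hP.toIsFacetRep.mem_interior_iff]
  intro i
  rw [inner_zero_right]
  exact hP.pos i

theorem isGluing [FiniteDimensional ℝ E] [Finite ι] (hP : IsBelted P u h opp t)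
    {L : AddSubgroup E} (hL : L = AddSubgroup.closure (range t)) :
    IsGluing P (regularSet P u h L) (fun l : L => (l : E)) (SheetRel P u h t L) where
  isCompact := hP.isCompact
  symm := fun w j k hjk => ⟨hP.glued_mem hjk.1 hjk.2, hP.glued_symm hjk.2⟩
  trans := fun w i j k h1 h2 => ⟨h1.1, glued_trans h1.2 h2.2⟩
  refl_iff := fun w j => ⟨fun hj => hj.1, fun hj => ⟨hj, glued_refl _⟩⟩
  finite := by
    intro w i hi
    refine ((hP.glued_finite hi.1).preimage (f := fun j : L => w - j) ?_).subset fun j hj => hj.2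
    intro a _ b _ hab
    exact Subtype.ext (sub_right_injective hab)
  transport := by
    intro p hp
    obtain ⟨δ, hδ, hd⟩ := hP.exists_radius hp
    refine ⟨δ, hδ, ?_⟩
    intro w i hwi z hz j k hij hjk
    have e : z - j = (w - j) + (z - w) := by abel
    have h1 := hij.2
    have h2 := hjk.2
    rw [hwi] at h1
    rw [e] at h2
    have h3 := hP.glued_of_near hp hd h1 hz h2
    refine ⟨hij.1, ?_⟩
    rw [hwi]
    convert h3 using 1
    abel
  cover := by
    intro w hw i hi
    obtain ⟨δ, hδ, hd⟩ := hP.exists_radius hi.1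
    filter_upwards [Metric.ball_mem_nhds w hδ] with z hz
    rw [mem_ball_iff_norm] at hz
    obtain ⟨q, hq, hqP⟩ := (hP.locallyTiled_of_regular hi.1 (hw i i.2 hi.1) hd hz).1
    have hmem : w - i - q ∈ L := (SetLike.ext_iff.1 hL _).2 (glued_sub_mem _ _ hq)
    refine ⟨i + ⟨_, hmem⟩, ⟨hi.1, ?_⟩, ?_, glued_refl _⟩
    · convert hq using 1
      simp only [AddSubgroup.coe_add]
      abel
    · convert hqP using 1
      simp only [AddSubgroup.coe_add]
      abel
  separated := by
    intro w hw i hi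
    obtain ⟨δ, hδ, hd⟩ := hP.exists_radius hi.1
    filter_upwards [Metric.ball_mem_nhds w hδ] with z hz j k hj hk hzj hzk
    rw [mem_ball_iff_norm] at hz
    have e : ∀ j : L, z - j = (w - j) + (z - w) := fun j => by abel
    have := (hP.locallyTiled_of_regular hi.1 (hw i i.2 hi.1) hd hz).2 _ _ hj.2 hk.2
      (by rw [← e]; exact hzj.1) (by rw [← e]; exact hzk.1)
    rw [← e, ← e] at this
    exact ⟨hzj.1, this⟩

end IsBelted

end Sheets

section Packing

variable {E : Type*} [NormedAddCommGroup E] [InnerProductSpace ℝ E] {ι : Type*}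
  {P : Set E} {u : ι → E} {h : ι → ℝ} {opp : ι → ι} {t : ι → E} {X : Set E}

/-- The group generated by the facet translations. -/
def facetGroup (t : ι → E) : AddSubgroup E := AddSubgroup.closure (range t)

theorem sheetRel_translate {w m : E} {L : AddSubgroup E} {a b : L} (hm : m ∈ L)
    (H : SheetRel P u h t L w a b) :
    SheetRel P u h t L (w + m) (a + ⟨m, hm⟩) (b + ⟨m, hm⟩) := by
  have e : ∀ c : L, w + m - ((c + ⟨m, hm⟩ : L) : E) = w - c := fun c =>
    add_sub_add_right_eq_sub _ _ _
  refine ⟨?_, ?_⟩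
  · rw [e]; exact H.1
  · rw [e, e]; exact H.2

theorem conn_translate {x y m : E} {L : AddSubgroup E} {a b : L} (hm : m ∈ L)
    (H : Conn (SheetRel P u h t L) x a y b) :
    Conn (SheetRel P u h t L) (x + m) (a + ⟨m, hm⟩) (y + m) (b + ⟨m, hm⟩) := by
  obtain ⟨κ, h1, h2, h3⟩ := H
  refine ⟨fun s => κ s + ⟨m, hm⟩, sheetRel_translate hm h1, ?_, sheetRel_translate hm h3⟩
  have e : ∀ s : ℝ, (AffineMap.lineMap (x + m) (y + m) s : E) = AffineMap.lineMap x y s + m := by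
    intro s
    simp only [AffineMap.lineMap_apply_module]
    module
  intro s hs
  simp only [e]
  refine ⟨sheetRel_translate hm (h2 s hs).1, ?_⟩
  filter_upwards [(h2 s hs).2] with r hr
  exact sheetRel_translate hm hr

theorem conn_of_mem (hconv : Convex ℝ P) {x y : E} {L : AddSubgroup E} {l : L}
    (hx : x - l ∈ P) (hy : y - l ∈ P) : Conn (SheetRel P u h t L) x l y l := by
  refine ⟨fun _ => l, ⟨hx, IsBelted.glued_refl _⟩, ?_, ⟨hy, IsBelted.glued_refl _⟩⟩
  intro s hs
  have hmem : (AffineMap.lineMap x y s : E) - l ∈ P := by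
    have := hconv.segment_subset hx hy (IsGluing.lineMap_mem (x := x - (l : E)) (y := y - l) hs)
    convert this using 1
    simp only [AffineMap.lineMap_apply_module]
    module
  exact ⟨⟨hmem, IsBelted.glued_refl _⟩, Eventually.of_forall fun _ => ⟨hmem, IsBelted.glued_refl _⟩⟩

theorem eq_of_glued_of_active_eq_empty {x y : E} (hx : active u h x = ∅)
    (H : Glued P u h t x y) : y = x := by
  refine IsBelted.glued_mem_of_closed (C := {x}) H rfl ?_
  rintro _ rfl i hi
  rw [hx] at hi
  exact hi.elim

variable [FiniteDimensional ℝ E] [Finite ι]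

namespace IsBelted

theorem mem_closure_interior (hP : IsBelted P u h opp t) {x : E} (hx : x ∈ P) :
    x ∈ closure (interior P) := by
  rw [hP.toIsFacetRep.convex.closure_interior_eq_closure_of_nonempty_interior
    ⟨0, hP.zero_mem_interior⟩]
  exact subset_closure hx

theorem exists_generic_near (hP : IsBelted P u h opp t) (hX : Dense X) {p l : E}
    (hp : p - l ∈ P) {δ : ℝ} (hδ : 0 < δ) :
    ∃ z ∈ X, z - l ∈ interior P ∧ ‖z - p‖ < δ := by
  obtain ⟨q, hq, hq'⟩ := Metric.mem_closure_iff.1 (hP.mem_closure_interior hp) δ hδ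
  have ho : IsOpen {z : E | z - l ∈ interior P ∧ ‖z - p‖ < δ} :=
    (isOpen_interior.preimage (continuous_id.sub continuous_const)).inter
      (isOpen_lt (continuous_id.sub continuous_const).norm continuous_const)
  obtain ⟨z, hz, hzX⟩ := hX.inter_open_nonempty _ ho ⟨q + l, by
    refine ⟨by simpa using hq, ?_⟩
    rw [dist_comm, dist_eq_norm] at hq'
    show ‖q + l - p‖ < δ
    rwa [show q + l - p = q - (p - l) by abel]⟩
  exact ⟨z, hzX, hz.1, hz.2⟩

/-- Short connections near `p` only reach sheets identified at `p`. -/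
theorem glued_of_conn_near (hP : IsBelted P u h opp t) {p : E} (hp : p ∈ P) :
    ∃ δ > 0, ∀ z z' : E, ‖z - p‖ < δ → ‖z' - p‖ < δ → ∀ m : facetGroup t,
      Conn (SheetRel P u h t (facetGroup t)) z 0 z' m → Glued P u h t p (p - m) := by
  have H := hP.isGluing (L := facetGroup t) rfl
  obtain ⟨δ, hδ, hd⟩ := H.transport p hp
  refine ⟨δ, hδ, ?_⟩
  rintro z z' hz hz' m ⟨κ, h1, h2, h3⟩
  have hd' := hd p 0 (by simp)
  have h0 : SheetRel P u h t (facetGroup t) p 0 0 := by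
    rw [H.refl_iff]
    simpa using hp
  have r0 := hd' z hz _ _ h0 h1
  have r1 := H.propagate (w := p) (i := 0) isPreconnected_Icc h2 (by
    intro s hs
    refine hd' _ ?_
    have hb := (convex_ball p δ).segment_subset (mem_ball_iff_norm.2 hz) (mem_ball_iff_norm.2 hz')
      (IsGluing.lineMap_mem hs)
    exact mem_ball_iff_norm.1 hb) (left_mem_Icc.2 zero_le_one) (right_mem_Icc.2 zero_le_one) r0
  have r2 := hd' z' hz' _ _ r1 h3
  simpa using r2.2

theorem conn_facet (hP : IsBelted P u h opp t) (hX : IsGenericSet P u h (facetGroup t) X) (i : ι) :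
    ∃ z ∈ X, ∃ z' ∈ X, z ∈ P ∧ z' - t i ∈ P ∧ ∃ hi : t i ∈ facetGroup t,
      Conn (SheetRel P u h t (facetGroup t)) z 0 z' ⟨t i, hi⟩ := by
  have H := hP.isGluing (L := facetGroup t) rfl
  have hti : t i ∈ facetGroup t := AddSubgroup.subset_closure (mem_range_self i)
  obtain ⟨y, hy, hy'⟩ := hP.exists_facet_point i
  have hyP := hP.mem_of_facet_point hy hy'
  have hact : active u h y = {i} := by
    ext j
    refine ⟨fun hj => ?_, ?_⟩
    · by_contra hne
      exact (hy' j hne).ne hj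
    · rintro rfl
      exact hy
  obtain ⟨δ, hδ, hd⟩ := hP.glued_of_conn_near hyP
  have hit : y - t i ∈ P := hP.sub_mem i y hyP hy
  obtain ⟨z, hzX, hz, hzn⟩ := hP.exists_generic_near hX.dense (p := y) (l := 0)
    (by simpa using hyP) hδ
  obtain ⟨z', hzX', hz', hzn'⟩ := hP.exists_generic_near hX.dense hit hδ
  rw [sub_zero] at hz
  refine ⟨z, hzX, z', hzX', interior_subset hz, interior_subset hz', hti, ?_⟩
  obtain ⟨m, hm, hconn⟩ := H.exists_conn (x := z) (y := z') (l := 0) (by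
    rw [← convexHull_pair]
    have := hX.convexHull_subset z hzX z hzX z' hzX'
    rwa [insert_eq_of_mem (mem_insert z {z'})] at this)
    (by rw [H.refl_iff]; simpa using interior_subset hz)
  have hgl := hd z z' hzn hzn' m hconn
  have hcases : y - (m : E) ∈ ({y, y - t i} : Set E) := by
    refine glued_mem_of_closed hgl (Or.inl rfl) ?_
    rintro _ (rfl | rfl) j hj
    · rw [hact] at hj
      rw [mem_singleton_iff.1 hj]
      exact Or.inr rfl
    · rw [hP.active_sub_singleton hyP hact] at hj
      rw [mem_singleton_iff.1 hj, hP.t_opp, sub_neg_eq_add, sub_add_cancel]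
      exact Or.inl rfl
  rcases hcases with hc | hc
  · exfalso
    have hm0 : (m : E) = 0 := sub_eq_self.1 hc
    have h1 := hP.le hm.1 i
    have h2 := hP.toIsFacetRep.mem_interior_iff.1 hz' (opp i)
    rw [hm0, sub_zero] at h1
    rw [hP.u_opp, hP.h_opp, inner_neg_left, inner_sub_right, hP.inner_t] at h2
    linarith
  · have hm' : m = ⟨t i, hti⟩ := Subtype.ext (sub_right_injective hc)
    rwa [← hm']

theorem exists_generic_zero (hP : IsBelted P u h opp t) (hX : Dense X) : ∃ x ∈ X, x ∈ P := by
  obtain ⟨z, hz, hzP, -⟩ := hP.exists_generic_near hX (p := 0) (l := 0)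
    (by simpa using interior_subset hP.zero_mem_interior) one_pos
  exact ⟨z, hz, by simpa using interior_subset hzP⟩

theorem _root_.TranslationTiling.IsGenericSet.eq_of_sheetRel
    (hX : IsGenericSet P u h (facetGroup t) X)
    {y : E} (hy : y ∈ X) {l l' : facetGroup t} (H : SheetRel P u h t (facetGroup t) y l l') :
    l = l' := by
  have := eq_of_glued_of_active_eq_empty (hX.active_eq y hy l l.2) H.2
  exact (Subtype.ext (sub_right_injective this)).symm

theorem conn_add (hP : IsBelted P u h opp t) (hX : IsGenericSet P u h (facetGroup t) X)
    (m : facetGroup t) : ∀ x ∈ X, x ∈ P →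
      Conn (SheetRel P u h t (facetGroup t)) x 0 (x + m) m := by
  have H := hP.isGluing (L := facetGroup t) rfl
  have hconv := hP.toIsFacetRep.convex
  have self : ∀ x ∈ P, ∀ y ∈ P, Conn (SheetRel P u h t (facetGroup t)) x 0 y 0 :=
    fun x hx y hy => conn_of_mem hconv (by simpa using hx) (by simpa using hy)
  obtain ⟨m, hm⟩ := m
  refine AddSubgroup.closure_induction (p := fun m hm => ∀ x ∈ X, x ∈ P →
      Conn (SheetRel P u h t (facetGroup t)) x 0 (x + m) ⟨m, hm⟩) ?_ ?_ ?_ ?_ hm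
  · rintro _ ⟨i, rfl⟩ x hxX hx
    obtain ⟨z, hzX, z', hzX', hz, hz', hi, hconn⟩ := hP.conn_facet hX i
    have h1 := H.conn_trans (hX.convexHull_subset x hxX z hzX z' hzX') (self x hx z hz) hconn
    exact H.conn_trans (hX.convexHull_subset x hxX z' hzX' _ (hX.add_mem x hxX _ hi)) h1
      (conn_of_mem hconv hz' (by simpa using hx))
  · intro x _ hx
    rw [add_zero]
    exact self x hx x hx
  · intro a b ha hb iha ihb x hxX hx
    have h1 := conn_translate (L := facetGroup t) (m := a) ha (ihb x hxX hx)
    rw [zero_add] at h1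
    have h2 := H.conn_trans (hX.convexHull_subset x hxX _ (hX.add_mem x hxX a ha) _
      (hX.add_mem _ (hX.add_mem x hxX b hb) a ha)) (iha x hxX hx)
        h1
    have e : x + (a + b) = x + b + a := by abel
    rw [e]
    convert h2 using 1
    exact Subtype.ext (add_comm a b)
  · intro a ha iha x hxX hx
    have hna := (facetGroup t).neg_mem ha
    have hxa := hX.add_mem x hxX a ha
    have hRa : SheetRel P u h t (facetGroup t) (x + a) ⟨a, ha⟩ ⟨a, ha⟩ := by
      rw [H.refl_iff]; simpa using hx
    obtain ⟨m, hm, hconn⟩ := H.exists_conn (x := x + a) (y := x) (l := ⟨a, ha⟩) (by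
      rw [← convexHull_pair]
      have := hX.convexHull_subset _ hxa _ hxa x hxX
      rwa [insert_eq_of_mem (mem_insert (x + a) {x})] at this) hRa
    have h1 := H.conn_trans (hX.convexHull_subset x hxX _ hxa x hxX) (iha x hxX hx) hconn
    have h2 := H.conn_unique (by
      rw [← convexHull_pair]
      have := hX.convexHull_subset _ hxX _ hxX x hxX
      rwa [insert_eq_of_mem (mem_insert x {x})] at this) h1 (self x hx x hx)
    rw [hX.eq_of_sheetRel hxX h2] at hconn
    have h3 := conn_translate (m := -a) hna hconn
    convert h3 using 1
    · rw [add_neg_cancel_right]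
    · exact Subtype.ext (add_neg_cancel a).symm
    · exact (zero_add _).symm

theorem generic_packing (hP : IsBelted P u h opp t) (hX : IsGenericSet P u h (facetGroup t) X)
    {y : E} (hy : y ∈ X) {l l' : facetGroup t} (hl : y - l ∈ P) (hl' : y - l' ∈ P) : l = l' := by
  have H := hP.isGluing (L := facetGroup t) rfl
  have mem : ∀ l : facetGroup t, y - l ∈ X := fun l => by
    rw [sub_eq_add_neg]
    exact hX.add_mem y hy _ ((facetGroup t).neg_mem l.2)
  have h1 := hP.conn_add hX l _ (mem l) hl
  have h2 := hP.conn_add hX l' _ (mem l') hl'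
  rw [sub_add_cancel] at h1 h2
  have h0 : Conn (SheetRel P u h t (facetGroup t)) (y - l) 0 (y - l') 0 :=
    conn_of_mem hP.toIsFacetRep.convex (by simpa using hl) (by simpa using hl')
  have h3 := H.conn_trans (hX.convexHull_subset _ (mem l) _ (mem l') _ hy) h0 h2
  refine hX.eq_of_sheetRel hy (H.conn_unique ?_ h1 h3)
  rw [← convexHull_pair]
  have := hX.convexHull_subset _ (mem l) _ (mem l) y hy
  rwa [insert_eq_of_mem (mem_insert (y - (l : E)) {y})] at this

theorem exists_isGenericSet (hP : IsBelted P u h opp t) :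
    ∃ X, IsGenericSet P u h (facetGroup t) X :=
  TranslationTiling.exists_isGenericSet hP.toIsFacetRep (countable_closure (countable_range t))

theorem interiors_disjoint (hP : IsBelted P u h opp t) {x l : E} (hl : l ∈ facetGroup t)
    (hx : x ∈ interior P) (hxl : x - l ∈ interior P) : l = 0 := by
  obtain ⟨X, hX⟩ := hP.exists_isGenericSet
  have ho : IsOpen {z : E | z ∈ interior P ∧ z - l ∈ interior P} :=
    isOpen_interior.inter (isOpen_interior.preimage (continuous_id.sub continuous_const))
  obtain ⟨z, hz, hzX⟩ := hX.dense.inter_open_nonempty _ ho ⟨x, hx, hxl⟩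
  have := hP.generic_packing hX hzX (l := ⟨l, hl⟩) (l' := 0) (interior_subset hz.2)
    (by simpa using interior_subset hz.1)
  exact congrArg Subtype.val this

theorem discreteTopology (hP : IsBelted P u h opp t) : DiscreteTopology (facetGroup t) := by
  refine discreteTopology_of_isOpen_singleton_zero ?_
  have : ({0} : Set (facetGroup t)) = Subtype.val ⁻¹' (interior P) := by
    ext l
    refine ⟨?_, fun hl => ?_⟩
    · rintro rfl
      exact hP.zero_mem_interior
    · exact Subtype.ext (hP.interiors_disjoint l.2 hl (by simpa using hP.zero_mem_interior))
  rw [this]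
  exact isOpen_interior.preimage continuous_subtype_val

theorem finite_inter (hP : IsBelted P u h opp t) {K : Set E} (hK : Bornology.IsBounded K) :
    (K ∩ facetGroup t).Finite := by
  have := hP.discreteTopology
  exact Metric.finite_isBounded_inter_isClosed ⟨this⟩ hK AddSubgroup.isClosed_of_discrete

theorem exists_mem_translate (hP : IsBelted P u h opp t) (x : E) :
    ∃ l ∈ facetGroup t, x - l ∈ P := by
  obtain ⟨X, hX⟩ := hP.exists_isGenericSet
  have H := hP.isGluing (L := facetGroup t) rfl
  obtain ⟨x₁, hx₁X, hx₁⟩ := hP.exists_generic_zero hX.dense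
  have hgen : ∀ y ∈ X, ∃ l ∈ facetGroup t, y - l ∈ P := by
    intro y hy
    obtain ⟨l, hl, -⟩ := H.exists_conn (x := x₁) (y := y) (l := 0) (by
      rw [← convexHull_pair]
      have := hX.convexHull_subset _ hx₁X _ hx₁X y hy
      rwa [insert_eq_of_mem (mem_insert x₁ {y})] at this)
      (by rw [H.refl_iff]; simpa using hx₁)
    exact ⟨l, l.2, hl.1⟩
  have hfin := hP.finite_inter (K := Metric.ball x 1 - P) (Metric.isBounded_ball.sub hP.bounded)
  have hcl : IsClosed (⋃ l ∈ (Metric.ball x 1 - P) ∩ (facetGroup t : Set E), {y : E | y - l ∈ P}) :=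
    hfin.isClosed_biUnion fun l _ =>
      hP.toIsFacetRep.isClosed.preimage (continuous_id.sub continuous_const)
  have hsub : Metric.ball x 1 ∩ X ⊆
      ⋃ l ∈ (Metric.ball x 1 - P) ∩ (facetGroup t : Set E), {y : E | y - l ∈ P} := by
    rintro y ⟨hy, hyX⟩
    obtain ⟨l, hl, hlP⟩ := hgen y hyX
    refine mem_biUnion (x := l) ⟨⟨y, hy, y - l, hlP, sub_sub_cancel y l⟩, hl⟩ hlP
  have hx : x ∈ closure (Metric.ball x 1 ∩ X) :=
    hX.dense.open_subset_closure_inter Metric.isOpen_ball (Metric.mem_ball_self one_pos)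
  have := closure_minimal hsub hcl hx
  simp only [mem_iUnion] at this
  obtain ⟨l, hl, hlP⟩ := this
  exact ⟨l, hl.2, hlP⟩

theorem glued_of_mem (hP : IsBelted P u h opp t) {x l : E} (hl : l ∈ facetGroup t)
    (hx : x ∈ P) (hxl : x - l ∈ P) : Glued P u h t x (x - l) := by
  obtain ⟨X, hX⟩ := hP.exists_isGenericSet
  have H := hP.isGluing (L := facetGroup t) rfl
  obtain ⟨δ, hδ, hd⟩ := hP.glued_of_conn_near hx
  obtain ⟨z, hzX, hz, hzn⟩ := hP.exists_generic_near hX.dense (p := x) (l := 0)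
    (by simpa using hx) hδ
  obtain ⟨z', hzX', hz', hzn'⟩ := hP.exists_generic_near hX.dense hxl hδ
  rw [sub_zero] at hz
  have h1 := hP.conn_add hX ⟨l, hl⟩ z hzX (interior_subset hz)
  refine hd z z' hzn hzn' ⟨l, hl⟩ (H.conn_trans
    (hX.convexHull_subset z hzX _ (hX.add_mem z hzX l hl) z' hzX') h1 ?_)
  exact conn_of_mem hP.toIsFacetRep.convex (by simpa using interior_subset hz)
    (interior_subset hz')

theorem sub_mem_of_openSegment (hP : IsBelted P u h opp t) {x y z l : E}
    (hl : l ∈ facetGroup t) (hx : x ∈ P) (hy : y ∈ P) (hz : z ∈ openSegment ℝ x y)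
    (hzl : z - l ∈ P) : x - l ∈ P := by
  have hzP : z ∈ P := hP.toIsFacetRep.convex.openSegment_subset hx hy hz
  have hact : active u h z ⊆ active u h x := by
    intro i hi
    obtain ⟨a, b, ha, hb, hab, rfl⟩ := hz
    have h1 := hP.le hx i
    have h2 := hP.le hy i
    have h3 : ⟪u i, a • x + b • y⟫ = h i := hi
    rw [inner_add_right, inner_smul_right, inner_smul_right] at h3
    refine le_antisymm h1 ?_
    by_contra hlt
    push Not at hlt
    have h4 := mul_lt_mul_of_pos_left hlt ha
    have h5 := mul_le_mul_of_nonneg_left h2 hb.le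
    have h6 : a * h i + b * h i = h i := by rw [← add_mul, hab, one_mul]
    linarith
  have := (hP.glued_translate (hP.glued_of_mem hl hzP hzl) hx hact).1
  convert this using 1
  abel

theorem span_facetGroup (hP : IsBelted P u h opp t) :
    Submodule.span ℝ (facetGroup t : Set E) = ⊤ := by
  rw [← Submodule.orthogonal_eq_bot_iff, Submodule.eq_bot_iff]
  intro v hv
  by_contra hv0
  have hpos : 0 < ‖v‖ := norm_pos_iff.2 hv0
  obtain ⟨r, hr⟩ := hP.bounded.exists_norm_le
  obtain ⟨n, hn⟩ := exists_nat_gt (r / ‖v‖)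
  rw [div_lt_iff₀ hpos] at hn
  obtain ⟨l, hl, hlP⟩ := hP.exists_mem_translate ((n : ℝ) • v)
  have h1 := hr _ hlP
  have h0 : ⟪v, l⟫ = 0 := Submodule.inner_left_of_mem_orthogonal (Submodule.subset_span hl) hv
  have h2 := real_inner_le_norm v ((n : ℝ) • v - l)
  rw [inner_sub_right, h0, sub_zero, inner_smul_right, real_inner_self_eq_norm_sq] at h2
  nlinarith [norm_nonneg ((n : ℝ) • v - l)]

theorem exists_basis (hP : IsBelted P u h opp t) :
    ∃ b : Fin (Module.finrank ℝ E) → E, LinearIndependent ℝ b ∧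
      (Submodule.span ℤ (range b) : Set E) = facetGroup t := by
  let L : Submodule ℤ E := AddSubgroup.toIntSubmodule (facetGroup t)
  have : DiscreteTopology L := hP.discreteTopology
  have : IsZLattice ℝ L := ⟨hP.span_facetGroup⟩
  let b₀ := (Module.finBasis ℤ L).ofZLatticeBasis ℝ L
  let b := b₀.reindex (finCongr (ZLattice.rank ℝ L))
  refine ⟨b, b.linearIndependent, ?_⟩
  rw [Module.Basis.range_reindex, Module.Basis.ofZLatticeBasis_span]
  rfl

end IsBelted

end Packing

section TranslateTiling

variable {E : Type*} [NormedAddCommGroup E] [InnerProductSpace ℝ E] [FiniteDimensional ℝ E]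

/-- The translates `s + P`, `s ∈ S`, cover the space and have disjoint interiors. -/
structure TranslateTiling (P S : Set E) : Prop where
  cover : ∀ x, ∃ s ∈ S, x - s ∈ P
  disjoint : ∀ s ∈ S, ∀ s' ∈ S, ∀ x, x - s ∈ interior P → x - s' ∈ interior P → s = s'

namespace TranslateTiling

variable {P S : Set E}

theorem translate (hT : TranslateTiling P S) (a : E) : TranslateTiling P ((· - a) '' S) where
  cover x := by
    obtain ⟨s, hs, hx⟩ := hT.cover (x + a)
    exact ⟨s - a, mem_image_of_mem _ hs, by rwa [sub_sub_eq_add_sub]⟩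
  disjoint := by
    rintro _ ⟨s, hs, rfl⟩ _ ⟨s', hs', rfl⟩ x hx hx'
    rw [hT.disjoint s hs s' hs' (x + a) (by rwa [add_sub_assoc, ← neg_sub s a, ← sub_eq_add_neg])
      (by rwa [add_sub_assoc, ← neg_sub s' a, ← sub_eq_add_neg])]

theorem exists_separation (hT : TranslateTiling P S) (hne : (interior P).Nonempty) :
    ∃ r > 0, S.Pairwise fun x y => r ≤ dist x y := by
  obtain ⟨x, hx⟩ := hne
  obtain ⟨r, hr, hball⟩ := Metric.isOpen_iff.1 isOpen_interior x hx
  refine ⟨r, hr, fun s hs s' hs' hss' => ?_⟩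
  by_contra hlt
  push Not at hlt
  refine hss' (hT.disjoint s hs s' hs' (x + s) (by simpa using hx) (hball ?_))
  rw [Metric.mem_ball, dist_eq_norm]
  rw [dist_eq_norm] at hlt
  rwa [show x + s - s' - x = s - s' by abel]

theorem finite_inter (hT : TranslateTiling P S) (hne : (interior P).Nonempty) {K : Set E}
    (hK : Bornology.IsBounded K) : (K ∩ S).Finite := by
  obtain ⟨r, hr, hsep⟩ := hT.exists_separation hne
  have hcl : IsClosed S := Metric.isClosed_of_pairwise_le_dist hr hsep
  have hd : IsDiscrete S := by
    rw [isDiscrete_iff_discreteTopology]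
    refine DiscreteTopology.of_forall_le_dist hr fun x y hxy => ?_
    exact hsep x.2 y.2 (Subtype.coe_injective.ne hxy)
  exact Metric.finite_isBounded_inter_isClosed hd hK hcl

theorem countable (hT : TranslateTiling P S) (hne : (interior P).Nonempty) : S.Countable := by
  have : S = ⋃ n : ℕ, Metric.ball 0 n ∩ S := by
    rw [← iUnion_inter, Metric.iUnion_ball_nat, univ_inter]
  rw [this]
  exact countable_iUnion fun n => (hT.finite_inter hne Metric.isBounded_ball).countable

theorem finite_near (hT : TranslateTiling P S) (hne : (interior P).Nonempty)
    (hP : Bornology.IsBounded P) {K : Set E} (hK : Bornology.IsBounded K) :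
    {s ∈ S | ∃ x ∈ K, x - s ∈ P}.Finite := by
  refine (hT.finite_inter hne (hK.sub hP)).subset ?_
  rintro s ⟨hs, x, hx, hxs⟩
  exact ⟨⟨x, hx, x - s, hxs, sub_sub_cancel x s⟩, hs⟩

/-- Near a point `p`, only the tiles containing `p` matter. -/
theorem eventually_mem (hT : TranslateTiling P S) (hne : (interior P).Nonempty)
    (hP : Bornology.IsBounded P) (hcl : IsClosed P) (p : E) :
    ∀ᶠ v in 𝓝 (0 : E), ∀ s ∈ S, p + v - s ∈ P → p - s ∈ P := by
  have hfin := hT.finite_near hne hP (Metric.isBounded_ball (x := p) (r := 1))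
  have h1 : ∀ᶠ v in 𝓝 (0 : E), ∀ s ∈ {s ∈ S | ∃ x ∈ Metric.ball p 1, x - s ∈ P},
      p + v - s ∈ P → p - s ∈ P := by
    refine (eventually_all_finite hfin).2 fun s _ => ?_
    by_cases hps : p - s ∈ P
    · exact Eventually.of_forall fun _ _ => hps
    · have hc : ContinuousAt (fun v : E => p + v - s) 0 := by fun_prop
      have : Pᶜ ∈ 𝓝 (p + (0 : E) - s) := hcl.isOpen_compl.mem_nhds (by simpa using hps)
      filter_upwards [hc this] with v hv hv'
      exact absurd hv' hv
  filter_upwards [h1, Metric.ball_mem_nhds (0 : E) one_pos] with v hv hv1 s hs hvs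
  exact hv s ⟨hs, p + v, by simpa using hv1, hvs⟩ hvs

end TranslateTiling

/-- A bounded polytope that is symmetric about the origin, with its facet description. -/
structure IsSymmetricRep {ι : Type*} (P : Set E) (u : ι → E) (h : ι → ℝ) (opp : ι → ι) : Prop
    extends IsFacetRep P u h where
  bounded : Bornology.IsBounded P
  pos : ∀ i, 0 < h i
  u_opp : ∀ i, u (opp i) = -u i
  h_opp : ∀ i, h (opp i) = h i

end TranslateTiling

section Belts

variable {E : Type*} [NormedAddCommGroup E] [InnerProductSpace ℝ E] [FiniteDimensional ℝ E]
variable {ι : Type*} [Finite ι] {P S : Set E} {u : ι → E} {h : ι → ℝ} {opp : ι → ι}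

namespace IsSymmetricRep

theorem zero_mem_interior (hP : IsSymmetricRep P u h opp) : (0 : E) ∈ interior P := by
  rw [hP.mem_interior_iff]
  simpa using hP.pos

theorem opp_opp (hP : IsSymmetricRep P u h opp) (i : ι) : opp (opp i) = i :=
  hP.injective (by rw [hP.u_opp, hP.u_opp, neg_neg])

theorem neg_mem (hP : IsSymmetricRep P u h opp) {x : E} (hx : x ∈ P) : -x ∈ P := by
  rw [hP.mem_iff]
  intro i
  have := hP.le hx (opp i)
  rwa [hP.u_opp, hP.h_opp, inner_neg_left, ← inner_neg_right] at this

theorem active_neg (hP : IsSymmetricRep P u h opp) {x : E} {i j : ι}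
    (hx : active u h x = {opp i, j}) : active u h (-x) = {i, opp j} := by
  ext k
  have h1 : k ∈ active u h (-x) ↔ opp k ∈ active u h x := by
    simp [active, hP.u_opp, hP.h_opp]
  rw [h1, hx]
  simp only [mem_insert_iff, mem_singleton_iff]
  refine or_congr ⟨fun e => ?_, fun e => by rw [e]⟩ ⟨fun e => ?_, fun e => ?_⟩
  · rw [← hP.opp_opp k, e, hP.opp_opp]
  · rw [← e, hP.opp_opp]
  · rw [e, hP.opp_opp]

end IsSymmetricRep

namespace TranslateTiling

theorem local_cover (hT : TranslateTiling P S) (hP : IsSymmetricRep P u h opp) (p v : E) :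
    ∃ s ∈ S, p - s ∈ P ∧ ∀ k ∈ active u h (p - s), ⟪u k, v⟫ ≤ 0 := by
  have hne : (interior P).Nonempty := ⟨0, hP.zero_mem_interior⟩
  have h1 := hT.eventually_mem hne hP.bounded hP.isClosed p
  have h2 : Tendsto (fun ε : ℝ => ε • v) (𝓝[>] 0) (𝓝 0) := by
    have : Tendsto (fun ε : ℝ => ε • v) (𝓝 0) (𝓝 ((0 : ℝ) • v)) := by
      exact (continuous_id.smul continuous_const).tendsto 0
    rw [zero_smul] at this
    exact this.mono_left nhdsWithin_le_nhds
  obtain ⟨ε, hε, hpos⟩ := ((h2.eventually h1).and self_mem_nhdsWithin).exists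
  replace hpos : 0 < ε := hpos
  obtain ⟨s, hs, hxs⟩ := hT.cover (p + ε • v)
  refine ⟨s, hs, hε s hs hxs, fun k hk => ?_⟩
  have h3 := hP.le hxs k
  have h4 : ⟪u k, p - s⟫ = h k := hk
  rw [show p + ε • v - s = (p - s) + ε • v by abel, inner_add_right, h4, inner_smul_right] at h3
  nlinarith

theorem local_disjoint (hT : TranslateTiling P S) (hP : IsSymmetricRep P u h opp) {p v s s' : E}
    (hs : s ∈ S) (hs' : s' ∈ S) (hps : p - s ∈ P) (hps' : p - s' ∈ P)
    (hv : ∀ k ∈ active u h (p - s), ⟪u k, v⟫ < 0)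
    (hv' : ∀ k ∈ active u h (p - s'), ⟪u k, v⟫ < 0) : s = s' := by
  have key : ∀ q ∈ P, (∀ k ∈ active u h q, ⟪u k, v⟫ < 0) →
      ∀ᶠ ε in 𝓝[>] (0 : ℝ), q + ε • v ∈ interior P := by
    intro q hq hqv
    obtain ⟨δ, hδ, hd⟩ := IsBelted.eventually_active_subset hP.toIsFacetRep hq
    have h2 : Tendsto (fun ε : ℝ => ‖ε • v‖) (𝓝[>] 0) (𝓝 0) := by
      have : Tendsto (fun ε : ℝ => ‖ε • v‖) (𝓝 0) (𝓝 ‖(0 : ℝ) • v‖) := by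
        exact (continuous_id.smul continuous_const).norm.tendsto 0
      rw [zero_smul, norm_zero] at this
      exact this.mono_left nhdsWithin_le_nhds
    filter_upwards [h2.eventually (gt_mem_nhds hδ), self_mem_nhdsWithin] with ε h3 hε
    rw [hP.mem_interior_iff]
    intro k
    by_cases hk : k ∈ active u h q
    · have h4 : ⟪u k, q⟫ = h k := hk
      rw [inner_add_right, h4, inner_smul_right]
      have := mul_neg_of_pos_of_neg (show 0 < ε from hε) (hqv k hk)
      linarith
    · exact hd _ h3 k hk
  obtain ⟨ε, h1, h2⟩ := ((key _ hps hv).and (key _ hps' hv')).exists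
  exact hT.disjoint s hs s' hs' (p + ε • v) (by convert h1 using 1; abel)
    (by convert h2 using 1; abel)

/-- Every ridge contains a point at which all tight inequalities of all tiles have normals in the
plane of the two facet normals. -/
theorem exists_generic_ridge_point (hT : TranslateTiling P S) (hP : IsSymmetricRep P u h opp)
    {i j : ι} (hij : Ridge P u h i j) :
    ∃ p ∈ P, active u h p = {i, j} ∧ ∀ s ∈ S, ∀ k ∈ active u h (p - s),
      ∃ α β : ℝ, u k = α • u i + β • u j := by
  obtain ⟨hne, p, hp, hpa⟩ := hij
  have hPint : (interior P).Nonempty := ⟨0, hP.zero_mem_interior⟩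
  let V : Submodule ℝ E := Submodule.span ℝ {u i, u j}
  obtain ⟨δ, hδ, hd⟩ := IsBelted.eventually_active_subset hP.toIsFacetRep hp
  have := (hT.countable hPint).to_subtype
  have : Countable ι := Finite.to_countable
  have hdense := dense_avoid_hyperplanes (A := S × ι)
    (fun a => Vᗮ.orthogonalProjectionOnto (u a.2)) (fun a => h a.2 - ⟪u a.2, p - a.1⟫)
  obtain ⟨w, hw, hwδ⟩ := hdense.exists_mem_open Metric.isOpen_ball
    ⟨0, Metric.mem_ball_self (x := (0 : Vᗮ)) hδ⟩
  have hproj : ∀ k, ⟪Vᗮ.orthogonalProjectionOnto (u k), w⟫ = ⟪u k, (w : E)⟫ := by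
    intro k
    exact Submodule.inner_orthogonalProjectionOnto_eq_of_mem_right w (u k)
  have hi0 : ⟪u i, (w : E)⟫ = 0 :=
    Submodule.inner_right_of_mem_orthogonal (Submodule.subset_span (by simp)) w.2
  have hj0 : ⟪u j, (w : E)⟫ = 0 :=
    Submodule.inner_right_of_mem_orthogonal (Submodule.subset_span (by simp)) w.2
  have hwn : ‖(w : E)‖ < δ := by simpa using hwδ
  have hd := hd _ hwn
  have hact : ∀ k ∈ active u h p, ⟪u k, (w : E)⟫ = 0 := by
    rw [hpa]
    rintro k (rfl | rfl)
    · exact hi0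
    · exact hj0
  refine ⟨p + w, (IsBelted.add_mem_iff hP.toIsFacetRep hd).2 fun k hk => (hact k hk).le, ?_, ?_⟩
  · rw [← hpa]
    ext k
    constructor
    · intro hk
      by_contra hk'
      exact (hd k hk').ne hk
    · intro hk
      have h4 : ⟪u k, p⟫ = h k := hk
      show ⟪u k, p + w⟫ = h k
      rw [inner_add_right, h4, hact k hk, add_zero]
  · intro s hs k hk
    have h1 : Vᗮ.orthogonalProjectionOnto (u k) = 0 := by
      by_contra hne0
      apply hw (⟨s, hs⟩, k) hne0
      show ⟪Vᗮ.orthogonalProjectionOnto (u k), w⟫ = _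
      rw [hproj]
      have h4 : ⟪u k, p + w - s⟫ = h k := hk
      rw [← h4, ← inner_sub_right]
      congr 1
      abel
    rw [Submodule.orthogonalProjectionOnto_eq_zero_iff, Submodule.orthogonal_orthogonal] at h1
    obtain ⟨α, β, h⟩ := Submodule.mem_span_pair.1 h1
    exact ⟨α, β, h.symm⟩

end TranslateTiling

end Belts

section BeltExistence

variable {E : Type*} [NormedAddCommGroup E] [InnerProductSpace ℝ E] [FiniteDimensional ℝ E]
variable {ι : Type*} [Finite ι] {P S : Set E} {u : ι → E} {h : ι → ℝ} {opp : ι → ι}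

/-- Two independent vectors admit a dual pair. -/
theorem exists_dual_pair {a b : E} (hab : ∀ x y : ℝ, x • a + y • b = 0 → x = 0 ∧ y = 0) :
    ∃ f g : E, ∀ x y α β : ℝ, ⟪α • a + β • b, x • f + y • g⟫ = α * x + β * y := by
  have key : ∀ a b : E, (∀ x y : ℝ, x • a + y • b = 0 → x = 0 ∧ y = 0) →
      ∃ f, ⟪a, f⟫ = 1 ∧ ⟪b, f⟫ = 0 := by
    intro a b hab
    have hb : b ≠ 0 := fun hb => one_ne_zero (hab 0 1 (by simp [hb])).2
    have hbb : ⟪b, b⟫ ≠ 0 := inner_self_ne_zero.2 hb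
    set f := a - (⟪b, a⟫ / ⟪b, b⟫) • b with hf
    have h0 : ⟪b, f⟫ = 0 := by
      rw [hf, inner_sub_right, inner_smul_right]
      field_simp
      ring
    have hf0 : f ≠ 0 := by
      intro h1
      refine one_ne_zero (hab 1 (-(⟪b, a⟫ / ⟪b, b⟫)) ?_).1
      rw [one_smul, neg_smul, ← sub_eq_add_neg, ← hf, h1]
    have haf : ⟪a, f⟫ = ⟪f, f⟫ := by
      conv_rhs => rw [hf, inner_sub_left, inner_smul_left, ← hf, h0]
      simp
    refine ⟨(⟪f, f⟫)⁻¹ • f, ?_, ?_⟩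
    · rw [inner_smul_right, haf, inv_mul_cancel₀ (inner_self_ne_zero.2 hf0)]
    · rw [inner_smul_right, h0, mul_zero]
  obtain ⟨f, hf1, hf2⟩ := key a b hab
  obtain ⟨g, hg1, hg2⟩ := key b a fun x y hxy => (hab y x (by rw [add_comm, hxy])).symm
  refine ⟨f, g, fun x y α β => ?_⟩
  simp only [inner_add_left, inner_add_right, inner_smul_left, inner_smul_right, hf1, hf2, hg1, hg2,
    conj_trivial]
  ring

/-- A point at which the normals of all tight inequalities of all tiles lie in the plane of
`u i` and `u j`. -/
structure IsGenericRidge (P S : Set E) (u : ι → E) (h : ι → ℝ) (i j : ι) (p : E) : Prop where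
  mem : p ∈ P
  active_eq : active u h p = {i, j}
  planar : ∀ s ∈ S, ∀ k ∈ active u h (p - s), ∃ α β : ℝ, u k = α • u i + β • u j

theorem IsGenericRidge.symm {i j : ι} {p : E} (hp : IsGenericRidge P S u h i j p) :
    IsGenericRidge P S u h j i p where
  mem := hp.mem
  active_eq := by rw [hp.active_eq, pair_comm]
  planar s hs k hk := by
    obtain ⟨α, β, e⟩ := hp.planar s hs k hk
    exact ⟨β, α, by rw [e, add_comm]⟩

namespace TranslateTiling

/-- The tile lying across the facet `i` at a generic point of a ridge. -/
theorem exists_across (hT : TranslateTiling P S) (hP : IsSymmetricRep P u h opp) (h0 : (0 : E) ∈ S)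
    {i j : ι} (hij : i ≠ j) {p : E} (hp : IsGenericRidge P S u h i j p) :
    ∃ s ∈ S, p - s ∈ P ∧ opp i ∈ active u h (p - s) ∧
      ∀ b ∈ active u h (p - s), b ≠ opp i →
        ∃ α β : ℝ, u b = α • u i + β • u j ∧ 0 < β := by
  have hi : i ∈ active u h p := by simp [hp.active_eq]
  have hj : j ∈ active u h p := by simp [hp.active_eq]
  have hind : ∀ x y : ℝ, x • u i + y • u j = 0 → x = 0 ∧ y = 0 :=
    fun x y e => hP.pair_independent hi hj hij e
  obtain ⟨f, g, hfg⟩ := exists_dual_pair hind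
  have hsmall : ∀ α β : ℝ, β ≠ 0 → ∀ᶠ ε in 𝓝[>] (0 : ℝ), ε * |α| < |β| := by
    intro α β hβ
    have : Tendsto (fun ε : ℝ => ε * |α|) (𝓝[>] 0) (𝓝 (0 * |α|)) :=
      ((continuous_id.mul continuous_const).tendsto 0).mono_left nhdsWithin_le_nhds
    rw [zero_mul] at this
    exact this.eventually (gt_mem_nhds (abs_pos.2 hβ))
  have hev : ∀ᶠ ε in 𝓝[>] (0 : ℝ), ∀ k α β, u k = α • u i + β • u j → β ≠ 0 →
      ε * |α| < |β| := by
    rw [eventually_all]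
    intro k
    by_cases hk : ∃ α β : ℝ, u k = α • u i + β • u j ∧ β ≠ 0
    · obtain ⟨α, β, e, hβ⟩ := hk
      filter_upwards [hsmall α β hβ] with ε hε α' β' e' _
      have h1 := hind (α - α') (β - β') (by
        rw [sub_smul, sub_smul, sub_add_sub_comm, ← e, ← e', sub_self])
      rwa [← sub_eq_zero.1 h1.1, ← sub_eq_zero.1 h1.2]
    · push Not at hk
      exact Eventually.of_forall fun ε α β e hβ => absurd (hk α β e) hβ
  obtain ⟨ε, hε, hpos⟩ := (hev.and self_mem_nhdsWithin).exists
  replace hpos : 0 < ε := hpos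
  obtain ⟨s, hs, hps, hcov⟩ := hT.local_cover hP p (ε • f + (-1 : ℝ) • g)
  have hcov' : ∀ k ∈ active u h (p - s), ∀ α β : ℝ, u k = α • u i + β • u j → α * ε ≤ β := by
    intro k hk α β e
    have := hcov k hk
    rw [e, hfg] at this
    linarith
  have hβ : ∀ k ∈ active u h (p - s), ∀ α β : ℝ, u k = α • u i + β • u j →
      0 < β ∨ k = opp i := by
    intro k hk α β e
    have h1 := hcov' k hk α β e
    rcases lt_trichotomy β 0 with hb | hb | hb
    · exfalso
      have h2 := hε k α β e hb.ne
      rw [abs_of_neg hb] at h2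
      nlinarith [neg_abs_le α]
    · right
      rw [hb] at h1 e
      have hα : α ≤ 0 := by
        by_contra hα
        push Not at hα
        nlinarith
      rw [zero_smul, add_zero] at e
      have h2 := hP.norm_eq k
      rw [e, norm_smul, hP.norm_eq, mul_one, Real.norm_eq_abs, abs_of_nonpos hα] at h2
      apply hP.injective
      rw [hP.u_opp, e, show α = -1 by linarith, neg_one_smul]
    · exact Or.inl hb
  have hs0 : s ≠ 0 := by
    rintro rfl
    have h1 := hcov' i (by rwa [sub_zero]) 1 0 (by simp)
    linarith
  have hmem : opp i ∈ active u h (p - s) := by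
    by_contra hno
    have hβ' : ∀ k ∈ active u h (p - s), ∀ α β : ℝ, u k = α • u i + β • u j → 0 < β :=
      fun k hk α β e => (hβ k hk α β e).resolve_right fun e' => hno (e' ▸ hk)
    apply hs0
    refine hT.local_disjoint hP (v := (-ε) • f + (-1 : ℝ) • g) hs h0 hps (by simpa using hp.mem)
      ?_ ?_
    · intro k hk
      obtain ⟨α, β, e⟩ := hp.planar s hs k hk
      have h1 := hβ' k hk α β e
      have h2 := hε k α β e h1.ne'
      rw [abs_of_pos h1] at h2
      rw [e, hfg]
      nlinarith [neg_abs_le α]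
    · rw [sub_zero, hp.active_eq]
      rintro k (rfl | rfl)
      · have := hfg (-ε) (-1) 1 0
        rw [one_smul, zero_smul, add_zero] at this
        rw [this]
        linarith
      · have := hfg (-ε) (-1) 0 1
        rw [one_smul, zero_smul, zero_add] at this
        rw [this]
        linarith
  refine ⟨s, hs, hps, hmem, fun b hb hbi => ?_⟩
  obtain ⟨α, β, e⟩ := hp.planar s hs b hb
  exact ⟨α, β, e, (hβ b hb α β e).resolve_right hbi⟩

theorem active_eq_pair (hP : IsSymmetricRep P u h opp) {i j b : ι} {q : E}
    (hi : opp i ∈ active u h q)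
    (hq : ∀ k ∈ active u h q, k ≠ opp i → ∃ α β : ℝ, u k = α • u i + β • u j ∧ 0 < β)
    (hb : b ∈ active u h q) (hbi : b ≠ opp i) : active u h q = {opp i, b} := by
  refine Subset.antisymm (fun c hc => ?_) (by rintro k (rfl | rfl) <;> assumption)
  by_contra hcon
  simp only [mem_insert_iff, mem_singleton_iff, not_or] at hcon
  obtain ⟨α, β, e, hβ⟩ := hq b hb hbi
  obtain ⟨α', β', e', hβ'⟩ := hq c hc hcon.1
  have := hP.triple_independent hi hb hc hbi.symm (Ne.symm hcon.1) (Ne.symm hcon.2)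
    (a := β' * α - β * α') (b := β') (c := -β) (by
      rw [hP.u_opp, e, e']
      module)
  exact hβ'.ne' this.2.1

theorem belt_of_zero_mem (hT : TranslateTiling P S) (hP : IsSymmetricRep P u h opp)
    (h0 : (0 : E) ∈ S) {i j : ι} (hij : Ridge P u h i j) :
    Quad P u h opp i j ∨ ∃ k, Hex P u h opp i j k := by
  obtain ⟨p, hpP, hpa, hpl⟩ := hT.exists_generic_ridge_point hP hij
  have hp : IsGenericRidge P S u h i j p := ⟨hpP, hpa, hpl⟩
  have hne := hij.1
  obtain ⟨s, hs, hps, his, hbs⟩ := hT.exists_across hP h0 hne hp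
  obtain ⟨s', hs', hps', hjs', hcs'⟩ := hT.exists_across hP h0 hne.symm hp.symm
  have hi : i ∈ active u h p := by simp [hpa]
  have hj : j ∈ active u h p := by simp [hpa]
  have hind : ∀ x y : ℝ, x • u i + y • u j = 0 → x = 0 ∧ y = 0 :=
    fun x y e => hP.pair_independent hi hj hne e
  have huniq : ∀ a b c d : ℝ, a • u i + b • u j = c • u i + d • u j → a = c ∧ b = d := by
    intro a b c d e
    have h1 := hind (a - c) (b - d) (by rw [sub_smul, sub_smul, sub_add_sub_comm, e, sub_self])
    exact ⟨sub_eq_zero.1 h1.1, sub_eq_zero.1 h1.2⟩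
  obtain ⟨f, g, hfg⟩ := exists_dual_pair hind
  have hopp_ne : opp j ≠ opp i := fun e => hne (by rw [← hP.opp_opp i, ← e, hP.opp_opp])
  have hss' : s ≠ s' := by
    rintro rfl
    obtain ⟨α, β, e, hβ⟩ := hbs _ hjs' hopp_ne
    have := huniq α β 0 (-1) (by rw [← e, hP.u_opp]; module)
    linarith [this.2]
  have hiopp : i ≠ opp j := by
    intro e
    have := huniq 1 0 0 (-1) (by
      have h1 := hP.u_opp j
      rw [← e] at h1
      rw [one_smul, zero_smul, add_zero, h1]
      module)
    linarith [this.1]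
  have hjopp : j ≠ opp i := fun e => hiopp (by rw [e, hP.opp_opp])
  have overlap : ∀ x y : ℝ, 0 < x → 0 < y →
      (∀ b ∈ active u h (p - s), b ≠ opp i → ∀ α β : ℝ, u b = α • u i + β • u j →
        α * x + β * y < 0) →
      (∀ c ∈ active u h (p - s'), c ≠ opp j → ∀ α β : ℝ, u c = α • u i + β • u j →
        α * x + β * y < 0) → False := by
    intro x y hx hy h1 h2
    refine hss' (hT.local_disjoint hP (v := x • f + y • g) hs hs' hps hps' ?_ ?_)
    · intro k hk
      by_cases hki : k = opp i
      · rw [hki, hP.u_opp, show -u i = (-1 : ℝ) • u i + (0 : ℝ) • u j by module, hfg]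
        linarith
      · obtain ⟨α, β, e⟩ := hpl s hs k hk
        rw [e, hfg]
        exact h1 k hk hki α β e
    · intro k hk
      by_cases hki : k = opp j
      · rw [hki, hP.u_opp, show -u j = (0 : ℝ) • u i + (-1 : ℝ) • u j by module, hfg]
        linarith
      · obtain ⟨α, β, e⟩ := hpl s' hs' k hk
        rw [e, hfg]
        exact h2 k hk hki α β e
  have hquad : Ridge P u h (opp i) j → Quad P u h opp i j := fun h => ⟨hij, h⟩
  -- the tile across `i`
  have hB : Ridge P u h (opp i) j ∨ (∀ b ∈ active u h (p - s), b = opp i) ∨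
      ∃ b, ∃ α β : ℝ, active u h (p - s) = {opp i, b} ∧ u b = α • u i + β • u j ∧ α < 0 ∧ 0 < β ∧
        b ≠ opp i := by
    by_cases hall : ∀ b ∈ active u h (p - s), b = opp i
    · exact Or.inr (Or.inl hall)
    push Not at hall
    obtain ⟨b, hb, hbi⟩ := hall
    obtain ⟨α, β, e, hβ⟩ := hbs b hb hbi
    have hact := active_eq_pair hP his hbs hb hbi
    rcases lt_trichotomy α 0 with hα | hα | hα
    · exact Or.inr (Or.inr ⟨b, α, β, hact, e, hα, hβ, hbi⟩)
    · left
      have hbj : b = j := by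
        apply hP.injective
        rw [hα, zero_smul, zero_add] at e
        have h2 := hP.norm_eq b
        rw [e, norm_smul, hP.norm_eq, mul_one, Real.norm_eq_abs, abs_of_pos hβ] at h2
        rw [e, h2, one_smul]
      rw [hbj] at hact
      exact ⟨hjopp.symm, p - s, hps, hact⟩
    · exfalso
      refine hP.not_mem_open_cone hps hb his (l := j) ?_ hjopp (a := 1 / β) (b := α / β)
        (by positivity) (by positivity) ?_
      · rintro rfl
        have := huniq 0 1 α β (by rw [← e]; simp)
        linarith [this.1]
      · rw [hP.u_opp, e, smul_add, smul_smul, smul_smul, one_div, inv_mul_cancel₀ hβ.ne',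
          div_eq_inv_mul]
        module
  have hC : Ridge P u h (opp i) j ∨ (∀ c ∈ active u h (p - s'), c = opp j) ∨
      ∃ c, ∃ α β : ℝ, active u h (p - s') = {opp j, c} ∧ u c = α • u i + β • u j ∧ 0 < α ∧ β < 0 ∧
        c ≠ opp j := by
    by_cases hall : ∀ b ∈ active u h (p - s'), b = opp j
    · exact Or.inr (Or.inl hall)
    push Not at hall
    obtain ⟨b, hb, hbi⟩ := hall
    obtain ⟨β, α, e, hα⟩ := hcs' b hb hbi
    have hact := active_eq_pair hP hjs' hcs' hb hbi
    rw [add_comm] at e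
    rcases lt_trichotomy β 0 with hβ | hβ | hβ
    · exact Or.inr (Or.inr ⟨b, α, β, hact, e, hα, hβ, hbi⟩)
    · left
      have hbj : b = i := by
        apply hP.injective
        rw [hβ, zero_smul, add_zero] at e
        have h2 := hP.norm_eq b
        rw [e, norm_smul, hP.norm_eq, mul_one, Real.norm_eq_abs, abs_of_pos hα] at h2
        rw [e, h2, one_smul]
      rw [hbj] at hact
      refine ⟨hjopp.symm, -(p - s'), hP.neg_mem hps', ?_⟩
      rw [hP.active_neg hact, pair_comm]
    · exfalso
      refine hP.not_mem_open_cone hps' hb hjs' (l := i) ?_ hiopp (a := 1 / α) (b := β / α)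
        (by positivity) (by positivity) ?_
      · rintro rfl
        have := huniq 1 0 α β (by rw [← e]; simp)
        linarith [this.2]
      · rw [hP.u_opp, e, smul_add, smul_smul, smul_smul, one_div, inv_mul_cancel₀ hα.ne',
          div_eq_inv_mul]
        module
  rcases hB with hB | hB | ⟨b, β₁, β₂, hab, eb, hβ₁, hβ₂, hbi⟩
  · exact Or.inl (hquad hB)
  · rcases hC with hC | hC | ⟨c, γ₁, γ₂, hac, ec, hγ₁, hγ₂, hcj⟩
    · exact Or.inl (hquad hC)
    · exact (overlap 1 1 one_pos one_pos (fun b hb hbi => absurd (hB b hb) hbi)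
        fun c hc hcj => absurd (hC c hc) hcj).elim
    · exfalso
      refine overlap (-γ₂) (2 * γ₁) (by linarith) (by linarith)
        (fun b hb hbi => absurd (hB b hb) hbi) fun c' hc' hcj' α β e => ?_
      rw [hac] at hc'
      obtain rfl : c' = c := hc'.resolve_left hcj'
      obtain ⟨rfl, rfl⟩ := huniq _ _ _ _ (ec.symm.trans e)
      nlinarith
  rcases hC with hC | hC | ⟨c, γ₁, γ₂, hac, ec, hγ₁, hγ₂, hcj⟩
  · exact Or.inl (hquad hC)
  · exfalso
    refine overlap (2 * β₂) (-β₁) (by linarith) (by linarith) (fun b' hb' hbi' α β e => ?_)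
      fun c hc hcj => absurd (hC c hc) hcj
    rw [hab] at hb'
    obtain rfl : b' = b := hb'.resolve_left hbi'
    obtain ⟨rfl, rfl⟩ := huniq _ _ _ _ (eb.symm.trans e)
    nlinarith
  rcases lt_trichotomy (γ₁ * β₂) (β₁ * γ₂) with hlt | heq | hgt
  · exfalso
    refine overlap (β₂ - γ₂) (γ₁ - β₁) (by linarith) (by linarith) (fun b' hb' hbi' α β e => ?_)
      fun c' hc' hcj' α β e => ?_
    · rw [hab] at hb'
      obtain rfl : b' = b := hb'.resolve_left hbi'
      obtain ⟨rfl, rfl⟩ := huniq _ _ _ _ (eb.symm.trans e)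
      nlinarith
    · rw [hac] at hc'
      obtain rfl : c' = c := hc'.resolve_left hcj'
      obtain ⟨rfl, rfl⟩ := huniq _ _ _ _ (ec.symm.trans e)
      nlinarith
  · right
    have hpar : u c = (-(γ₁ / β₁)) • u (opp b) := by
      rw [hP.u_opp, smul_neg, neg_smul, neg_neg, eb, ec, smul_add, smul_smul, smul_smul,
        div_mul_cancel₀ _ hβ₁.ne, div_mul_eq_mul_div, heq, mul_div_cancel_left₀ _ hβ₁.ne]
    have hcb : c = opp b := by
      apply hP.injective
      have h2 := hP.norm_eq c
      have h3 : 0 < -(γ₁ / β₁) := neg_pos.2 (div_neg_of_pos_of_neg hγ₁ hβ₁)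
      rw [hpar, norm_smul, hP.norm_eq, mul_one, Real.norm_eq_abs, abs_of_pos h3] at h2
      rw [hpar, h2, one_smul]
    refine ⟨b, ⟨-β₁ / β₂, 1 / β₂, div_pos (by linarith) hβ₂, by positivity, ?_⟩, hij, ?_, ?_⟩
    · rw [eb, smul_add, smul_smul, smul_smul, one_div, inv_mul_cancel₀ hβ₂.ne', div_eq_inv_mul]
      module
    · refine ⟨?_, -(p - s'), hP.neg_mem hps', ?_⟩
      · rintro rfl
        have := huniq 0 1 β₁ β₂ (by rw [← eb]; simp)
        linarith [this.1]
      · rw [hP.active_neg hac, hcb, hP.opp_opp]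
    · exact ⟨hbi, p - s, hps, by rw [hab, pair_comm]⟩
  · exfalso
    refine hP.not_mem_open_cone hps' (i := c) (j := opp j) (l := opp b) (by simp [hac]) hjs' ?_ ?_
      (a := -β₁ / γ₁) (b := (γ₁ * β₂ - β₁ * γ₂) / γ₁) (div_pos (by linarith) hγ₁)
      (div_pos (by linarith) hγ₁) ?_
    · intro e
      have := huniq (-β₁) (-β₂) γ₁ γ₂ (by rw [← ec, ← e, hP.u_opp, eb]; module)
      nlinarith [this.1, this.2]
    · intro e
      have := huniq (-β₁) (-β₂) 0 (-1) (by
        rw [show (-β₁) • u i + (-β₂) • u j = -u b by rw [eb]; module, ← hP.u_opp, e, hP.u_opp]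
        module)
      linarith [this.1]
    · rw [hP.u_opp, hP.u_opp, eb, ec]
      rw [show (-β₁ / γ₁) • (γ₁ • u i + γ₂ • u j) + ((γ₁ * β₂ - β₁ * γ₂) / γ₁) • -u j
        = (-β₁ / γ₁ * γ₁) • u i + (-β₁ / γ₁ * γ₂ - (γ₁ * β₂ - β₁ * γ₂) / γ₁) • u j by module]
      rw [div_mul_cancel₀ _ hγ₁.ne',
        show -β₁ / γ₁ * γ₂ - (γ₁ * β₂ - β₁ * γ₂) / γ₁ = -β₂ by field_simp; ring]
      module

/-- Every belt of a symmetric translative tile has four or six facets. -/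
theorem belt (hT : TranslateTiling P S) (hP : IsSymmetricRep P u h opp) {i j : ι}
    (hij : Ridge P u h i j) : Quad P u h opp i j ∨ ∃ k, Hex P u h opp i j k := by
  obtain ⟨s, hs, -⟩ := hT.cover 0
  exact (hT.translate s).belt_of_zero_mem hP ⟨s, hs, sub_self s⟩ hij

end TranslateTiling

end BeltExistence

section HalfSpaces

variable {E : Type*} [NormedAddCommGroup E] [InnerProductSpace ℝ E]

/-- The intersection of the half-spaces `⟪a.1, x⟫ ≤ a.2`. -/
def halfSpaces (A : Set (E × ℝ)) : Set E := {x | ∀ a ∈ A, ⟪a.1, x⟫ ≤ a.2}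

theorem inner_lt_of_mem_interior {K : Set E} {a x : E} {c : ℝ} (ha : a ≠ 0)
    (hK : ∀ y ∈ K, ⟪a, y⟫ ≤ c) (hx : x ∈ interior K) : ⟪a, x⟫ < c := by
  obtain ⟨r, hr, hball⟩ := Metric.isOpen_iff.1 isOpen_interior x hx
  have hn : 0 < ‖a‖ := norm_pos_iff.2 ha
  have h1 := hK (x + (r / 2 / ‖a‖) • a) (interior_subset (hball (by
    rw [mem_ball_iff_norm, add_sub_cancel_left, norm_smul, Real.norm_of_nonneg (by positivity),
      div_mul_cancel₀ _ hn.ne']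
    linarith)))
  rw [inner_add_right, inner_smul_right, real_inner_self_eq_norm_sq] at h1
  have : 0 < r / 2 / ‖a‖ * ‖a‖ ^ 2 := by positivity
  linarith

/-- Deleting redundant inequalities from a finite system of half-spaces with unit normals. -/
theorem exists_isFacetRep {K : Set E} (hne : (interior K).Nonempty) {A : Set (E × ℝ)}
    (hfin : A.Finite) (hA : ∀ a ∈ A, ‖a.1‖ = 1) (hK : K = halfSpaces A) :
    ∃ B ⊆ A, IsFacetRep K (fun b : B => b.1.1) (fun b : B => b.1.2) := by
  obtain ⟨B, hBA, hmin⟩ : ∃ B ⊆ A, Minimal (fun B => B ⊆ A ∧ K = halfSpaces B) B := by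
    have hf : {B | B ⊆ A ∧ K = halfSpaces B}.Finite :=
      hfin.finite_subsets.subset fun B hB => hB.1
    obtain ⟨B, hB⟩ := hf.exists_minimal ⟨A, Subset.rfl, hK⟩
    exact ⟨B, hB.1.1, hB⟩
  refine ⟨B, hBA, fun b => hA _ (hBA b.2), fun x => ?_, fun b => ?_⟩
  · rw [hmin.1.2]
    simp [halfSpaces]
  obtain ⟨z, hz⟩ := hne
  obtain ⟨x, hx, hxb⟩ : ∃ x, x ∈ halfSpaces (B \ {b.1}) ∧ b.1.2 < ⟪b.1.1, x⟫ := by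
    by_contra hcon
    push Not at hcon
    have h1 : K = halfSpaces (B \ {b.1}) := by
      rw [hmin.1.2]
      ext x
      refine ⟨fun hx a ha => hx a ha.1, fun hx a ha => ?_⟩
      by_cases hab : a = b.1
      · rw [hab]; exact hcon x hx
      · exact hx a ⟨ha, hab⟩
    have h2 := hmin.2 ⟨sdiff_subset.trans hBA, h1⟩ sdiff_subset b.2
    exact h2.2 rfl
  have hstrict : ∀ a ∈ B, ⟪a.1, z⟫ < a.2 := fun a ha =>
    inner_lt_of_mem_interior (norm_ne_zero_iff.1 (by rw [hA a (hBA ha)]; exact one_ne_zero))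
      (fun y hy => by rw [hmin.1.2] at hy; exact hy a ha) hz
  have hzb := hstrict b b.2
  set α := b.1.2 - ⟪b.1.1, z⟫ with hα
  set β := ⟪b.1.1, x⟫ - b.1.2 with hβ
  have hα0 : 0 < α := sub_pos.2 hzb
  have hβ0 : 0 < β := sub_pos.2 hxb
  have hs : 0 < α + β := by positivity
  refine ⟨(β / (α + β)) • z + (α / (α + β)) • x, ?_, fun a hab => ?_⟩
  · rw [inner_add_right, inner_smul_right, inner_smul_right]
    field_simp
    rw [hα, hβ]
    ring
  · have h1 := hstrict a a.2
    have h2 := hx a ⟨a.2, fun e => hab (Subtype.ext e)⟩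
    rw [inner_add_right, inner_smul_right, inner_smul_right]
    have h3 : a.1.2 = β / (α + β) * a.1.2 + α / (α + β) * a.1.2 := by field_simp; ring
    rw [h3]
    exact add_lt_add_of_lt_of_le (mul_lt_mul_of_pos_left h1 (by positivity))
      (mul_le_mul_of_nonneg_left h2 (by positivity))

theorem eq_of_halfSpace_subset {a b : E} (ha : ‖a‖ = 1) (hb : ‖b‖ = 1)
    (hab : ∀ v, ⟪a, v⟫ ≤ 0 → ⟪b, v⟫ ≤ 0) : a = b := by
  have haa : ⟪a, a⟫ = 1 := by rw [real_inner_self_eq_norm_sq, ha]; norm_num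
  have hbb : ⟪b, b⟫ = 1 := by rw [real_inner_self_eq_norm_sq, hb]; norm_num
  have h1 := hab (b - ⟪a, b⟫ • a) (by rw [inner_sub_right, inner_smul_right, haa]; linarith)
  have h2 := hab (-a) (by rw [inner_neg_right, haa]; norm_num)
  rw [inner_sub_right, inner_smul_right, hbb] at h1
  rw [inner_neg_right] at h2
  have hc : ⟪b, a⟫ = ⟪a, b⟫ := real_inner_comm _ _
  rw [hc] at h1 h2
  have h3 := abs_real_inner_le_norm a b
  rw [ha, hb, mul_one, abs_le] at h3
  rw [← inner_eq_one_iff_of_norm_eq_one (𝕜 := ℝ) ha hb]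
  nlinarith

/-- The facet description of a body symmetric about the origin is symmetric. -/
theorem IsFacetRep.exists_opp {ι : Type*} [Finite ι] {P : Set E} {u : ι → E} {h : ι → ℝ}
    (hP : IsFacetRep P u h) (hneg : ∀ x ∈ P, -x ∈ P) (i : ι) :
    ∃ j, u j = -u i ∧ h j = h i := by
  obtain ⟨y, hy, hy'⟩ := hP.exists_facet_point i
  have hyP := hP.mem_of_facet_point hy hy'
  have hact : active u h y = {i} := by
    ext k
    refine ⟨fun hk => ?_, fun hk => by rw [mem_singleton_iff.1 hk]; exact hy⟩
    by_contra hki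
    exact (hy' k hki).ne hk
  obtain ⟨j, hj⟩ : (active u h (-y)).Nonempty := by
    by_contra hemp
    rw [not_nonempty_iff_eq_empty] at hemp
    have h1 : -y ∈ interior P := by
      rw [hP.mem_interior_iff]
      intro k
      refine lt_of_le_of_ne (hP.le (hneg y hyP) k) fun hk => ?_
      have : k ∈ active u h (-y) := hk
      simp [hemp] at this
    have h2 : y ∈ interior P := by
      have : interior P ⊆ -P := fun x hx => hneg x (interior_subset hx)
      have h3 : -y ∈ interior (-P) := interior_maximal this isOpen_interior h1
      have h4 : interior (-P) = -interior P := by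
        have := (Homeomorph.neg E).preimage_interior P
        exact this.symm
      rw [h4] at h3
      simpa using h3
    exact (hP.mem_interior_iff.1 h2 i).ne hy
  have huj : -u i = u j := by
    refine eq_of_halfSpace_subset (by rw [norm_neg, hP.norm_eq]) (hP.norm_eq j) fun v hv => ?_
    obtain ⟨δ, hδ, hd⟩ := IsBelted.eventually_active_subset hP hyP
    have hε : 0 < δ / 2 / (‖v‖ + 1) := by positivity
    set ε := δ / 2 / (‖v‖ + 1) with hε'
    have hvn : ‖ε • (-v)‖ < δ := by
      rw [norm_smul, norm_neg, Real.norm_of_nonneg hε.le, hε', div_mul_eq_mul_div,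
        div_lt_iff₀ (by positivity)]
      nlinarith [norm_nonneg v]
    have h1 : y + ε • (-v) ∈ P := by
      rw [IsBelted.add_mem_iff hP (hd _ hvn), hact]
      rintro k rfl
      rw [inner_smul_right, inner_neg_right]
      rw [inner_neg_left] at hv
      nlinarith
    have h2 := hP.le (hneg _ h1) j
    have h3 : ⟪u j, -y⟫ = h j := hj
    rw [show -(y + ε • (-v)) = -y + ε • v by module, inner_add_right, h3, inner_smul_right] at h2
    nlinarith
  refine ⟨j, huj.symm, ?_⟩
  have h3 : ⟪u j, -y⟫ = h j := hj
  rw [← h3, ← huj, inner_neg_neg, hy]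

variable [FiniteDimensional ℝ E]

/-- A convex body that tiles by translates is a finite intersection of half-spaces. -/
theorem TranslateTiling.exists_halfSpaces {P S : Set E} (hT : TranslateTiling P S)
    (hconv : Convex ℝ P) (hcomp : IsCompact P) (hne : (interior P).Nonempty) :
    ∃ A : Set (E × ℝ), A.Finite ∧ (∀ a ∈ A, ‖a.1‖ = 1) ∧ P = halfSpaces A := by
  obtain ⟨s₀, hs₀, -⟩ := hT.cover 0
  have hclos : closure (interior P) = P := by
    rw [hconv.closure_interior_eq_closure_of_nonempty_interior hne, hcomp.isClosed.closure_eq]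
  have hsep : ∀ s ∈ S, s ≠ s₀ → ∃ a : E × ℝ, ‖a.1‖ = 1 ∧ (∀ x ∈ P, ⟪a.1, x⟫ ≤ a.2) ∧
      ∀ x, x - (s - s₀) ∈ P → a.2 ≤ ⟪a.1, x⟫ := by
    intro s hs hss
    have hset : IsOpen ((fun x => x - (s - s₀)) ⁻¹' interior P) :=
      isOpen_interior.preimage (by fun_prop)
    have hsetc : Convex ℝ ((fun x => x - (s - s₀)) ⁻¹' interior P) := by
      simpa [sub_eq_add_neg] using hconv.interior.translate_preimage_left (-(s - s₀))
    have hd : Disjoint (interior P) ((fun x => x - (s - s₀)) ⁻¹' interior P) := by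
      rw [disjoint_left]
      intro x hx hx'
      refine hss (hT.disjoint s hs s₀ hs₀ (x + s₀) ?_ (by simpa using hx))
      rwa [show x + s₀ - s = x - (s - s₀) by abel]
    obtain ⟨f, c, hf1, hf2⟩ := geometric_hahn_banach_open_open hconv.interior isOpen_interior
      hsetc hset hd
    set v := (InnerProductSpace.toDual ℝ E).symm f with hv
    have hfv : ∀ x, f x = ⟪v, x⟫ := fun x => by
      rw [hv, InnerProductSpace.toDual_symm_apply]
    obtain ⟨z, hz⟩ := hne
    have hv0 : v ≠ 0 := by
      intro h0
      have h1 := hf1 z hz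
      have h2 := hf2 (z + (s - s₀)) (by simpa using hz)
      rw [hfv, h0, inner_zero_left] at h1 h2
      linarith
    have hn : 0 < ‖v‖ := norm_pos_iff.2 hv0
    have hle : ∀ x ∈ P, ⟪v, x⟫ ≤ c := by
      intro x hx
      rw [← hclos] at hx
      refine closure_minimal (t := {x | ⟪v, x⟫ ≤ c}) (fun y hy => ?_)
        (isClosed_le (by fun_prop) continuous_const) hx
      show ⟪v, y⟫ ≤ c
      rw [← hfv]
      exact (hf1 y hy).le
    have hge : ∀ x ∈ P, c ≤ ⟪v, x + (s - s₀)⟫ := by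
      intro x hx
      rw [← hclos] at hx
      refine closure_minimal (t := {x | c ≤ ⟪v, x + (s - s₀)⟫}) (fun y hy => ?_)
        (isClosed_le continuous_const (by fun_prop)) hx
      show c ≤ ⟪v, y + (s - s₀)⟫
      rw [← hfv]
      exact (hf2 _ (by simpa using hy)).le
    refine ⟨(‖v‖⁻¹ • v, ‖v‖⁻¹ * c), ?_, fun x hx => ?_, fun x hx => ?_⟩
    · rw [norm_smul, norm_inv, norm_norm, inv_mul_cancel₀ hn.ne']
    · rw [inner_smul_left]
      exact mul_le_mul_of_nonneg_left (hle x hx) (by simp)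
    · have := hge _ hx
      rw [sub_add_cancel] at this
      rw [inner_smul_left]
      exact mul_le_mul_of_nonneg_left this (by simp)
  choose! a ha1 ha2 ha3 using hsep
  set N := {s ∈ S | ∃ x ∈ Metric.cthickening 1 ((fun x => x + s₀) '' P), x - s ∈ P} with hN
  have hNfin : N.Finite := hT.finite_near hne hcomp.isBounded
    ((hcomp.image (by fun_prop)).cthickening.isBounded)
  refine ⟨a '' (N \ {s₀}), (hNfin.subset sdiff_subset).image _, ?_, ?_⟩
  · rintro _ ⟨s, hs, rfl⟩
    exact ha1 s hs.1.1 hs.2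
  refine Subset.antisymm ?_ ?_
  · rintro x hx _ ⟨s, hs, rfl⟩
    exact ha2 s hs.1.1 hs.2 x hx
  · intro x hx
    by_contra hxP
    obtain ⟨z, hz⟩ := hne
    have hPne : P.Nonempty := ⟨z, interior_subset hz⟩
    set φ : ℝ → ℝ := fun t => Metric.infDist (AffineMap.lineMap z x t) P with hφ
    have hφc : Continuous φ :=
      (Metric.continuous_infDist_pt P).comp AffineMap.lineMap_continuous
    have h0 : φ 0 = 0 := by
      simp only [hφ, AffineMap.lineMap_apply_zero]
      exact Metric.infDist_zero_of_mem (interior_subset hz)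
    have h1 : 0 < φ 1 := by
      simp only [hφ, AffineMap.lineMap_apply_one]
      exact (hcomp.isClosed.notMem_iff_infDist_pos hPne).1 hxP
    obtain ⟨t, ht, hφt⟩ : min (φ 1 / 2) 1 ∈ φ '' Icc 0 1 := by
      refine intermediate_value_Icc zero_le_one hφc.continuousOn ⟨?_, ?_⟩
      · rw [h0]; positivity
      · exact (min_le_left _ _).trans (by linarith)
    set y := AffineMap.lineMap z x t with hy
    have hφpos : 0 < φ t := by rw [hφt]; positivity
    have hyP : y ∉ P := (hcomp.isClosed.notMem_iff_infDist_pos hPne).2 hφpos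
    have ht1 : t < 1 := by
      rcases ht.2.lt_or_eq with h | h
      · exact h
      · have := min_le_left (φ 1 / 2) 1
        rw [← hφt, h] at this
        linarith
    obtain ⟨s, hs, hys⟩ := hT.cover (y + s₀)
    have hss : s ≠ s₀ := by
      rintro rfl
      exact hyP (by simpa using hys)
    have hsN : s ∈ N := by
      refine ⟨hs, y + s₀, ?_, hys⟩
      obtain ⟨q, hq, hqd⟩ := hcomp.exists_infDist_eq_dist hPne y
      refine Metric.mem_cthickening_of_dist_le _ (q + s₀) _ _ (mem_image_of_mem _ hq) ?_
      rw [dist_add_right, ← hqd]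
      exact hφt.trans_le (min_le_right _ _)
    have h2 := ha3 s hs hss y (by rwa [show y - (s - s₀) = y + s₀ - s by abel])
    have h3 := hx _ ⟨s, ⟨hsN, hss⟩, rfl⟩
    have h4 := inner_lt_of_mem_interior
      (norm_ne_zero_iff.1 (by rw [ha1 s hs hss]; exact one_ne_zero)) (ha2 s hs hss) hz
    rw [hy, AffineMap.lineMap_apply_module, inner_add_right, inner_smul_right,
      inner_smul_right] at h2
    nlinarith [ht.1]

end HalfSpaces

section Quantile

/-- `q` is the quantile function on `(0, 1)` of the positive density `f` on `(a, b)` with total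
mass `V`. -/
structure IsQuantile (f : ℝ → ℝ) (a b V : ℝ) (q : ℝ → ℝ) : Prop where
  mem : ∀ p ∈ Ioo (0 : ℝ) 1, q p ∈ Ioo a b
  hasDerivAt : ∀ p ∈ Ioo (0 : ℝ) 1, HasDerivAt q (V / f (q p)) p
  surj : ∀ x ∈ Ioo a b, ∃ p ∈ Ioo (0 : ℝ) 1, q p = x

theorem exists_isQuantile {f : ℝ → ℝ} {a b : ℝ} (hab : a < b) (hc : ContinuousOn f (Ioo a b))
    (hpos : ∀ x ∈ Ioo a b, 0 < f x) (hfint : IntervalIntegrable f volume a b) :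
    0 < (∫ x in a..b, f x) ∧ ∃ q, IsQuantile f a b (∫ x in a..b, f x) q := by
  set V := ∫ x in a..b, f x with hV
  have hV0 : 0 < V := intervalIntegral.intervalIntegral_pos_of_pos_on hfint hpos hab
  refine ⟨hV0, ?_⟩
  set F : ℝ → ℝ := fun x => (∫ t in a..x, f t) / V with hF
  have hsub : ∀ x ∈ Icc a b, ∀ y ∈ Icc a b, IntervalIntegrable f volume x y := fun x hx y hy =>
    hfint.mono_set (by
      rw [uIcc_of_le hab.le]
      exact uIcc_subset_Icc hx hy)
  have hmono : StrictMonoOn F (Icc a b) := by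
    intro x hx y hy hxy
    have h1 : 0 < ∫ t in x..y, f t :=
      intervalIntegral.intervalIntegral_pos_of_pos_on (hsub x hx y hy)
        (fun t ht => hpos t ⟨hx.1.trans_lt ht.1, ht.2.trans_le hy.2⟩) hxy
    have h2 := intervalIntegral.integral_add_adjacent_intervals
      (hsub a (left_mem_Icc.2 hab.le) x hx) (hsub x hx y hy)
    exact div_lt_div_of_pos_right (by linarith) hV0
  have hcont : ContinuousOn F (Icc a b) := by
    have := intervalIntegral.continuousOn_primitive_interval (μ := volume) (f := f)
      (a := a) (b := b) (by
        rw [uIcc_of_le hab.le]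
        exact (intervalIntegrable_iff_integrableOn_Icc_of_le hab.le).1 hfint)
    rw [uIcc_of_le hab.le] at this
    exact this.div_const V
  have hFa : F a = 0 := by simp [hF]
  have hFb : F b = 1 := by simp [hF, ← hV, hV0.ne']
  have hderiv : ∀ x ∈ Ioo a b, HasDerivAt F (f x / V) x := by
    intro x hx
    refine HasDerivAt.div_const ?_ V
    refine intervalIntegral.integral_hasDerivAt_right
      (hsub a (left_mem_Icc.2 hab.le) x (Ioo_subset_Icc_self hx)) ?_
      (hc.continuousAt (isOpen_Ioo.mem_nhds hx))
    exact hc.stronglyMeasurableAtFilter isOpen_Ioo x hx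
  have himg : ∀ p ∈ Ioo (0 : ℝ) 1, ∃ x ∈ Ioo a b, F x = p := by
    intro p hp
    have := intermediate_value_Ioo hab.le hcont
    rw [hFa, hFb] at this
    obtain ⟨x, hx, hxp⟩ := this hp
    exact ⟨x, hx, hxp⟩
  have hFmem : ∀ x ∈ Ioo a b, F x ∈ Ioo (0 : ℝ) 1 := fun x hx =>
    ⟨hFa ▸ hmono (left_mem_Icc.2 hab.le) (Ioo_subset_Icc_self hx) hx.1,
      hFb ▸ hmono (Ioo_subset_Icc_self hx) (right_mem_Icc.2 hab.le) hx.2⟩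
  choose! q hq hFq using himg
  have hqF : ∀ x ∈ Ioo a b, q (F x) = x := fun x hx =>
    hmono.injOn (Ioo_subset_Icc_self (hq _ (hFmem x hx))) (Ioo_subset_Icc_self hx)
      (hFq _ (hFmem x hx))
  have hqmono : StrictMonoOn q (Ioo 0 1) := by
    intro x hx y hy hxy
    by_contra! hcon
    have := hmono.monotoneOn (Ioo_subset_Icc_self (hq y hy)) (Ioo_subset_Icc_self (hq x hx)) hcon
    rw [hFq x hx, hFq y hy] at this
    linarith
  have hqimg : q '' Ioo 0 1 = Ioo a b := by
    ext x
    constructor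
    · rintro ⟨p, hp, rfl⟩
      exact hq p hp
    · intro hx
      exact ⟨F x, hFmem x hx, hqF x hx⟩
  refine ⟨q, hq, fun p hp => ?_, fun x hx => ⟨F x, hFmem x hx, hqF x hx⟩⟩
  have hqc : ContinuousAt q p := hqmono.continuousAt_of_image_mem_nhds (isOpen_Ioo.mem_nhds hp)
    (by rw [hqimg]; exact isOpen_Ioo.mem_nhds (hq p hp))
  have := HasDerivAt.of_local_left_inverse hqc (hderiv _ (hq p hp))
    (div_ne_zero (hpos _ (hq p hp)).ne' hV0.ne')
    (by filter_upwards [isOpen_Ioo.mem_nhds hp] with y hy using hFq y hy)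
  rwa [inv_div] at this

variable {f g q q' : ℝ → ℝ} {a b a' b' V V' : ℝ}

theorem IsQuantile.continuousOn (hq : IsQuantile f a b V q) : ContinuousOn q (Ioo 0 1) :=
  fun p hp => (hq.hasDerivAt p hp).continuousAt.continuousWithinAt

/-- The interpolation of two quantile functions, used as a change of variables. -/
theorem IsQuantile.lintegral_interp (hq : IsQuantile f a b V q) (hq' : IsQuantile g a' b' V' q')
    (hf : ∀ x ∈ Ioo a b, 0 < f x) (hg : ∀ x ∈ Ioo a' b', 0 < g x) (hV : 0 < V) (hV' : 0 < V')
    {l : ℝ} (hl : l ∈ Ioo (0 : ℝ) 1) {H : ℝ → ENNReal}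
    (hH : ∀ x ∈ Ioo a b, ∀ y ∈ Ioo a' b',
      ENNReal.ofReal (f x ^ (1 - l) * g y ^ l) ≤ H ((1 - l) * x + l * y)) :
    ∫⁻ p in Ioo (0 : ℝ) 1, ENNReal.ofReal (((1 - l) * (V / f (q p)) + l * (V' / g (q' p))) *
      (f (q p) ^ (1 - l) * g (q' p) ^ l)) ≤ ∫⁻ x, H x := by
  obtain ⟨hl0, hl1⟩ := hl
  set r : ℝ → ℝ := fun p => (1 - l) * q p + l * q' p with hr
  set r' : ℝ → ℝ := fun p => (1 - l) * (V / f (q p)) + l * (V' / g (q' p)) with hr'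
  have hr'pos : ∀ p ∈ Ioo (0 : ℝ) 1, 0 < r' p := by
    intro p hp
    have h1 := hf _ (hq.mem p hp)
    have h2 := hg _ (hq'.mem p hp)
    have h3 : 0 < 1 - l := by linarith
    simp only [hr']
    positivity
  have hd : ∀ p ∈ Ioo (0 : ℝ) 1, HasDerivAt r (r' p) p := fun p hp =>
    ((hq.hasDerivAt p hp).const_mul _).add ((hq'.hasDerivAt p hp).const_mul _)
  have hmono : StrictMonoOn r (Ioo 0 1) := by
    refine strictMonoOn_of_deriv_pos (convex_Ioo 0 1)
      (fun p hp => (hd p hp).continuousAt.continuousWithinAt) fun p hp => ?_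
    rw [interior_Ioo] at hp
    rw [(hd p hp).deriv]
    exact hr'pos p hp
  have hcv := lintegral_image_eq_lintegral_abs_deriv_mul measurableSet_Ioo
    (fun p hp => (hd p hp).hasDerivWithinAt) hmono.injOn H
  refine le_trans ?_ (setLIntegral_le_lintegral (r '' Ioo 0 1) H)
  rw [hcv]
  refine setLIntegral_mono' measurableSet_Ioo fun p hp => ?_
  rw [ENNReal.ofReal_mul (hr'pos p hp).le, abs_of_pos (hr'pos p hp)]
  gcongr
  exact hH _ (hq.mem p hp) _ (hq'.mem p hp)

theorem le_interp_mul {V V' x y l : ℝ} (hV : 0 < V) (hV' : 0 < V') (hx : 0 < x) (hy : 0 < y)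
    (hl : l ∈ Ioo (0 : ℝ) 1) :
    V ^ (1 - l) * V' ^ l ≤ ((1 - l) * (V / x) + l * (V' / y)) * (x ^ (1 - l) * y ^ l) := by
  have h := Real.geom_mean_le_arith_mean2_weighted (sub_nonneg.2 hl.2.le) hl.1.le
    (div_pos hV hx).le (div_pos hV' hy).le (by ring)
  have hxl : 0 < x ^ (1 - l) := Real.rpow_pos_of_pos hx _
  have hyl : 0 < y ^ l := Real.rpow_pos_of_pos hy _
  rw [Real.div_rpow hV.le hx.le, Real.div_rpow hV'.le hy.le] at h
  calc V ^ (1 - l) * V' ^ l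
      = (V ^ (1 - l) / x ^ (1 - l) * (V' ^ l / y ^ l)) * (x ^ (1 - l) * y ^ l) := by
        field_simp
    _ ≤ _ := by gcongr

theorem IsQuantile.prekopa (hq : IsQuantile f a b V q) (hq' : IsQuantile g a' b' V' q')
    (hf : ∀ x ∈ Ioo a b, 0 < f x) (hg : ∀ x ∈ Ioo a' b', 0 < g x) (hV : 0 < V) (hV' : 0 < V')
    {l : ℝ} (hl : l ∈ Ioo (0 : ℝ) 1) {H : ℝ → ENNReal}
    (hH : ∀ x ∈ Ioo a b, ∀ y ∈ Ioo a' b',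
      ENNReal.ofReal (f x ^ (1 - l) * g y ^ l) ≤ H ((1 - l) * x + l * y)) :
    ENNReal.ofReal (V ^ (1 - l) * V' ^ l) ≤ ∫⁻ x, H x := by
  refine le_trans ?_ (hq.lintegral_interp hq' hf hg hV hV' hl hH)
  calc ENNReal.ofReal (V ^ (1 - l) * V' ^ l)
      = ∫⁻ _ in Ioo (0 : ℝ) 1, ENNReal.ofReal (V ^ (1 - l) * V' ^ l) := by simp
    _ ≤ _ := setLIntegral_mono' measurableSet_Ioo fun p hp => ENNReal.ofReal_le_ofReal
        (le_interp_mul hV hV' (hf _ (hq.mem p hp)) (hg _ (hq'.mem p hp)) hl)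

/-- Equality case of the one-dimensional inequality for a density and its reflection. -/
theorem symmetric_of_lintegral_le (hab : a < b) (hc : ContinuousOn f (Ioo a b))
    (hf : ∀ x ∈ Ioo a b, 0 < f x) (hfint : IntervalIntegrable f volume a b) {H : ℝ → ENNReal}
    (hH : ∀ x ∈ Ioo a b, ∀ y ∈ Ioo a b,
      ENNReal.ofReal (f x ^ (1 / 2 : ℝ) * f y ^ (1 / 2 : ℝ)) ≤ H ((1 / 2) * x - (1 / 2) * y))
    (hle : ∫⁻ x, H x ≤ ENNReal.ofReal (∫ x in a..b, f x)) {x : ℝ} (hx : x ∈ Ioo a b) :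
    f (a + b - x) = f x := by
  obtain ⟨hV, q, hq⟩ := exists_isQuantile hab hc hf hfint
  set V := ∫ x in a..b, f x with hVdef
  have hmem : ∀ y ∈ Ioo (-b) (-a), -y ∈ Ioo a b := fun y hy =>
    ⟨by linarith [hy.2], by linarith [hy.1]⟩
  have hg : ∀ y ∈ Ioo (-b) (-a), 0 < f (-y) := fun y hy => hf _ (hmem y hy)
  obtain ⟨-, q', hq'⟩ := exists_isQuantile (f := fun y => f (-y)) (neg_lt_neg hab)
    (hc.comp continuousOn_neg hmem) hg (by
      have := (IntervalIntegrable.iff_comp_neg (f := f) (a := a) (b := b)).1 hfint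
      exact this.symm)
  have hV' : (∫ y in (-b)..(-a), f (-y)) = V := by
    rw [intervalIntegral.integral_comp_neg, neg_neg, neg_neg]
  rw [hV'] at hq'
  have hl : (1 / 2 : ℝ) ∈ Ioo (0 : ℝ) 1 := by constructor <;> norm_num
  have hle2 := (hq.lintegral_interp hq' hf hg hV hV hl (H := H) (by
    intro x hx y hy
    have := hH x hx (-y) (hmem y hy)
    norm_num at this ⊢
    exact this)).trans hle
  set G : ℝ → ℝ := fun p => ((1 - 1 / 2) * (V / f (q p)) + 1 / 2 * (V / f (-q' p))) *
      (f (q p) ^ (1 - 1 / 2 : ℝ) * f (-q' p) ^ (1 / 2 : ℝ)) with hG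
  have hfq : ContinuousOn (fun p => f (q p)) (Ioo 0 1) := hc.comp hq.continuousOn hq.mem
  have hgq : ContinuousOn (fun p => f (-q' p)) (Ioo 0 1) :=
    hc.comp hq'.continuousOn.neg fun p hp => hmem _ (hq'.mem p hp)
  have hfq0 : ∀ p ∈ Ioo (0 : ℝ) 1, 0 < f (q p) := fun p hp => hf _ (hq.mem p hp)
  have hgq0 : ∀ p ∈ Ioo (0 : ℝ) 1, 0 < f (-q' p) := fun p hp => hg _ (hq'.mem p hp)
  have hGc : ContinuousOn G (Ioo 0 1) := by
    refine ContinuousOn.mul (ContinuousOn.add ?_ ?_) (ContinuousOn.mul ?_ ?_)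
    · exact continuousOn_const.mul (continuousOn_const.div hfq fun p hp => (hfq0 p hp).ne')
    · exact continuousOn_const.mul (continuousOn_const.div hgq fun p hp => (hgq0 p hp).ne')
    · exact hfq.rpow_const fun p hp => Or.inl (hfq0 p hp).ne'
    · exact hgq.rpow_const fun p hp => Or.inl (hgq0 p hp).ne'
  have hVG : ∀ p ∈ Ioo (0 : ℝ) 1, V ≤ G p := by
    intro p hp
    have := le_interp_mul hV hV (hfq0 p hp) (hgq0 p hp) hl
    rwa [← Real.rpow_add hV, sub_add_cancel, Real.rpow_one] at this
  have hae : (fun _ => ENNReal.ofReal V) =ᵐ[volume.restrict (Ioo 0 1)]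
      fun p => ENNReal.ofReal (G p) := by
    refine ae_eq_of_ae_le_of_lintegral_le ?_ (by simp) ?_ ?_
    · exact (ae_restrict_mem measurableSet_Ioo).mono fun p hp =>
        ENNReal.ofReal_le_ofReal (hVG p hp)
    · exact (hGc.aemeasurable measurableSet_Ioo).ennreal_ofReal
    · exact hle2.trans (le_of_eq (by simp))
  have hGV : EqOn (fun _ => V) G (Ioo 0 1) := by
    refine Measure.eqOn_open_of_ae_eq (μ := volume) ?_ isOpen_Ioo continuousOn_const hGc
    filter_upwards [hae, ae_restrict_mem measurableSet_Ioo] with p hp hp2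
    exact (ENNReal.ofReal_eq_ofReal_iff hV.le (hV.le.trans (hVG p hp2))).1 hp
  have heq : ∀ p ∈ Ioo (0 : ℝ) 1, f (q p) = f (-q' p) := by
    intro p hp
    have h1 := hGV hp
    simp only [hG] at h1
    have hx := hfq0 p hp
    have hy := hgq0 p hp
    generalize f (q p) = x at *
    generalize f (-q' p) = y at *
    rw [show (1 - 1 / 2 : ℝ) = 1 / 2 by norm_num, ← Real.sqrt_eq_rpow, ← Real.sqrt_eq_rpow] at h1
    obtain ⟨s, hs, rfl⟩ : ∃ s, 0 < s ∧ x = s ^ 2 :=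
      ⟨√x, Real.sqrt_pos.2 hx, (Real.sq_sqrt hx.le).symm⟩
    obtain ⟨t, ht, rfl⟩ : ∃ s, 0 < s ∧ y = s ^ 2 :=
      ⟨√y, Real.sqrt_pos.2 hy, (Real.sq_sqrt hy.le).symm⟩
    rw [Real.sqrt_sq hs.le, Real.sqrt_sq ht.le] at h1
    field_simp at h1
    have : (s - t) ^ 2 = 0 := by nlinarith
    have : s - t = 0 := by simpa using this
    rw [sub_eq_zero.1 this]
  obtain ⟨c, hcst⟩ : ∃ c, ∀ p ∈ Ioo (0 : ℝ) 1, q' p - q p = c := by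
    refine isOpen_Ioo.exists_is_const_of_deriv_eq_zero isPreconnected_Ioo
      (f := fun p => q' p - q p) (fun p hp => ?_) (fun p hp => ?_)
    · exact ((hq'.hasDerivAt p hp).sub (hq.hasDerivAt p hp)).differentiableAt.differentiableWithinAt
    · rw [((hq'.hasDerivAt p hp).fun_sub (hq.hasDerivAt p hp)).deriv, heq p hp]
      simp
  have hcab : c = -a - b := by
    have h1 : Ioo (a + c) (b + c) ⊆ Ioo (-b) (-a) := by
      intro y hy
      obtain ⟨p, hp, hpy⟩ := hq.surj (y - c) ⟨by linarith [hy.1], by linarith [hy.2]⟩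
      have := hcst p hp
      rw [show y = q' p by linarith]
      exact hq'.mem p hp
    rw [Ioo_subset_Ioo_iff (by linarith)] at h1
    linarith [h1.1, h1.2]
  obtain ⟨p, hp, rfl⟩ := hq.surj x hx
  have := hcst p hp
  rw [heq p hp]
  congr 1
  linarith

end Quantile

section Slices

variable {E : Type*} [NormedAddCommGroup E] [InnerProductSpace ℝ E]

/-- The slice of `K` at height `τ` in the direction `u`, inside the orthogonal complement of `u`. -/
def slice (u : E) (K : Set E) (τ : ℝ) : Set (ℝ ∙ u)ᗮ := {w | τ • u + (w : E) ∈ K}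

theorem inner_orthogonal (u : E) (w : (ℝ ∙ u)ᗮ) : ⟪u, (w : E)⟫ = 0 :=
  Submodule.mem_orthogonal_singleton_iff_inner_right.1 w.2

theorem inner_smul_add {u : E} (hu : ‖u‖ = 1) (τ : ℝ) (w : (ℝ ∙ u)ᗮ) :
    ⟪u, τ • u + (w : E)⟫ = τ := by
  rw [inner_add_right, inner_orthogonal, real_inner_smul_right, real_inner_self_eq_norm_sq, hu]
  simp

theorem exists_smul_add {u : E} (hu : ‖u‖ = 1) (x : E) :
    ∃ w : (ℝ ∙ u)ᗮ, ⟪u, x⟫ • u + (w : E) = x := by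
  refine ⟨⟨x - ⟪u, x⟫ • u, ?_⟩, by simp⟩
  rw [Submodule.mem_orthogonal_singleton_iff_inner_right, inner_sub_right, real_inner_smul_right,
    real_inner_self_eq_norm_sq, hu]
  simp

variable [FiniteDimensional ℝ E]

theorem finrank_orthogonal {u : E} (hu : ‖u‖ = 1) {n : ℕ} (hn : Module.finrank ℝ E = n + 1) :
    Module.finrank ℝ (ℝ ∙ u)ᗮ = n := by
  have hu0 : u ≠ 0 := by
    rintro rfl
    simp at hu
  have h1 := Submodule.finrank_add_finrank_orthogonal (ℝ ∙ u)
  rw [finrank_span_singleton hu0] at h1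
  omega

variable [MeasurableSpace E] [BorelSpace E]

/-- **Fubini** for slices. -/
theorem exists_slice_measure (μ : Measure E) [μ.IsAddHaarMeasure] {u : E} (hu : ‖u‖ = 1) :
    ∃ ν : Measure (ℝ ∙ u)ᗮ, ν.IsAddHaarMeasure ∧ ∀ A : Set E, MeasurableSet A →
      (Measurable fun τ => ν (slice u A τ)) ∧ μ A = ∫⁻ τ, ν (slice u A τ) := by
  set Φ₀ : (ℝ × (ℝ ∙ u)ᗮ) →ₗ[ℝ] E :=
    (LinearMap.toSpanSingleton ℝ E u).coprod (ℝ ∙ u)ᗮ.subtype with hΦ₀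
  have hΦ₀a : ∀ τ w, Φ₀ (τ, w) = τ • u + (w : E) := fun τ w => by simp [hΦ₀]
  have hbij : Function.Bijective Φ₀ := by
    constructor
    · rw [← LinearMap.ker_eq_bot, LinearMap.ker_eq_bot']
      rintro ⟨τ, w⟩ h
      rw [hΦ₀a] at h
      have h1 := inner_smul_add hu τ w
      rw [h, inner_zero_right] at h1
      subst h1
      simp only [zero_smul, zero_add] at h
      simp [Subtype.ext_iff, h]
    · intro x
      obtain ⟨w, hw⟩ := exists_smul_add hu x
      exact ⟨(⟪u, x⟫, w), by rw [hΦ₀a, hw]⟩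
  set Φ : (ℝ × (ℝ ∙ u)ᗮ) ≃L[ℝ] E := (LinearEquiv.ofBijective Φ₀ hbij).toContinuousLinearEquiv
  have hΦa : ∀ p, Φ p = p.1 • u + (p.2 : E) := fun p => hΦ₀a p.1 p.2
  set ν₀ : Measure (ℝ ∙ u)ᗮ := Measure.addHaar
  set ρ : Measure E := ((volume : Measure ℝ).prod ν₀).map Φ with hρ
  have : ρ.IsAddHaarMeasure := Φ.isAddHaarMeasure_map _
  obtain ⟨c, hc⟩ : ∃ c : NNReal, μ = c • ρ := ⟨_, Measure.isAddLeftInvariant_eq_smul μ ρ⟩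
  have hc0 : c ≠ 0 := by
    rintro rfl
    have h1 : μ univ ≠ 0 := (isOpen_univ.measure_pos μ univ_nonempty).ne'
    simp [hc] at h1
  refine ⟨c • ν₀, ?_, fun A hA => ?_⟩
  · exact Measure.IsAddHaarMeasure.smul ν₀ (c := (c : ENNReal)) (by simpa using hc0) (by simp)
  have hpre : MeasurableSet (Φ ⁻¹' A) := Φ.continuous.measurable hA
  have hm : Measurable fun τ => ν₀ (slice u A τ) := by
    have := measurable_measure_prodMk_left (ν := ν₀) hpre
    convert this using 3
    ext w
    simp [slice, hΦa]
  constructor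
  · simp only [Measure.smul_apply]
    exact hm.const_smul c
  · rw [hc, Measure.smul_apply, hρ, Measure.map_apply Φ.continuous.measurable hA,
      Measure.prod_apply hpre]
    simp only [Measure.smul_apply]
    rw [show (fun τ => c • ν₀ (slice u A τ)) = fun τ => (c : ENNReal) * ν₀ (slice u A τ) from rfl,
      lintegral_const_mul _ hm]
    rw [show ∀ x : ENNReal, c • x = (c : ENNReal) * x from fun _ => rfl]
    congr 2

end Slices

section Bodies

variable {E : Type*} [NormedAddCommGroup E] [InnerProductSpace ℝ E]

/-- A convex body: a compact convex set with nonempty interior. -/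
structure IsBody (K : Set E) : Prop where
  convex : Convex ℝ K
  isCompact : IsCompact K
  interior_nonempty : (interior K).Nonempty

theorem isCompact_slice {K : Set E} [FiniteDimensional ℝ E] (hK : IsCompact K) (u : E) (τ : ℝ) :
    IsCompact (slice u K τ) := by
  have he : Topology.IsClosedEmbedding fun w : (ℝ ∙ u)ᗮ => τ • u + (w : E) :=
    (Homeomorph.addLeft (τ • u)).isClosedEmbedding.comp
      (Submodule.closed_of_finiteDimensional _).isClosedEmbedding_subtypeVal
  exact he.isCompact_preimage hK

theorem IsBody.nonempty {K : Set E} (hK : IsBody K) : K.Nonempty :=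
  hK.interior_nonempty.mono interior_subset

theorem slice_combo {K L M : Set E} {u : E} {l : ℝ}
    (hM : ∀ x ∈ K, ∀ y ∈ L, (1 - l) • x + l • y ∈ M) {σ τ : ℝ} (v : (ℝ ∙ u)ᗮ)
    (hv : v ∈ slice u K σ) (w : (ℝ ∙ u)ᗮ) (hw : w ∈ slice u L τ) :
    (1 - l) • v + l • w ∈ slice u M ((1 - l) * σ + l * τ) := by
  have := hM _ hv _ hw
  simp only [slice, mem_ofPred_eq, Submodule.coe_add, Submodule.coe_smul]
  convert this using 1
  module

theorem convex_slice {K : Set E} (hK : Convex ℝ K) (u : E) (τ : ℝ) : Convex ℝ (slice u K τ) := by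
  intro v hv w hw a b ha hb hab
  have := slice_combo (l := b) (fun x hx y hy => hK hx hy (by linarith) hb (by ring)) v hv w hw
  rw [show a = 1 - b by linarith]
  rwa [show (1 - b) * τ + b * τ = τ by ring] at this

/-- The extent of a convex body in the direction `u`. -/
structure IsExtent (u : E) (K : Set E) (a b : ℝ) : Prop where
  lt : a < b
  mem_Icc : ∀ x ∈ K, ⟪u, x⟫ ∈ Icc a b
  exists_left : ∃ x ∈ K, ⟪u, x⟫ = a
  exists_right : ∃ x ∈ K, ⟪u, x⟫ = b

theorem IsBody.exists_isExtent {K : Set E} (hK : IsBody K) {u : E} (hu : ‖u‖ = 1) :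
    ∃ a b, IsExtent u K a b := by
  have hc : ContinuousOn (fun x => ⟪u, x⟫) K := by fun_prop
  obtain ⟨x, hx, hxm⟩ := hK.isCompact.exists_isMinOn hK.nonempty hc
  obtain ⟨y, hy, hym⟩ := hK.isCompact.exists_isMaxOn hK.nonempty hc
  refine ⟨⟪u, x⟫, ⟪u, y⟫, ?_, fun z hz => ⟨hxm hz, hym hz⟩, ⟨x, hx, rfl⟩, ⟨y, hy, rfl⟩⟩
  obtain ⟨z, hz⟩ := hK.interior_nonempty
  have hu0 : u ≠ 0 := by
    rintro rfl
    simp at hu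
  have h1 := inner_lt_of_mem_interior hu0 (fun w hw => hym hw) hz
  have h2 : ⟪u, x⟫ ≤ ⟪u, z⟫ := hxm (interior_subset hz)
  exact h2.trans_lt h1

theorem IsExtent.slice_eq_empty {K : Set E} {u : E} (hu : ‖u‖ = 1) {a b : ℝ}
    (h : IsExtent u K a b) {τ : ℝ} (hτ : τ ∉ Icc a b) : slice u K τ = ∅ := by
  rw [eq_empty_iff_forall_notMem]
  intro w hw
  have := h.mem_Icc _ hw
  rw [inner_smul_add hu] at this
  exact hτ this

theorem IsExtent.slice_isBody [FiniteDimensional ℝ E] {K : Set E} (hK : IsBody K) {u : E}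
    (hu : ‖u‖ = 1) {a b : ℝ} (h : IsExtent u K a b) {τ : ℝ} (hτ : τ ∈ Ioo a b) :
    IsBody (slice u K τ) := by
  refine ⟨convex_slice hK.convex u τ, isCompact_slice hK.isCompact u τ, ?_⟩
  have key : ∃ p ∈ interior K, ⟪u, p⟫ = τ := by
    obtain ⟨z, hz⟩ := hK.interior_nonempty
    have hc : ∀ x ∈ K, ∀ s ∈ Ico (0 : ℝ) 1, (1 - s) • z + s • x ∈ interior K := fun x hx s hs =>
      hK.convex.combo_interior_self_mem_interior hz hx (by linarith [hs.2]) hs.1 (by ring)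
    obtain ⟨x, hx, hxa⟩ := h.exists_left
    obtain ⟨y, hy, hyb⟩ := h.exists_right
    have hi : ∀ x s, ⟪u, (1 - s) • z + s • x⟫ = ⟪u, z⟫ + s * (⟪u, x⟫ - ⟪u, z⟫) := fun x s => by
      rw [inner_add_right, real_inner_smul_right, real_inner_smul_right]
      ring
    rcases lt_trichotomy τ ⟪u, z⟫ with hlt | heq | hgt
    · refine ⟨_, hc x hx ((⟪u, z⟫ - τ) / (⟪u, z⟫ - a)) ⟨?_, ?_⟩, ?_⟩
      · exact div_nonneg (by linarith) (by linarith [hτ.1])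
      · rw [div_lt_one (by linarith [hτ.1])]
        linarith [hτ.1]
      · rw [hi, hxa]
        have : ⟪u, z⟫ - a ≠ 0 := by linarith [hτ.1]
        field_simp
        ring
    · exact ⟨z, hz, heq.symm⟩
    · refine ⟨_, hc y hy ((τ - ⟪u, z⟫) / (b - ⟪u, z⟫)) ⟨?_, ?_⟩, ?_⟩
      · exact div_nonneg (by linarith) (by linarith [hτ.2])
      · rw [div_lt_one (by linarith [hτ.2])]
        linarith [hτ.2]
      · rw [hi, hyb]
        have : b - ⟪u, z⟫ ≠ 0 := by linarith [hτ.2]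
        field_simp
        ring
  obtain ⟨p, hp, rfl⟩ := key
  obtain ⟨w, hw⟩ := exists_smul_add hu p
  refine ⟨w, mem_interior.2 ⟨(fun w : (ℝ ∙ u)ᗮ => ⟪u, p⟫ • u + (w : E)) ⁻¹' interior K, ?_, ?_, ?_⟩⟩
  · exact fun v hv => interior_subset (s := K) hv
  · exact isOpen_interior.preimage (by fun_prop)
  · simpa [hw] using hp

end Bodies

section BrunnMinkowski

/-- The multiplicative form of the Brunn-Minkowski inequality for convex bodies. -/
def LogBrunnMinkowski {E : Type*} [NormedAddCommGroup E] [InnerProductSpace ℝ E]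
    [MeasurableSpace E] (μ : Measure E) : Prop :=
  ∀ K L M : Set E, IsBody K → IsBody L → IsCompact M → ∀ l ∈ Ioo (0 : ℝ) 1,
    (∀ x ∈ K, ∀ y ∈ L, (1 - l) • x + l • y ∈ M) → μ.real K ^ (1 - l) * μ.real L ^ l ≤ μ.real M

theorem IsBody.measureReal_pos {E : Type*} [NormedAddCommGroup E] [InnerProductSpace ℝ E]
    [MeasurableSpace E] {K : Set E} (hK : IsBody K) (μ : Measure E)
    [μ.IsAddHaarMeasure] : 0 < μ.real K := by
  refine ENNReal.toReal_pos ?_ hK.isCompact.measure_lt_top.ne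
  exact ((isOpen_interior.measure_pos μ hK.interior_nonempty).trans_le
    (measure_mono interior_subset)).ne'

variable {E : Type*} [NormedAddCommGroup E] [InnerProductSpace ℝ E] [FiniteDimensional ℝ E]
  [MeasurableSpace E] [BorelSpace E] {μ : Measure E} [μ.IsAddHaarMeasure] {u : E}
  {ν : Measure (ℝ ∙ u)ᗮ} [ν.IsAddHaarMeasure]

theorem slice_pos (hu : ‖u‖ = 1) {K : Set E} (hK : IsBody K) {a b : ℝ}
    (h : IsExtent u K a b) {τ : ℝ} (hτ : τ ∈ Ioo a b) : 0 < ν.real (slice u K τ) :=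
  (h.slice_isBody hK hu hτ).measureReal_pos ν

theorem slice_continuousOn (hν : LogBrunnMinkowski ν) (hu : ‖u‖ = 1) {K : Set E} (hK : IsBody K)
    {a b : ℝ} (h : IsExtent u K a b) :
    ContinuousOn (fun τ => ν.real (slice u K τ)) (Ioo a b) := by
  have hconc : ConcaveOn ℝ (Ioo a b) fun τ => Real.log (ν.real (slice u K τ)) := by
    rw [concaveOn_iff_forall_pos]
    refine ⟨convex_Ioo a b, fun x hx y hy s l hs hl hsl => ?_⟩
    obtain rfl : s = 1 - l := by linarith
    have h1 := hν _ _ _ (h.slice_isBody hK hu hx) (h.slice_isBody hK hu hy)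
      (isCompact_slice hK.isCompact u ((1 - l) * x + l * y)) l ⟨hl, by linarith⟩
      (slice_combo fun x hx y hy => hK.convex hx hy hs.le hl.le hsl)
    have hx0 := slice_pos (ν := ν) hu hK h hx
    have hy0 := slice_pos (ν := ν) hu hK h hy
    have h2 := Real.log_le_log (by positivity) h1
    rw [Real.log_mul (by positivity) (by positivity), Real.log_rpow hx0, Real.log_rpow hy0] at h2
    exact h2
  have hc := (hconc.continuousOn isOpen_Ioo).rexp
  refine hc.congr fun τ hτ => ?_
  exact (Real.exp_log (slice_pos hu hK h hτ)).symm

theorem slice_integrable (hμ : ∀ A : Set E, MeasurableSet A →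
      (Measurable fun τ => ν (slice u A τ)) ∧ μ A = ∫⁻ τ, ν (slice u A τ))
    (hu : ‖u‖ = 1) {K : Set E} (hK : IsBody K) {a b : ℝ} (h : IsExtent u K a b) :
    IntervalIntegrable (fun τ => ν.real (slice u K τ)) volume a b ∧
      ∫ τ in a..b, ν.real (slice u K τ) = μ.real K := by
  obtain ⟨hm, hi⟩ := hμ K hK.isCompact.measurableSet
  have hfint : Integrable (fun τ => ν.real (slice u K τ)) :=
    integrable_toReal_of_lintegral_ne_top hm.aemeasurable
      (by rw [← hi]; exact hK.isCompact.measure_lt_top.ne)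
  refine ⟨hfint.intervalIntegrable, ?_⟩
  rw [intervalIntegral.integral_of_le h.lt.le, ← integral_Icc_eq_integral_Ioc,
    setIntegral_eq_integral_of_forall_compl_eq_zero]
  · rw [measureReal_def, hi]
    exact integral_toReal hm.aemeasurable
      (Eventually.of_forall fun τ => (isCompact_slice hK.isCompact u τ).measure_lt_top)
  · intro τ hτ
    rw [h.slice_eq_empty hu hτ]
    simp

end BrunnMinkowski

theorem logBrunnMinkowski_of_finrank.{v} (n : ℕ) : ∀ (E : Type v) [NormedAddCommGroup E]
    [InnerProductSpace ℝ E] [FiniteDimensional ℝ E] [MeasurableSpace E] [BorelSpace E]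
    (μ : Measure E) [μ.IsAddHaarMeasure], Module.finrank ℝ E = n → LogBrunnMinkowski μ := by
  induction n with
  | zero =>
    intro E _ _ _ _ _ μ _ hn K L M hK hL hM l hl h
    have := Module.finrank_zero_iff.1 hn
    have hu : ∀ A : Set E, A.Nonempty → A = univ := fun A hA => Subsingleton.eq_univ_of_nonempty hA
    obtain ⟨x, hx⟩ := hK.nonempty
    obtain ⟨y, hy⟩ := hL.nonempty
    have hpos := hK.measureReal_pos μ
    rw [hu K ⟨x, hx⟩] at hpos ⊢
    rw [hu L ⟨y, hy⟩, hu M ⟨_, h x hx y hy⟩, ← Real.rpow_add hpos]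
    simp
  | succ n ih =>
    intro E _ _ _ _ _ μ _ hn K L M hK hL hM l hl h
    have : Nontrivial E := Module.nontrivial_of_finrank_pos (R := ℝ) (by omega)
    obtain ⟨u, hu⟩ := exists_norm_eq E (zero_le_one' ℝ)
    obtain ⟨ν, hν, hμ⟩ := exists_slice_measure μ hu
    have hBM := ih _ ν (finrank_orthogonal hu hn)
    obtain ⟨a, b, hab⟩ := hK.exists_isExtent hu
    obtain ⟨a', b', hab'⟩ := hL.exists_isExtent hu
    obtain ⟨hi, hV⟩ := slice_integrable hμ hu hK hab
    obtain ⟨hi', hV'⟩ := slice_integrable hμ hu hL hab'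
    obtain ⟨hpos, q, hq⟩ := exists_isQuantile hab.lt (slice_continuousOn hBM hu hK hab)
      (fun x hx => slice_pos hu hK hab hx) hi
    obtain ⟨hpos', q', hq'⟩ := exists_isQuantile hab'.lt (slice_continuousOn hBM hu hL hab')
      (fun x hx => slice_pos hu hL hab' hx) hi'
    have key := hq.prekopa hq' (fun x hx => slice_pos hu hK hab hx)
      (fun x hx => slice_pos hu hL hab' hx) hpos hpos' hl (H := fun τ => ν (slice u M τ)) (by
        intro x hx y hy
        refine ENNReal.ofReal_le_of_le_toReal ?_
        exact hBM _ _ _ (hab.slice_isBody hK hu hx) (hab'.slice_isBody hL hu hy)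
          (isCompact_slice hM _ _) l hl (slice_combo h))
    rw [hV, hV', ← (hμ M hM.measurableSet).2,
      ENNReal.ofReal_le_iff_le_toReal hM.measure_lt_top.ne] at key
    exact key

section Equality

variable {E : Type*} [NormedAddCommGroup E] [InnerProductSpace ℝ E] [FiniteDimensional ℝ E]
  [MeasurableSpace E] [BorelSpace E]

/-- The **Brunn-Minkowski inequality** for convex bodies, multiplicative form. -/
theorem logBrunnMinkowski (μ : Measure E) [μ.IsAddHaarMeasure] : LogBrunnMinkowski μ :=
  logBrunnMinkowski_of_finrank _ E μ rfl

variable {K : Set E}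

/-- The difference body `½ (K - K)`. -/
def diffBody (K : Set E) : Set E := (fun p : E × E => (1 / 2 : ℝ) • (p.1 - p.2)) '' K ×ˢ K

theorem IsBody.inner_integral_of_le {μ : Measure E} [μ.IsAddHaarMeasure] (hK : IsBody K)
    {M : Set E} (hM : IsCompact M) (hKM : ∀ x ∈ K, ∀ y ∈ K, (1 / 2 : ℝ) • (x - y) ∈ M)
    (hle : μ M ≤ μ K) {u : E} (hu : ‖u‖ = 1) {a b : ℝ} (h : IsExtent u K a b) :
    2 * ⟪u, ∫ x in K, x ∂μ⟫ = (a + b) * μ.real K := by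
  obtain ⟨ν, hν, hμ⟩ := exists_slice_measure μ hu
  have hBM := logBrunnMinkowski ν
  obtain ⟨hi, hV⟩ := slice_integrable hμ hu hK h
  have hsymm : ∀ τ ∈ Ioo a b, ν.real (slice u K (a + b - τ)) = ν.real (slice u K τ) := by
    intro τ hτ
    refine symmetric_of_lintegral_le (f := fun τ => ν.real (slice u K τ)) h.lt
      (slice_continuousOn hBM hu hK h)
      (fun x hx => slice_pos hu hK h hx) hi (H := fun τ => ν (slice u M τ)) ?_ ?_ hτ
    · intro x hx y hy
      refine ENNReal.ofReal_le_of_le_toReal ?_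
      have hneg : ν.real (slice u K y) = ν.real (-slice u K y) := by
        rw [measureReal_def, measureReal_def, Measure.measure_neg]
      have hbody := h.slice_isBody hK hu hy
      have hbody' : IsBody (-slice u K y) := by
        refine ⟨hbody.convex.neg, hbody.isCompact.neg, ?_⟩
        exact hbody.interior_nonempty.neg.mono
          (interior_maximal (neg_subset_neg.2 interior_subset) isOpen_interior.neg)
      have := hBM _ _ _ (h.slice_isBody hK hu hx) hbody'
          (isCompact_slice hM u ((1 / 2) * x - (1 / 2) * y)) (1 / 2) (by constructor <;> norm_num)
          (by
            intro v hv w hw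
            have h1 := hKM _ hv _ hw
            simp only [slice, mem_ofPred_eq, Submodule.coe_add, Submodule.coe_smul]
            convert h1 using 1
            simp only [Submodule.coe_neg]
            module)
      rw [show (1 - 1 / 2 : ℝ) = 1 / 2 by norm_num, ← hneg] at this
      exact this
    · rw [hV, ← (hμ M hM.measurableSet).2, measureReal_def,
        ENNReal.ofReal_toReal hK.isCompact.measure_lt_top.ne]
      exact hle
  have hsymm2 : ∀ᵐ τ : ℝ, ν (slice u K (a + b - τ)) = ν (slice u K τ) := by
    have h1 : ∀ᵐ τ : ℝ, τ ≠ a := by simp [ae_iff]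
    have h2 : ∀ᵐ τ : ℝ, τ ≠ b := by simp [ae_iff]
    filter_upwards [h1, h2] with τ ha hb
    by_cases hτ : τ ∈ Ioo a b
    · exact (ENNReal.toReal_eq_toReal_iff' (isCompact_slice hK.isCompact _ _).measure_lt_top.ne
        (isCompact_slice hK.isCompact _ _).measure_lt_top.ne).1 (hsymm τ hτ)
    · rw [h.slice_eq_empty hu, h.slice_eq_empty hu]
      · rintro ⟨h1, h2⟩
        exact hτ ⟨lt_of_le_of_ne h1 (Ne.symm ha), lt_of_le_of_ne h2 hb⟩
      · rintro ⟨h1, h2⟩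
        exact hτ ⟨lt_of_le_of_ne (by linarith) (Ne.symm ha), lt_of_le_of_ne (by linarith) hb⟩
  have hmu : Measurable fun x : E => ⟪u, x⟫ := by fun_prop
  have hmap : ∀ B : Set ℝ, MeasurableSet B →
      (μ.restrict K).map (fun x => ⟪u, x⟫) B = ∫⁻ τ, B.indicator (fun τ => ν (slice u K τ)) τ := by
    intro B hB
    rw [Measure.map_apply hmu hB, Measure.restrict_apply (hmu hB),
      (hμ _ ((hmu hB).inter hK.isCompact.measurableSet)).2]
    congr 1
    ext τ
    by_cases hτ : τ ∈ B
    · rw [indicator_of_mem hτ]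
      congr 1
      ext w
      simp only [slice, mem_ofPred_eq, mem_inter_iff, mem_preimage, inner_smul_add hu, hτ, true_and]
    · rw [indicator_of_notMem hτ]
      convert measure_empty (μ := ν)
      ext w
      simp only [slice, mem_ofPred_eq, mem_inter_iff, mem_preimage, inner_smul_add hu, hτ,
        false_and, mem_empty_iff_false]
  have hinv : ((μ.restrict K).map fun x => ⟪u, x⟫).map (fun τ => a + b - τ) =
      (μ.restrict K).map fun x => ⟪u, x⟫ := by
    have hms : Measurable fun τ : ℝ => a + b - τ := by fun_prop
    ext B hB
    rw [Measure.map_apply hms hB, hmap _ (hms hB), hmap _ hB,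
      ← lintegral_sub_left_eq_self (fun τ => B.indicator (fun τ => ν (slice u K τ)) τ) (a + b)]
    refine lintegral_congr_ae ?_
    filter_upwards [hsymm2] with τ hτ
    simp only [indicator, hτ]
    rfl
  have hIK : IntegrableOn (fun x : E => x) K μ :=
    continuousOn_id.integrableOn_compact hK.isCompact
  have hIu : IntegrableOn (fun x : E => ⟪u, x⟫) K μ :=
    (by fun_prop : Continuous fun x : E => ⟪u, x⟫).continuousOn.integrableOn_compact hK.isCompact
  have e1 : ∫ x in K, ⟪u, x⟫ ∂μ = ∫ x in K, (a + b - ⟪u, x⟫) ∂μ := by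
    have h1 : ∫ x in K, ⟪u, x⟫ ∂μ = ∫ τ, τ ∂((μ.restrict K).map fun x => ⟪u, x⟫) :=
      (integral_map hmu.aemeasurable aestronglyMeasurable_id).symm
    rw [h1]
    conv_lhs => rw [← hinv]
    have h2 : ∫ τ, τ ∂(((μ.restrict K).map fun x => ⟪u, x⟫).map fun τ => a + b - τ) =
        ∫ τ, (a + b - τ) ∂((μ.restrict K).map fun x => ⟪u, x⟫) :=
      integral_map (by fun_prop) aestronglyMeasurable_id
    rw [h2, integral_map hmu.aemeasurable (by fun_prop)]
  have : IsFiniteMeasure (μ.restrict K) :=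
    ⟨by rw [Measure.restrict_apply_univ]; exact hK.isCompact.measure_lt_top⟩
  rw [integral_sub (integrable_const _) hIu] at e1
  have e2 : ⟪u, ∫ x in K, x ∂μ⟫ = ∫ x in K, ⟪u, x⟫ ∂μ := (integral_inner hIK u).symm
  rw [e2]
  simp only [integral_const, measureReal_restrict_apply_univ, smul_eq_mul] at e1
  linarith

/-- **Equality case of the Brunn-Minkowski inequality** for a body and its reflection. -/
theorem IsBody.symmetric_of_le {μ : Measure E} [μ.IsAddHaarMeasure] (hK : IsBody K)
    {M : Set E} (hM : IsCompact M) (hKM : ∀ x ∈ K, ∀ y ∈ K, (1 / 2 : ℝ) • (x - y) ∈ M)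
    (hle : μ M ≤ μ K) : ∃ c : E, ∀ x ∈ K, c - x ∈ K := by
  have hV := hK.measureReal_pos μ
  refine ⟨(2 / μ.real K) • (∫ x in K, x ∂μ), fun x hx => ?_⟩
  by_contra hcon
  obtain ⟨f, s, hfs, hft⟩ :=
    geometric_hahn_banach_closed_point hK.convex hK.isCompact.isClosed hcon
  obtain ⟨v, hv⟩ : ∃ v : E, ∀ x, ⟪v, x⟫ = f x :=
    ⟨(InnerProductSpace.toDual ℝ E).symm f, fun x => by simp⟩
  have hv0 : v ≠ 0 := by
    rintro rfl
    have h1 := hfs x hx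
    rw [← hv, inner_zero_left] at h1
    rw [← hv, inner_zero_left] at hft
    linarith
  have hvn : 0 < ‖v‖ := norm_pos_iff.2 hv0
  have hu : ‖(‖v‖⁻¹ • v)‖ = 1 := norm_smul_inv_norm hv0
  obtain ⟨a, b, hab⟩ := hK.exists_isExtent hu
  have key := hK.inner_integral_of_le hM hKM hle hu hab
  obtain ⟨y, hy, hyb⟩ := hab.exists_right
  have hx1 := (hab.mem_Icc x hx).1
  have h1 := hfs y hy
  have h2 : f y < f ((2 / μ.real K) • (∫ x in K, x ∂μ) - x) := by linarith
  rw [← hv, ← hv, inner_sub_right, real_inner_smul_right] at h2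
  rw [real_inner_smul_left] at key hx1 hyb
  set I := ⟪v, ∫ x in K, x ∂μ⟫
  have hn0 := hvn.ne'
  have k1 : ⟪v, y⟫ = b * ‖v‖ := by field_simp at hyb; linarith
  have k2 : a * ‖v‖ ≤ ⟪v, x⟫ := by
    rw [inv_mul_eq_div, le_div_iff₀ hvn] at hx1
    exact hx1
  have k3 : 2 / μ.real K * I = (a + b) * ‖v‖ := by
    field_simp at key ⊢
    linarith
  nlinarith

end Equality

section Density

variable {E : Type*} [NormedAddCommGroup E] [InnerProductSpace ℝ E] [FiniteDimensional ℝ E]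
  [MeasurableSpace E] [BorelSpace E] {P S : Set E}

theorem exists_weight (μ : Measure E) [μ.IsAddHaarMeasure] (R : ℝ) (hR : 0 ≤ R) {ε : ℝ}
    (hε : 0 < ε) : ∃ w : E → ENNReal, Measurable w ∧ (∀ x, w x ≠ 0) ∧ ∫⁻ x, w x ∂μ ≠ ⊤ ∧
      ∀ x y, ‖x - y‖ ≤ R →
        w x ≤ ENNReal.ofReal ((1 + ε * R) ^ (Module.finrank ℝ E + 1 : ℝ)) * w y := by
  set r : ℝ := Module.finrank ℝ E + 1 with hr
  have hr0 : 0 ≤ r := by positivity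
  refine ⟨fun x => ENNReal.ofReal ((1 + ‖ε • x‖) ^ (-r)), by fun_prop, fun x => ?_, ?_, ?_⟩
  · have : 0 < (1 + ‖ε • x‖) ^ (-r) := Real.rpow_pos_of_pos (by positivity) _
    simpa using this
  · exact ((integrable_one_add_norm (μ := μ) (r := r) (by linarith)).comp_smul
      hε.ne').lintegral_lt_top.ne
  · intro x y hxy
    have h0 : 0 ≤ ε * R := by positivity
    rw [← ENNReal.ofReal_mul (by positivity)]
    refine ENNReal.ofReal_le_ofReal ?_
    rw [norm_smul, norm_smul, Real.norm_of_nonneg hε.le, Real.rpow_neg (by positivity),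
      Real.rpow_neg (by positivity), ← div_eq_mul_inv, le_div_iff₀ (by positivity),
      inv_mul_le_iff₀ (by positivity), ← Real.mul_rpow (by positivity) (by positivity)]
    refine Real.rpow_le_rpow (by positivity) ?_ hr0
    have h1 : ‖y‖ ≤ ‖x‖ + R := by
      have := norm_sub_norm_le y x
      rw [norm_sub_rev] at this
      linarith
    have h2 : ε * ‖y‖ ≤ ε * (‖x‖ + R) := by gcongr
    have h3 : 0 ≤ (ε * ‖x‖) * (ε * R) := by positivity
    nlinarith

theorem TranslateTiling.tsum_indicator_interior_le (hT : TranslateTiling P S) (x : E) :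
    ∑' s : S, (interior P).indicator (fun _ => (1 : ENNReal)) (x - s) ≤ 1 := by
  by_cases h : ∃ s : S, x - s ∈ interior P
  · obtain ⟨s, hs⟩ := h
    rw [tsum_eq_single s]
    · exact indicator_le_self' (fun _ _ => zero_le) _
    · intro s' hs'
      refine indicator_of_notMem (fun hx => hs' ?_) _
      exact Subtype.ext (hT.disjoint _ s'.2 _ s.2 x hx hs)
  · push Not at h
    simp [indicator_of_notMem (h _)]

theorem TranslateTiling.one_le_tsum_indicator (hT : TranslateTiling P S) (x : E) :
    1 ≤ ∑' s : S, P.indicator (fun _ => (1 : ENNReal)) (x - s) := by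
  obtain ⟨s, hs, hx⟩ := hT.cover x
  refine le_trans ?_ (ENNReal.le_tsum (⟨s, hs⟩ : S))
  rw [indicator_of_mem hx]

/-- If the periodization of `f` along the tiling is dominated by the periodization of `g`, then
the integral of `f` is at most the integral of `g`. -/
theorem TranslateTiling.lintegral_le (hT : TranslateTiling P S) (hP : Bornology.IsBounded P)
    (hne : (interior P).Nonempty) (μ : Measure E) [μ.IsAddHaarMeasure] {f g : E → ENNReal}
    (hf : Measurable f) (hg : Measurable g) {R : ℝ} (hfR : ∀ x, f x ≠ 0 → ‖x‖ ≤ R)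
    (hgR : ∀ x, g x ≠ 0 → ‖x‖ ≤ R)
    (hfg : ∀ᵐ x ∂μ, ∑' s : S, f (x - s) ≤ ∑' s : S, g (x - s)) :
    ∫⁻ x, f x ∂μ ≤ ∫⁻ x, g x ∂μ := by
  have hcount := (hT.countable hne).to_subtype
  obtain ⟨R₁, hR₁⟩ := hP.exists_norm_le
  set R' := max 0 (max R R₁) with hR'
  have hR0 : 0 ≤ R' := le_max_left _ _
  have hRR : R ≤ R' := (le_max_left _ _).trans (le_max_right _ _)
  have hRR1 : R₁ ≤ R' := (le_max_right _ _).trans (le_max_right _ _)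
  obtain ⟨s₀, hs₀, -⟩ := hT.cover 0
  have key : ∀ ε : ℝ, 0 < ε → ∫⁻ x, f x ∂μ ≤
      ENNReal.ofReal ((1 + ε * R') ^ (Module.finrank ℝ E + 1 : ℝ)) ^ 2 * ∫⁻ x, g x ∂μ := by
    intro ε hε
    obtain ⟨w, hwm, hw0, hwi, hw⟩ := exists_weight μ R' hR0 hε
    set c := ENNReal.ofReal ((1 + ε * R') ^ (Module.finrank ℝ E + 1 : ℝ)) with hc
    have hctop : c ≠ ⊤ := ENNReal.ofReal_ne_top
    have hshift : ∀ (φ : E → ENNReal) (s : E), ∫⁻ x, φ (x - s) ∂μ = ∫⁻ x, φ x ∂μ := fun φ s =>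
      lintegral_sub_right_eq_self φ s
    have hm : ∀ {φ : E → ENNReal}, Measurable φ → ∀ s : E, Measurable fun x => φ (x - s) :=
      fun hφ s => hφ.comp (measurable_id.sub_const s)
    have lower : ∀ φ : E → ENNReal, Measurable φ → (∀ x, φ x ≠ 0 → ‖x‖ ≤ R') →
        (∑' s : S, w s) * ∫⁻ x, φ x ∂μ ≤ c * ∫⁻ x, w x * ∑' s : S, φ (x - s) ∂μ := by
      intro φ hφ hφR
      have hmw : Measurable fun x => w x * ∑' s : S, φ (x - s) :=
        hwm.mul (Measurable.tsum fun s : S => hm hφ s)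
      have hmw' : ∀ s : S, AEMeasurable (fun x => c * (w x * φ (x - s))) μ := fun s =>
        ((hwm.mul (hm hφ s)).const_mul c).aemeasurable
      rw [← lintegral_const_mul _ hmw]
      simp_rw [← ENNReal.tsum_mul_left]
      rw [lintegral_tsum hmw',
        ← ENNReal.tsum_mul_right]
      refine ENNReal.tsum_le_tsum fun s => ?_
      rw [← hshift φ s, ← lintegral_const_mul _ (hm hφ s)]
      refine lintegral_mono fun x => ?_
      by_cases hx : φ (x - s) = 0
      · simp [hx]
      · rw [← mul_assoc]
        gcongr
        refine hw _ _ ?_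
        rw [norm_sub_rev]
        exact hφR _ hx
    have upper : ∀ φ : E → ENNReal, Measurable φ → (∀ x, φ x ≠ 0 → ‖x‖ ≤ R') →
        ∫⁻ x, w x * ∑' s : S, φ (x - s) ∂μ ≤ c * ((∑' s : S, w s) * ∫⁻ x, φ x ∂μ) := by
      intro φ hφ hφR
      have hmw : ∀ s : S, AEMeasurable (fun x => w x * φ (x - s)) μ := fun s =>
        (hwm.mul (hm hφ s)).aemeasurable
      simp_rw [← ENNReal.tsum_mul_left]
      rw [lintegral_tsum hmw,
        ← ENNReal.tsum_mul_right, ← ENNReal.tsum_mul_left]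
      refine ENNReal.tsum_le_tsum fun s => ?_
      rw [← hshift φ s, ← mul_assoc, ← lintegral_const_mul _ (hm hφ s)]
      refine lintegral_mono fun x => ?_
      by_cases hx : φ (x - s) = 0
      · simp [hx]
      · gcongr
        exact hw _ _ (hφR _ hx)
    have hW0 : (∑' s : S, w s) ≠ 0 := by
      intro h
      exact hw0 s₀ (ENNReal.tsum_eq_zero.1 h ⟨s₀, hs₀⟩)
    have hWtop : (∑' s : S, w s) ≠ ⊤ := by
      have h1 := lower ((interior P).indicator fun _ => 1)
        (measurable_const.indicator isOpen_interior.measurableSet)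
        (fun x hx =>
          (hR₁ x (interior_subset (by_contra fun h => hx (indicator_of_notMem h _)))).trans
          hRR1)
      rw [lintegral_indicator_const isOpen_interior.measurableSet, one_mul] at h1
      have h2 : c * ∫⁻ x, w x * ∑' s : S, (interior P).indicator (fun _ => (1 : ENNReal)) (x - s) ∂μ
          ≤ c * ∫⁻ x, w x ∂μ := by
        gcongr with x
        calc w x * _ ≤ w x * 1 := by gcongr; exact hT.tsum_indicator_interior_le x
          _ = w x := mul_one _
      intro htop
      rw [htop, ENNReal.top_mul (isOpen_interior.measure_pos μ hne).ne'] at h1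
      exact (ENNReal.mul_ne_top hctop hwi) (top_le_iff.1 (h1.trans h2))
    have h1 := lower f hf fun x hx => (hfR x hx).trans hRR
    have h2 := upper g hg fun x hx => (hgR x hx).trans hRR
    have h3 : ∫⁻ x, w x * ∑' s : S, f (x - s) ∂μ ≤ ∫⁻ x, w x * ∑' s : S, g (x - s) ∂μ := by
      refine lintegral_mono_ae ?_
      filter_upwards [hfg] with x hx
      gcongr
    have h4 : (∑' s : S, w s) * ∫⁻ x, f x ∂μ ≤ (∑' s : S, w s) * (c ^ 2 * ∫⁻ x, g x ∂μ) := by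
      calc _ ≤ c * (c * ((∑' s : S, w s) * ∫⁻ x, g x ∂μ)) := h1.trans (by gcongr; exact h3.trans h2)
        _ = _ := by ring
    exact (ENNReal.mul_le_mul_iff_right hW0 hWtop).1 h4
  have hlim : Tendsto (fun ε : ℝ => ENNReal.ofReal ((1 + ε * R') ^ (Module.finrank ℝ E + 1 : ℝ)) ^ 2
      * ∫⁻ x, g x ∂μ) (𝓝[>] 0) (𝓝 (1 * ∫⁻ x, g x ∂μ)) := by
    refine ENNReal.Tendsto.mul_const ?_ (Or.inl one_ne_zero)
    have h1 : Tendsto (fun ε : ℝ => (1 + ε * R') ^ (Module.finrank ℝ E + 1 : ℝ)) (𝓝[>] 0)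
        (𝓝 ((1 + 0 * R') ^ (Module.finrank ℝ E + 1 : ℝ))) := by
      refine tendsto_nhdsWithin_of_tendsto_nhds ?_
      refine Tendsto.rpow_const ?_ (Or.inr (by positivity))
      exact (Continuous.tendsto (by fun_prop) 0)
    have h2 := ENNReal.Tendsto.pow (n := 2) (ENNReal.tendsto_ofReal h1)
    simpa using h2
  rw [one_mul] at hlim
  exact ge_of_tendsto hlim (eventually_nhdsWithin_of_forall fun ε hε => key ε hε)

/-- A convex body that tiles by translates is centrally symmetric. -/
theorem TranslateTiling.exists_center (hT : TranslateTiling P S) (hP : IsBody P) :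
    ∃ c : E, ∀ x ∈ P, c - x ∈ P := by
  set μ : Measure E := Measure.addHaar
  set U : Set E := {x | ∃ p ∈ interior P, ∃ q ∈ interior P, x = (1 / 2 : ℝ) • (p - q)} with hU
  have hconv : Convex ℝ (interior P) := hP.convex.interior
  have hmid : ∀ p ∈ interior P, ∀ q ∈ interior P, (1 / 2 : ℝ) • (p + q) ∈ interior P := by
    intro p hp q hq
    rw [smul_add]
    exact hconv hp hq (by norm_num) (by norm_num) (by norm_num)
  have hUconv : Convex ℝ U := by
    rintro _ ⟨p, hp, q, hq, rfl⟩ _ ⟨p', hp', q', hq', rfl⟩ a b ha hb hab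
    exact ⟨a • p + b • p', hconv hp hp' ha hb hab,
      a • q + b • q', hconv hq hq' ha hb hab, by module⟩
  have hUopen : IsOpen U := by
    have : U = ⋃ q ∈ interior P, (fun x => (2 : ℝ) • x + q) ⁻¹' interior P := by
      ext x
      simp only [hU, mem_ofPred_eq, mem_iUnion, mem_preimage, exists_prop]
      constructor
      · rintro ⟨p, hp, q, hq, rfl⟩
        exact ⟨q, hq, by convert hp using 1; module⟩
      · rintro ⟨q, hq, hx⟩
        exact ⟨_, hx, q, hq, by module⟩
    rw [this]
    exact isOpen_biUnion fun q _ => isOpen_interior.preimage (by fun_prop)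
  obtain ⟨R, hR⟩ := hP.isCompact.isBounded.exists_norm_le
  have hUR : ∀ x ∈ U, ‖x‖ ≤ R := by
    rintro _ ⟨p, hp, q, hq, rfl⟩
    have h1 := hR p (interior_subset hp)
    have h2 := hR q (interior_subset hq)
    have h3 := norm_sub_le p q
    rw [norm_smul]
    norm_num
    linarith
  have hbdd : Bornology.IsBounded U := (isBounded_iff_forall_norm_le).2 ⟨R, hUR⟩
  have hpack : ∀ s ∈ S, ∀ s' ∈ S, ∀ x, x - s ∈ U → x - s' ∈ U → s = s' := by
    rintro s hs s' hs' x ⟨p, hp, q, hq, h1⟩ ⟨p', hp', q', hq', h2⟩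
    refine hT.disjoint s hs s' hs' (s + (1 / 2 : ℝ) • (p + q')) ?_ ?_
    · rw [add_sub_cancel_left]
      exact hmid p hp q' hq'
    · convert hmid p' hp' q hq using 1
      have : s = x - (1 / 2 : ℝ) • (p - q) := by rw [← h1]; abel
      have h' : s' = x - (1 / 2 : ℝ) • (p' - q') := by rw [← h2]; abel
      rw [this, h']
      module
  have hle : μ U ≤ μ P := by
    have := hT.lintegral_le hP.isCompact.isBounded hP.interior_nonempty μ
      (f := U.indicator fun _ => 1) (g := P.indicator fun _ => 1) (R := R)
      (measurable_const.indicator hUopen.measurableSet)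
      (measurable_const.indicator hP.isCompact.measurableSet)
      (fun x hx => hUR x (by_contra fun h => hx (indicator_of_notMem h _)))
      (fun x hx => hR x (by_contra fun h => hx (indicator_of_notMem h _)))
      (Eventually.of_forall fun x => by
        refine le_trans ?_ (hT.one_le_tsum_indicator x)
        by_cases h : ∃ s : S, x - s ∈ U
        · obtain ⟨s, hs⟩ := h
          rw [tsum_eq_single s]
          · exact indicator_le_self' (fun _ _ => zero_le) _
          · intro s' hs'
            refine indicator_of_notMem (fun hx => hs' ?_) _
            exact Subtype.ext (hpack _ s'.2 _ s.2 x hx hs)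
        · push Not at h
          simp [indicator_of_notMem (h _)])
    rwa [lintegral_indicator_const hUopen.measurableSet, one_mul,
      lintegral_indicator_const hP.isCompact.measurableSet, one_mul] at this
  have hcl : P = closure (interior P) := by
    rw [hP.convex.closure_interior_eq_closure_of_nonempty_interior hP.interior_nonempty,
      hP.isCompact.isClosed.closure_eq]
  refine hP.symmetric_of_le (μ := μ) (M := closure U) (hbdd.isCompact_closure) ?_ ?_
  · intro x hx y hy
    rw [hcl] at hx hy
    exact map_mem_closure₂ (f := fun x y : E => (1 / 2 : ℝ) • (x - y)) (by fun_prop) hx hy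
      fun p hp q hq => ⟨p, hp, q, hq, rfl⟩
  · have h1 : μ (closure U) ≤ μ U := by
      calc μ (closure U) = μ (U ∪ frontier U) := by rw [← closure_eq_self_union_frontier]
        _ ≤ μ U + μ (frontier U) := measure_union_le _ _
        _ = μ U := by rw [hUconv.addHaar_frontier μ, add_zero]
    exact h1.trans hle

end Density

section Jumps

/-- If a linear combination of functions, each continuous on a closed interval and zero outside it,
vanishes almost everywhere, then the jumps at the endpoints of the intervals add up to zero. -/
theorem sum_jumps_eq_zero {κ : Type*} [Fintype κ] {a b c : κ → ℝ} {m : κ → ℝ → ℝ}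
    (hab : ∀ k, a k ≤ b k) (hc : ∀ k, ContinuousOn (m k) (Icc (a k) (b k)))
    (h0 : ∀ k, ∀ x, x ∉ Icc (a k) (b k) → m k x = 0)
    (hsum : ∀ᵐ x : ℝ, ∑ k, c k * m k x = 0) :
    ∑ k, c k * m k (a k) = ∑ k, c k * m k (b k) := by
  classical
  set e : κ → ℝ → ℝ := fun k x => m k (max (a k) (min (b k) x)) with he
  have hec : ∀ k, Continuous (e k) := fun k =>
    (hc k).comp_continuous (by fun_prop)
      fun x => ⟨le_max_left _ _, max_le (hab k) (min_le_left _ _)⟩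
  set Φ : (κ → Prop × Prop) → ℝ := fun p =>
    ∑ k, c k * ((if (p k).1 then m k (a k) else 0) + (if (p k).2 then m k (b k) else 0)) with hΦ
  set G : ℝ → ℝ := fun x => ∑ k, c k * e k x with hG
  have hGc : Continuous G := continuous_finsetSum _ fun k _ => continuous_const.mul (hec k)
  have hek : ∀ k x, e k x = m k x + ((if x < a k then m k (a k) else 0) +
      (if b k < x then m k (b k) else 0)) := by
    intro k x
    have hk := hab k
    simp only [he]
    by_cases h1 : x < a k
    · rw [min_eq_right (by linarith), max_eq_left h1.le, if_pos h1, if_neg (by linarith),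
        h0 k x fun h => by linarith [h.1]]
      ring
    · by_cases h2 : b k < x
      · rw [min_eq_left h2.le, max_eq_right hk, if_neg h1, if_pos h2,
          h0 k x fun h => by linarith [h.2]]
        ring
      · rw [min_eq_right (by linarith), max_eq_right (by linarith), if_neg h1, if_neg h2]
        ring
  have hfin : (range Φ).Finite := finite_range Φ
  have hdense : Dense {x | G x ∈ range Φ} := by
    refine Measure.dense_of_ae (μ := volume) ?_
    filter_upwards [hsum] with x hx
    refine ⟨fun k => (x < a k, b k < x), ?_⟩
    simp only [hΦ, hG, hek, mul_add, Finset.sum_add_distrib] at hx ⊢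
    linarith
  have hall : ∀ x, G x ∈ range Φ := by
    intro x
    have hcl : IsClosed {x | G x ∈ range Φ} := hfin.isClosed.preimage hGc
    have : x ∈ closure {x | G x ∈ range Φ} := hdense x
    rwa [hcl.closure_eq] at this
  have hss : (range G).Subsingleton := by
    by_contra hnt
    rw [Set.not_subsingleton_iff] at hnt
    exact (isPreconnected_range hGc).infinite_of_nontrivial hnt
      (hfin.subset (range_subset_iff.2 hall))
  obtain ⟨A, hA⟩ := (finite_range a).bddBelow
  obtain ⟨B, hB⟩ := (finite_range b).bddAbove
  have := hss (mem_range_self A) (mem_range_self B)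
  have hA' : ∀ k, e k A = m k (a k) := fun k => by
    have := hA (mem_range_self k)
    simp only [he]
    rw [min_eq_right (by linarith [hab k]), max_eq_left this]
  have hB' : ∀ k, e k B = m k (b k) := fun k => by
    have := hB (mem_range_self k)
    simp only [he]
    rw [min_eq_left this, max_eq_right (hab k)]
  simpa only [hG, hA', hB'] using this

end Jumps

section SliceContinuity

variable {E : Type*} [NormedAddCommGroup E] [InnerProductSpace ℝ E] [FiniteDimensional ℝ E]
  [MeasurableSpace E] [BorelSpace E] {u : E} {ν : Measure (ℝ ∙ u)ᗮ} [ν.IsAddHaarMeasure]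

/-- The volume of slices of a compact set is upper semicontinuous. -/
theorem eventually_slice_le (hu : ‖u‖ = 1) {K : Set E} (hK : IsCompact K) (e : ℝ) {ε : ℝ}
    (hε : 0 < ε) : ∀ᶠ τ in 𝓝 e, ν.real (slice u K τ) ≤ ν.real (slice u K e) + ε := by
  have hc := isCompact_slice hK u e
  obtain ⟨U, hU, hUo, hUlt⟩ := hc.exists_isOpen_lt_add (μ := ν)
    (ε := ENNReal.ofReal ε) (by simpa using hε)
  have hproj : ∀ (τ : ℝ) (w : (ℝ ∙ u)ᗮ),
      (ℝ ∙ u)ᗮ.orthogonalProjectionOnto (τ • u + (w : E)) = w := by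
    intro τ w
    rw [map_add, Submodule.orthogonalProjectionOnto_mem_subspace_eq_self, map_smul,
      Submodule.orthogonalProjectionOnto_orthogonal_apply_eq_zero
        (Submodule.mem_span_singleton_self u)]
    simp
  set C : Set E := K ∩ (ℝ ∙ u)ᗮ.orthogonalProjectionOnto ⁻¹' Uᶜ
  have hC : IsCompact C := hK.inter_right (hUo.isClosed_compl.preimage (by fun_prop))
  have hCi : IsClosed ((fun x => ⟪u, x⟫) '' C) := (hC.image (by fun_prop)).isClosed
  have he : e ∉ (fun x => ⟪u, x⟫) '' C := by
    rintro ⟨x, ⟨hxK, hxU⟩, hxe⟩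
    obtain ⟨w, hw⟩ := exists_smul_add hu x
    simp only at hxe
    rw [hxe] at hw
    rw [mem_preimage, ← hw, hproj] at hxU
    exact hxU (hU (by rw [slice, mem_ofPred_eq, hw]; exact hxK))
  filter_upwards [hCi.isOpen_compl.mem_nhds he] with τ hτ
  have hsub : slice u K τ ⊆ U := by
    intro w hw
    by_contra hwU
    refine hτ ⟨τ • u + (w : E), ⟨hw, ?_⟩, inner_smul_add hu τ w⟩
    rw [mem_preimage, hproj]
    exact hwU
  have hfin : ν (slice u K e) ≠ ⊤ := hc.measure_lt_top.ne
  have h1 : ν (slice u K τ) ≤ ν (slice u K e) + ENNReal.ofReal ε :=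
    (measure_mono hsub).trans hUlt.le
  have h2 := ENNReal.toReal_mono (by simp [hfin]) h1
  rwa [ENNReal.toReal_add hfin (by simp), ENNReal.toReal_ofReal hε.le] at h2

theorem isBody_of_measure_pos {E : Type*} [NormedAddCommGroup E] [InnerProductSpace ℝ E]
    [FiniteDimensional ℝ E] [MeasurableSpace E] [BorelSpace E] {μ : Measure E}
    [μ.IsAddHaarMeasure] {K : Set E} (hK : Convex ℝ K)
    (hc : IsCompact K) (h : μ K ≠ 0) : IsBody K := by
  refine ⟨hK, hc, ?_⟩
  by_contra hne
  rw [not_nonempty_iff_eq_empty] at hne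
  refine h ?_
  have := hK.addHaar_frontier μ
  rwa [frontier, hne, sdiff_empty, hc.isClosed.closure_eq] at this

theorem slice_continuousOn_Icc (hu : ‖u‖ = 1) {K : Set E} (hK : IsBody K) {a b : ℝ}
    (h : IsExtent u K a b) : ContinuousOn (fun τ => ν.real (slice u K τ)) (Icc a b) := by
  intro e he
  set c := (a + b) / 2 with hc
  have hlt := h.lt
  have hcm : c ∈ Ioo a b := ⟨by linarith, by linarith⟩
  have hslice := slice_continuousOn (logBrunnMinkowski ν) hu hK h
  by_cases hee : e ∈ Ioo a b
  · exact ((hslice e hee).continuousAt (isOpen_Ioo.mem_nhds hee)).continuousWithinAt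
  have hce : c - e ≠ 0 := by
    intro h0
    exact hee (by rwa [sub_eq_zero.1 h0] at hcm)
  refine tendsto_order.2 ⟨fun y hy => ?_, fun y hy => ?_⟩
  · by_cases hpos : ν (slice u K e) = 0
    · have : ν.real (slice u K e) = 0 := by simp [measureReal_def, hpos]
      simp only [this] at hy
      exact Eventually.of_forall fun τ => hy.trans_le measureReal_nonneg
    have hbe := isBody_of_measure_pos (convex_slice hK.convex u e)
      (isCompact_slice hK.isCompact u e)
      hpos
    have hme := hbe.measureReal_pos ν
    have hmc := slice_pos (ν := ν) hu hK h hcm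
    have hlim : Tendsto (fun τ => ν.real (slice u K e) ^ (1 - (τ - e) / (c - e)) *
        ν.real (slice u K c) ^ ((τ - e) / (c - e))) (𝓝[Icc a b] e) (𝓝 (ν.real (slice u K e))) := by
      have hcont : Continuous fun τ => ν.real (slice u K e) ^ (1 - (τ - e) / (c - e)) *
          ν.real (slice u K c) ^ ((τ - e) / (c - e)) :=
        (Continuous.rpow (by fun_prop) (by fun_prop) fun _ => Or.inl hme.ne').mul
          (Continuous.rpow (by fun_prop) (by fun_prop) fun _ => Or.inl hmc.ne')
      have := hcont.tendsto e
      simp only [sub_self, zero_div, sub_zero, Real.rpow_one, Real.rpow_zero, mul_one] at this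
      exact tendsto_nhdsWithin_of_tendsto_nhds this
    have hnear : ∀ᶠ τ in 𝓝[Icc a b] e, (τ - e) / (c - e) < 1 := by
      have : Tendsto (fun τ => (τ - e) / (c - e)) (𝓝[Icc a b] e) (𝓝 ((e - e) / (c - e))) :=
        tendsto_nhdsWithin_of_tendsto_nhds
          (Continuous.tendsto (by fun_prop : Continuous fun τ => (τ - e) / (c - e)) e)
      rw [sub_self, zero_div] at this
      exact this.eventually_lt_const one_pos
    filter_upwards [hlim.eventually_const_lt hy, hnear, self_mem_nhdsWithin] with τ h1 h2 h3
    rcases eq_or_ne τ e with rfl | hne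
    · exact hy
    refine h1.trans_le ?_
    have hl0 : 0 < (τ - e) / (c - e) := by
      rcases lt_or_gt_of_ne hce with hneg | hpos'
      · have : e = b := by
          by_contra hb
          exact hee ⟨by linarith [hcm.1], lt_of_le_of_ne he.2 hb⟩
        subst this
        exact div_pos_of_neg_of_neg (by linarith [lt_of_le_of_ne h3.2 hne]) hneg
      · have : e = a := by
          by_contra ha
          exact hee ⟨lt_of_le_of_ne he.1 (Ne.symm ha), by linarith [hcm.2]⟩
        subst this
        exact div_pos (by linarith [lt_of_le_of_ne h3.1 (Ne.symm hne)]) hpos'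
    have hs : (1 - (τ - e) / (c - e)) * e + (τ - e) / (c - e) * c = τ := by
      field_simp
      ring
    have := logBrunnMinkowski ν _ _ _ hbe (h.slice_isBody hK hu hcm)
      (isCompact_slice hK.isCompact u ((1 - (τ - e) / (c - e)) * e + (τ - e) / (c - e) * c))
      _ ⟨hl0, h2⟩
      (slice_combo fun x hx y hy => hK.convex hx hy (by linarith) hl0.le (by ring))
    rwa [hs] at this
  · have := eventually_slice_le (ν := ν) hu hK.isCompact e (ε := (y - ν.real (slice u K e)) / 2)
      (by simp only at hy; linarith)
    filter_upwards [mem_nhdsWithin_of_mem_nhds this] with τ hτ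
    simp only at hy
    linarith

end SliceContinuity

section Dissections

variable {E : Type*} [NormedAddCommGroup E] [InnerProductSpace ℝ E] [FiniteDimensional ℝ E]
  [MeasurableSpace E] [BorelSpace E] {μ : Measure E} [μ.IsAddHaarMeasure] {u : E}
  {ν : Measure (ℝ ∙ u)ᗮ} [ν.IsAddHaarMeasure]

theorem ae_slice_eq_zero (hμ : ∀ A : Set E, MeasurableSet A →
      (Measurable fun τ => ν (slice u A τ)) ∧ μ A = ∫⁻ τ, ν (slice u A τ))
    {N : Set E} (hN : MeasurableSet N) (h0 : μ N = 0) : ∀ᵐ τ : ℝ, ν (slice u N τ) = 0 := by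
  obtain ⟨hm, hi⟩ := hμ N hN
  rw [h0, eq_comm, lintegral_eq_zero_iff hm] at hi
  exact hi

/-- The two extremal slices of a centrally symmetric convex body have equal volume. -/
theorem IsExtent.slice_ends_eq_of_symmetric (hu : ‖u‖ = 1) {Q : Set E} {a b : ℝ} {c : E}
    (h : IsExtent u Q a b) (hc : ∀ x ∈ Q, c - x ∈ Q) :
    ν.real (slice u Q a) = ν.real (slice u Q b) := by
  obtain ⟨x, hx, hxa⟩ := h.exists_left
  obtain ⟨y, hy, hyb⟩ := h.exists_right
  have h1 := (h.mem_Icc _ (hc x hx)).2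
  have h2 := (h.mem_Icc _ (hc y hy)).1
  rw [inner_sub_right] at h1 h2
  obtain ⟨w, hw⟩ := exists_smul_add hu c
  have hcc : ⟪u, c⟫ = a + b := by linarith
  rw [hcc] at hw
  have hs : slice u Q b = (fun v => w - v) ⁻¹' slice u Q a := by
    ext v
    have e1 : a • u + ((w - v : (ℝ ∙ u)ᗮ) : E) = c - (b • u + (v : E)) := by
      rw [← hw, Submodule.coe_sub]
      module
    simp only [slice, mem_preimage, mem_ofPred_eq, e1]
    refine ⟨hc _, fun h => ?_⟩
    simpa using hc _ h
  have hp : MeasurePreserving (fun v => w - v) ν ν := Measure.measurePreserving_sub_left ν w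
  rw [hs, measureReal_def, measureReal_def, hp.measure_preimage_emb
    (Homeomorph.subLeft w).measurableEmbedding]

/-- If a convex body is dissected into finitely many centrally symmetric convex bodies, then its
two extremal slices in any direction have equal volume. -/
theorem IsExtent.slice_ends_eq_of_dissection (hμ : ∀ A : Set E, MeasurableSet A →
      (Measurable fun τ => ν (slice u A τ)) ∧ μ A = ∫⁻ τ, ν (slice u A τ))
    (hu : ‖u‖ = 1) {K : Set E} (hK : IsBody K) {a b : ℝ} (h : IsExtent u K a b)
    {κ : Type*} [Finite κ] {Q : κ → Set E} {c : κ → E} (hQ : ∀ k, IsBody (Q k))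
    (hc : ∀ k, ∀ x ∈ Q k, c k - x ∈ Q k) (hsub : ∀ k, Q k ⊆ K)
    (hcov : μ (K \ ⋃ k, Q k) = 0) (hdisj : ∀ k l, k ≠ l → μ (Q k ∩ Q l) = 0) :
    ν.real (slice u K a) = ν.real (slice u K b) := by
  have := Fintype.ofFinite κ
  choose α β hαβ using fun k => (hQ k).exists_isExtent hu
  have hmK := hK.isCompact.measurableSet
  have hmQ := fun k => (hQ k).isCompact.measurableSet
  have hae : ∀ᵐ τ : ℝ, ν.real (slice u K τ) = ∑ k, ν.real (slice u (Q k) τ) := by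
    have h1 := ae_slice_eq_zero hμ (hmK.diff (MeasurableSet.iUnion hmQ)) hcov
    have h2 : ∀ᵐ τ : ℝ, ∀ k l, k ≠ l → ν (slice u (Q k ∩ Q l) τ) = 0 := by
      rw [ae_all_iff]
      intro k
      rw [ae_all_iff]
      intro l
      by_cases hkl : k = l
      · simp [hkl]
      · filter_upwards [ae_slice_eq_zero hμ ((hmQ k).inter (hmQ l)) (hdisj k l hkl)] with τ hτ _
        exact hτ
    filter_upwards [h1, h2] with τ h1 h2
    have e1 : ν (slice u K τ) = ν (⋃ k, slice u (Q k) τ) := by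
      refine le_antisymm ?_ (measure_mono (iUnion_subset fun k w hw => hsub k hw))
      have : slice u K τ ⊆ slice u (K \ ⋃ k, Q k) τ ∪ ⋃ k, slice u (Q k) τ := by
        intro w hw
        by_cases hw' : τ • u + (w : E) ∈ ⋃ k, Q k
        · right
          simpa [slice] using hw'
        · exact Or.inl ⟨hw, hw'⟩
      refine (measure_mono this).trans ((measure_union_le _ _).trans ?_)
      rw [h1, zero_add]
    have e2 : ν (⋃ k, slice u (Q k) τ) = ∑ k, ν (slice u (Q k) τ) := by
      rw [measure_iUnion₀ (f := fun k => slice u (Q k) τ) (fun k l hkl => h2 k l hkl)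
        fun k => (isCompact_slice (hQ k).isCompact u τ).measurableSet.nullMeasurableSet,
        tsum_fintype]
    rw [measureReal_def, e1, e2, ENNReal.toReal_sum
      fun k _ => (isCompact_slice (hQ k).isCompact u τ).measure_lt_top.ne]
    rfl
  have key := sum_jumps_eq_zero (κ := Option κ) (a := fun k => k.elim a α)
    (b := fun k => k.elim b β) (c := fun k => k.elim (-1) fun _ => 1)
    (m := fun k τ => k.elim (ν.real (slice u K τ)) fun k => ν.real (slice u (Q k) τ))
    (by
      rintro (_ | k)
      · exact h.lt.le
      · exact (hαβ k).lt.le)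
    (by
      rintro (_ | k)
      · exact slice_continuousOn_Icc hu hK h
      · exact slice_continuousOn_Icc hu (hQ k) (hαβ k))
    (by
      rintro (_ | k) x hx
      · simp [h.slice_eq_empty hu hx]
      · simp [(hαβ k).slice_eq_empty hu hx])
    (by
      filter_upwards [hae] with τ hτ
      simp [Fintype.sum_option, hτ])
  have hsymm : ∀ k, ν.real (slice u (Q k) (α k)) = ν.real (slice u (Q k) (β k)) := fun k =>
    (hαβ k).slice_ends_eq_of_symmetric hu (hc k)
  simp [Fintype.sum_option, hsymm] at key
  exact key

end Dissections

section Cones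

variable {E : Type*} [NormedAddCommGroup E] [InnerProductSpace ℝ E]

/-- The cone with apex `0` (the apex removed) over the slice of `K` at height `τ`. -/
def sliceCone (u : E) (K : Set E) (τ : ℝ) : Set E :=
  {y | 0 < ⟪u, y⟫ / τ ∧ ⟪u, y⟫ / τ ≤ 1 ∧ (τ / ⟪u, y⟫) • y ∈ K}

theorem sliceCone_subset {K : Set E} (hK : Convex ℝ K) (h0 : (0 : E) ∈ K) (u : E) (τ : ℝ) :
    sliceCone u K τ ⊆ K := by
  rintro y ⟨h1, h2, h3⟩
  have := hK.smul_mem_of_zero_mem h0 h3 ⟨h1.le, h2⟩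
  rw [smul_smul] at this
  have hy : ⟪u, y⟫ ≠ 0 := by
    intro h
    simp [h] at h1
  have hτ : τ ≠ 0 := by
    rintro rfl
    simp at h1
  rwa [div_mul_div_cancel₀ hτ, div_self hy, one_smul] at this

variable [FiniteDimensional ℝ E] [MeasurableSpace E] [BorelSpace E]

theorem measurableSet_sliceCone {K : Set E} (hK : IsClosed K) (u : E) (τ : ℝ) :
    MeasurableSet (sliceCone u K τ) := by
  have hm : Measurable fun y : E => ⟪u, y⟫ :=
    (continuous_const.inner continuous_id).measurable
  refine (measurableSet_lt measurable_const (hm.div_const τ)).inter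
    ((measurableSet_le (hm.div_const τ) measurable_const).inter ?_)
  exact ((measurable_const.div hm).smul measurable_id) hK.measurableSet

variable {μ : Measure E} [μ.IsAddHaarMeasure] {u : E}
  {ν : Measure (ℝ ∙ u)ᗮ} [ν.IsAddHaarMeasure]

theorem measureReal_sliceCone (hμ : ∀ A : Set E, MeasurableSet A →
      (Measurable fun τ => ν (slice u A τ)) ∧ μ A = ∫⁻ τ, ν (slice u A τ)) {m : ℕ}
    (hm : Module.finrank ℝ E = m + 1)
    (hu : ‖u‖ = 1) {K : Set E} (hK : IsCompact K) {τ : ℝ} (hτ : τ ≠ 0) :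
    (m + 1) * μ.real (sliceCone u K τ) = |τ| * ν.real (slice u K τ) := by
  obtain ⟨hmeas, hi⟩ := hμ _ (measurableSet_sliceCone hK.isClosed u τ)
  have hslice_smul : ∀ σ, 0 < σ / τ ∧ σ / τ ≤ 1 →
      slice u (sliceCone u K τ) σ = (σ / τ) • slice u K τ := by
    intro σ hσ
    have hσ0 : σ ≠ 0 := by
      rintro rfl
      simp at hσ
    ext w
    rw [mem_smul_set_iff_inv_smul_mem₀ hσ.1.ne']
    simp only [slice, sliceCone, mem_ofPred_eq, inner_smul_add hu, hσ.1, hσ.2, true_and,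
      Submodule.coe_smul, inv_div]
    rw [smul_add, smul_smul, div_mul_cancel₀ τ hσ0]
  have hslice_empty : ∀ σ, ¬ (0 < σ / τ ∧ σ / τ ≤ 1) → slice u (sliceCone u K τ) σ = ∅ := by
    intro σ hσ
    rw [eq_empty_iff_forall_notMem]
    rintro w ⟨h1, h2, -⟩
    rw [inner_smul_add hu] at h1 h2
    exact hσ ⟨h1, h2⟩
  have hslice : ∀ σ, ν.real (slice u (sliceCone u K τ) σ) =
      {σ | 0 < σ / τ ∧ σ / τ ≤ 1}.indicator (fun σ => (σ / τ) ^ m * ν.real (slice u K τ)) σ := by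
    intro σ
    by_cases hσ : 0 < σ / τ ∧ σ / τ ≤ 1
    · rw [indicator_of_mem (by exact hσ), hslice_smul σ hσ, measureReal_def,
        Measure.addHaar_smul, finrank_orthogonal hu hm,
        abs_of_nonneg (pow_nonneg hσ.1.le _), ENNReal.toReal_mul,
        ENNReal.toReal_ofReal (pow_nonneg hσ.1.le _), measureReal_def]
    · rw [indicator_of_notMem (by exact hσ), hslice_empty σ hσ, measureReal_empty]
  have hfin : ∀ᵐ σ, ν (slice u (sliceCone u K τ) σ) < ⊤ := by
    refine Eventually.of_forall fun σ => ?_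
    by_cases hσ : 0 < σ / τ ∧ σ / τ ≤ 1
    · rw [hslice_smul σ hσ]
      exact ((isCompact_slice hK u τ).smul _).measure_lt_top
    · simp [hslice_empty σ hσ]
  have hreal : μ.real (sliceCone u K τ) = ∫ σ, ν.real (slice u (sliceCone u K τ) σ) := by
    rw [measureReal_def, hi, ← integral_toReal hmeas.aemeasurable hfin]
    rfl
  have hset : MeasurableSet {σ : ℝ | 0 < σ / τ ∧ σ / τ ≤ 1} :=
    (measurableSet_lt measurable_const (measurable_id.div_const τ)).inter
      (measurableSet_le (measurable_id.div_const τ) measurable_const)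
  have hpow : ∫ σ in (0 : ℝ)..τ, (σ / τ) ^ m * ν.real (slice u K τ) =
      τ / (m + 1) * ν.real (slice u K τ) := by
    rw [intervalIntegral.integral_mul_const,
      intervalIntegral.integral_comp_div (fun x => x ^ m) hτ, integral_pow, zero_div, div_self hτ]
    simp
    left
    ring
  rw [hreal]
  simp only [hslice]
  rw [integral_indicator hset]
  have hm0 : (m + 1 : ℝ) ≠ 0 := by positivity
  rcases lt_or_gt_of_ne hτ with hneg | hpos
  · have : {σ : ℝ | 0 < σ / τ ∧ σ / τ ≤ 1} = Ico τ 0 := by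
      ext σ
      rw [mem_ofPred_eq, mem_Ico, div_le_one_of_neg hneg]
      constructor
      · rintro ⟨h1, h2⟩
        exact ⟨h2, by
          by_contra h
          exact absurd h1 (not_lt.2 (div_nonpos_of_nonneg_of_nonpos (by linarith) hneg.le))⟩
      · rintro ⟨h1, h2⟩
        exact ⟨div_pos_of_neg_of_neg h2 hneg, h1⟩
    rw [this, integral_Ico_eq_integral_Ioc, ← intervalIntegral.integral_of_le hneg.le,
      intervalIntegral.integral_symm, hpow, abs_of_neg hneg]
    field_simp
  · have : {σ : ℝ | 0 < σ / τ ∧ σ / τ ≤ 1} = Ioc 0 τ := by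
      ext σ
      rw [mem_ofPred_eq, mem_Ioc, div_le_one hpos]
      exact and_congr_left fun _ => div_pos_iff_of_pos_right hpos
    rw [this, ← intervalIntegral.integral_of_le hpos.le, hpow, abs_of_pos hpos]
    field_simp

end Cones

section ConeSums

variable {E : Type*} [NormedAddCommGroup E] [InnerProductSpace ℝ E] [FiniteDimensional ℝ E]
  [MeasurableSpace E] [BorelSpace E] {μ : Measure E} [μ.IsAddHaarMeasure]

theorem addHaar_inner_eq_zero {v : E} (hv : v ≠ 0) : μ {y : E | ⟪v, y⟫ = 0} = 0 := by
  have h : {y : E | ⟪v, y⟫ = 0} = ((ℝ ∙ v)ᗮ : Submodule ℝ E) := by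
    ext y
    exact Submodule.mem_orthogonal_singleton_iff_inner_right.symm
  rw [h]
  refine Measure.addHaar_submodule μ _ fun htop => hv ?_
  have : v ∈ (ℝ ∙ v)ᗮ := htop ▸ Submodule.mem_top
  rw [Submodule.mem_orthogonal_singleton_iff_inner_right] at this
  exact inner_self_eq_zero.1 this

theorem sum_sliceCone_le {ι : Type*} [Fintype ι] {u : ι → E} {τ : ι → ℝ} {K : Set E}
    (hK : Convex ℝ K) (hKc : IsCompact K) (h0 : (0 : E) ∈ K)
    (hsupp : ∀ i, ∀ y ∈ K, ⟪u i, y⟫ / τ i ≤ 1)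
    (hne : ∀ i j, i ≠ j → (τ i)⁻¹ • u i ≠ (τ j)⁻¹ • u j) :
    ∑ i, μ.real (sliceCone (u i) K (τ i)) ≤ μ.real K := by
  have hle : ∀ i j, ∀ y ∈ sliceCone (u i) K (τ i), ⟪u j, y⟫ / τ j ≤ ⟪u i, y⟫ / τ i := by
    rintro i j y ⟨h1, h2, h3⟩
    have := hsupp j _ h3
    rw [real_inner_smul_right] at this
    have e : τ i / ⟪u i, y⟫ * ⟪u j, y⟫ / τ j = (⟪u j, y⟫ / τ j) / (⟪u i, y⟫ / τ i) := by
      rw [div_div_eq_mul_div, mul_comm (τ i / _), mul_div_assoc', mul_div_right_comm]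
      ring
    rwa [e, div_le_one h1] at this
  have hdisj : Pairwise (Function.onFun (AEDisjoint μ) fun i => sliceCone (u i) K (τ i)) := by
    intro i j hij
    refine measure_mono_null ?_ (addHaar_inner_eq_zero (μ := μ) (sub_ne_zero.2 (hne i j hij)))
    rintro y ⟨h1, h2⟩
    have := le_antisymm (hle i j y h1) (hle j i y h2)
    rw [mem_ofPred_eq, inner_sub_left, real_inner_smul_left, real_inner_smul_left]
    rw [div_eq_inv_mul, div_eq_inv_mul] at this
    linarith
  have hsub : ∀ i, sliceCone (u i) K (τ i) ⊆ K := fun i => sliceCone_subset hK h0 _ _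
  have hfin : ∀ i, μ (sliceCone (u i) K (τ i)) ≠ ⊤ := fun i =>
    ((measure_mono (hsub i)).trans_lt hKc.measure_lt_top).ne
  simp only [measureReal_def]
  rw [← ENNReal.toReal_sum fun i _ => hfin i]
  refine ENNReal.toReal_mono hKc.measure_lt_top.ne ?_
  rw [← tsum_fintype (L := .unconditional ι), ← measure_iUnion₀ hdisj
    fun i => (measurableSet_sliceCone hKc.isClosed _ _).nullMeasurableSet]
  exact measure_mono (iUnion_subset hsub)

theorem cap_le {u : E} {ν : Measure (ℝ ∙ u)ᗮ} [ν.IsAddHaarMeasure]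
    (hμ : ∀ A : Set E, MeasurableSet A →
      (Measurable fun τ => ν (slice u A τ)) ∧ μ A = ∫⁻ τ, ν (slice u A τ))
    (hu : ‖u‖ = 1) {K : Set E} (hK : IsCompact K) {e : ℝ} (he : ∀ x ∈ K, ⟪u, x⟫ ≤ e)
    {ε : ℝ} (hε : 0 < ε) :
    ∀ᶠ s in 𝓝[>] (0 : ℝ), μ.real {y ∈ K | e - s ≤ ⟪u, y⟫} ≤ s * (ν.real (slice u K e) + ε) := by
  obtain ⟨δ, hδ, hball⟩ := Metric.eventually_nhds_iff.1 (eventually_slice_le (ν := ν) hu hK e hε)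
  filter_upwards [Ioo_mem_nhdsGT hδ] with s hs
  have hcl : IsCompact {y ∈ K | e - s ≤ ⟪u, y⟫} :=
    hK.inter_right (t := {y | e - s ≤ ⟪u, y⟫})
      (isClosed_le continuous_const (by fun_prop))
  set r := ν.real (slice u K e) + ε with hr
  have hr0 : 0 ≤ r := by positivity
  have hbd : ∀ τ, ν (slice u {y ∈ K | e - s ≤ ⟪u, y⟫} τ) ≤
      (Icc (e - s) e).indicator (fun _ => ENNReal.ofReal r) τ := by
    intro τ
    by_cases hτ : τ ∈ Icc (e - s) e
    · rw [indicator_of_mem hτ]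
      refine (measure_mono (t := slice u K τ) fun w hw => hw.1).trans ?_
      rw [← ENNReal.ofReal_toReal (isCompact_slice hK u τ).measure_lt_top.ne]
      refine ENNReal.ofReal_le_ofReal (hball ?_)
      rw [Real.dist_eq, abs_lt]
      constructor <;> linarith [hτ.1, hτ.2, hs.1, hs.2]
    · have : slice u {y ∈ K | e - s ≤ ⟪u, y⟫} τ = ∅ := by
        rw [eq_empty_iff_forall_notMem]
        rintro w ⟨h1, h2⟩
        have h3 := he _ h1
        rw [inner_smul_add hu] at h2 h3
        exact hτ ⟨h2, h3⟩
      rw [this, measure_empty]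
      exact zero_le
  have h1 : μ {y ∈ K | e - s ≤ ⟪u, y⟫} ≤ ENNReal.ofReal (s * r) := by
    rw [(hμ _ hcl.measurableSet).2]
    refine (lintegral_mono hbd).trans ?_
    rw [lintegral_indicator_const measurableSet_Icc, Real.volume_Icc, ← ENNReal.ofReal_mul hr0]
    exact ENNReal.ofReal_le_ofReal (by linarith)
  have := ENNReal.toReal_mono (by simp) h1
  rwa [ENNReal.toReal_ofReal (mul_nonneg hs.1.le hr0)] at this

theorem isCompact_diffBody {K : Set E} (hK : IsCompact K) : IsCompact (diffBody K) :=
  (hK.prod hK).image (by fun_prop)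

theorem IsBody.diffBody {K : Set E} (hK : IsBody K) : IsBody (diffBody K) := by
  refine ⟨?_, isCompact_diffBody hK.isCompact, ?_⟩
  · rintro _ ⟨⟨p, q⟩, ⟨hp, hq⟩, rfl⟩ _ ⟨⟨p', q'⟩, ⟨hp', hq'⟩, rfl⟩ s t hs ht hst
    refine ⟨(s • p + t • p', s • q + t • q'), ⟨hK.convex hp hp' hs ht hst,
      hK.convex hq hq' hs ht hst⟩, ?_⟩
    simp only
    module
  · obtain ⟨z, hz⟩ := hK.interior_nonempty
    refine ⟨0, mem_interior.2 ⟨(fun x => (2 : ℝ) • x + z) ⁻¹' interior K, ?_,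
      isOpen_interior.preimage (by fun_prop), by simpa using hz⟩⟩
    intro x hx
    exact ⟨((2 : ℝ) • x + z, z), ⟨interior_subset hx, interior_subset hz⟩, by simp only; module⟩

/-- If the two extremal slices of a convex polytope orthogonal to each facet normal have equal
volume, then the difference body is not larger than the polytope. -/
theorem diffBody_le {ι : Type*} [Finite ι] {u : ι → E} {h g : ι → ℝ} {K : Set E} {m : ℕ}
    (hm : Module.finrank ℝ E = m + 1)
    (hK : IsBody K) (hu : ∀ i, ‖u i‖ = 1) (hinj : Function.Injective u) (h0 : 0 ∈ interior K)
    (hmem : ∀ x, x ∈ K ↔ ∀ i, ⟪u i, x⟫ ≤ h i) (hext : ∀ i, IsExtent (u i) K (-g i) (h i))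
    (hends : ∀ i, ∀ ν : Measure (ℝ ∙ u i)ᗮ, ν.IsAddHaarMeasure →
      (∀ A : Set E, MeasurableSet A →
        (Measurable fun τ => ν (slice (u i) A τ)) ∧ μ A = ∫⁻ τ, ν (slice (u i) A τ)) →
      ν.real (slice (u i) K (-g i)) = ν.real (slice (u i) K (h i))) :
    μ.real (diffBody K) ≤ μ.real K := by
  have := Fintype.ofFinite ι
  choose ν hνh hν using fun i => exists_slice_measure μ (hu i)
  have hu0 : ∀ i, u i ≠ 0 := fun i => by
    intro h
    simpa [h] using hu i
  have hpos : ∀ i, 0 < h i := fun i => by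
    simpa using inner_lt_of_mem_interior (hu0 i) (fun y hy => ((hext i).mem_Icc y hy).2) h0
  have gpos : ∀ i, 0 < g i := fun i => by
    simpa using inner_lt_of_mem_interior (neg_ne_zero.2 (hu0 i)) (c := g i)
      (fun y hy => by rw [inner_neg_left]; linarith [((hext i).mem_Icc y hy).1]) h0
  set V := μ.real K with hVdef
  have hV : 0 < V := hK.measureReal_pos μ
  set a : ι → ℝ := fun i => (ν i).real (slice (u i) K (h i)) with ha
  set n : ℝ := m + 1 with hn
  have hsum1 : ∑ i, h i * a i ≤ n * V := by
    have := sum_sliceCone_le (μ := μ) (u := u) (τ := h) hK.convex hK.isCompact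
      (interior_subset h0) (fun i y hy => by
        rw [div_le_one (hpos i)]
        exact ((hext i).mem_Icc y hy).2) (fun i j hij heq => by
        have hnorm := congrArg norm heq
        rw [norm_smul, norm_smul, hu, hu, mul_one, mul_one, norm_inv, norm_inv, inv_inj,
          Real.norm_of_nonneg (hpos i).le, Real.norm_of_nonneg (hpos j).le] at hnorm
        rw [hnorm] at heq
        exact hij (hinj (smul_right_injective E (inv_ne_zero (hpos j).ne') heq)))
    have h2 := mul_le_mul_of_nonneg_left this (by positivity : 0 ≤ n)
    rw [Finset.mul_sum] at h2
    refine le_trans (le_of_eq (Finset.sum_congr rfl fun i _ => ?_)) h2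
    rw [hn, measureReal_sliceCone (hν i) hm (hu i) hK.isCompact (hpos i).ne', abs_of_pos (hpos i)]
  have hsum2 : ∑ i, g i * a i ≤ n * V := by
    have := sum_sliceCone_le (μ := μ) (u := u) (τ := fun i => -g i) hK.convex hK.isCompact
      (interior_subset h0) (fun i y hy => by
        rw [div_neg, ← neg_div, div_le_one (gpos i)]
        linarith [((hext i).mem_Icc y hy).1]) (fun i j hij heq => by
        have hnorm := congrArg norm heq
        rw [norm_smul, norm_smul, hu, hu, mul_one, mul_one, norm_inv, norm_inv, inv_inj, norm_neg,
          norm_neg, Real.norm_of_nonneg (gpos i).le, Real.norm_of_nonneg (gpos j).le] at hnorm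
        simp only [hnorm] at heq
        exact hij (hinj (smul_right_injective E
          (inv_ne_zero (neg_ne_zero.2 (gpos j).ne')) heq)))
    have h2 := mul_le_mul_of_nonneg_left this (by positivity : 0 ≤ n)
    rw [Finset.mul_sum] at h2
    refine le_trans (le_of_eq (Finset.sum_congr rfl fun i _ => ?_)) h2
    rw [hn, measureReal_sliceCone (hν i) hm (hu i) hK.isCompact (neg_ne_zero.2 (gpos i).ne'),
      abs_neg, abs_of_pos (gpos i), hends i (ν i) (hνh i) (hν i)]
  set l : ι → ℝ := fun i => (h i + g i) / 2 with hl
  have hlpos : ∀ i, 0 < l i := fun i => by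
    have := hpos i
    have := gpos i
    simp only [hl]
    positivity
  have hsum : ∑ i, l i * a i ≤ n * V := by
    have : ∑ i, l i * a i = (∑ i, h i * a i + ∑ i, g i * a i) / 2 := by
      rw [← Finset.sum_add_distrib, Finset.sum_div]
      exact Finset.sum_congr rfl fun i _ => by simp only [hl]; ring
    linarith
  have hD := hK.diffBody
  have hDpos := hD.measureReal_pos μ
  set D := μ.real (TranslationTiling.diffBody K)
  -- the inner parallel bodies
  set I : ℝ → Set E := fun s => {y | ∀ i, ⟪u i, y⟫ ≤ h i - s * l i} with hI
  have hIK : ∀ s, 0 ≤ s → I s ⊆ K := fun s hs y hy => (hmem y).2 fun i =>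
    (hy i).trans (by linarith [mul_nonneg hs (hlpos i).le])
  have hIcl : ∀ s, IsClosed (I s) := fun s => by
    simp only [hI, ofPred_forall]
    exact isClosed_iInter fun i => isClosed_le (by fun_prop) continuous_const
  have hIconv : ∀ s, Convex ℝ (I s) := fun s => by
    simp only [hI, ofPred_forall]
    exact convex_iInter fun i => convex_halfSpace_le (innerₛₗ ℝ (u i)).isLinear _
  have hIbody : ∀ᶠ s in 𝓝[>] (0 : ℝ), IsBody (I s) := by
    have h1 : ∀ᶠ s in 𝓝[>] (0 : ℝ), ∀ i, 0 < h i - s * l i := by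
      rw [eventually_all]
      intro i
      have : Tendsto (fun s => h i - s * l i) (𝓝[>] 0) (𝓝 (h i - 0 * l i)) :=
        tendsto_nhdsWithin_of_tendsto_nhds (Continuous.tendsto (by fun_prop) 0)
      exact this.eventually_const_lt (by simpa using hpos i)
    filter_upwards [h1, self_mem_nhdsWithin] with s hs hs0
    refine ⟨hIconv s, hK.isCompact.of_isClosed_subset (hIcl s) (hIK s (le_of_lt hs0)), 0,
      mem_interior.2 ⟨{y | ∀ i, ⟪u i, y⟫ < h i - s * l i}, fun y hy i => (hy i).le, ?_, ?_⟩⟩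
    · simp only [ofPred_forall]
      exact isOpen_iInter_of_finite fun i => isOpen_lt (by fun_prop) continuous_const
    · simpa using hs
  have hcombo : ∀ s, 0 < s → ∀ y ∈ I s, ∀ d ∈ TranslationTiling.diffBody K, y + s • d ∈ K := by
    rintro s hs y hy _ ⟨⟨p, q⟩, ⟨hp, hq⟩, rfl⟩
    refine (hmem _).2 fun i => ?_
    have h1 := ((hext i).mem_Icc p hp).2
    have h2 := ((hext i).mem_Icc q hq).1
    have h3 := hy i
    simp only [inner_add_right, real_inner_smul_right, inner_sub_right]
    have : s * (1 / 2 * (⟪u i, p⟫ - ⟪u i, q⟫)) ≤ s * l i :=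
      mul_le_mul_of_nonneg_left (by simp only [hl]; linarith) hs.le
    linarith
  have hvol : ∀ η > 0, ∀ᶠ s in 𝓝[>] (0 : ℝ), V * (1 - s * (n + η)) ≤ μ.real (I s) := by
    intro η hη
    set ε := η * V / (1 + ∑ i, l i) with hε
    have hls : 0 ≤ ∑ i, l i := Finset.sum_nonneg fun i _ => (hlpos i).le
    have hε0 : 0 < ε := by positivity
    have hcap : ∀ᶠ s in 𝓝[>] (0 : ℝ), ∀ i,
        μ.real {y ∈ K | h i - s * l i ≤ ⟪u i, y⟫} ≤ s * l i * (a i + ε) := by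
      rw [eventually_all]
      intro i
      have ht : Tendsto (fun s => s * l i) (𝓝[>] 0) (𝓝[>] 0) := by
        refine tendsto_nhdsWithin_iff.2 ⟨?_, ?_⟩
        · have : Tendsto (fun s => s * l i) (𝓝 0) (𝓝 (0 * l i)) :=
            Continuous.tendsto (by fun_prop) 0
          rw [zero_mul] at this
          exact tendsto_nhdsWithin_of_tendsto_nhds this
        · filter_upwards [self_mem_nhdsWithin] with s hs
          exact mul_pos hs (hlpos i)
      exact ht.eventually (cap_le (hν i) (hu i) hK.isCompact
        (fun x hx => ((hext i).mem_Icc x hx).2) hε0)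
    filter_upwards [hcap, self_mem_nhdsWithin] with s hs hs0
    have hs0' : (0 : ℝ) < s := hs0
    have hcov : K ⊆ I s ∪ ⋃ i, {y ∈ K | h i - s * l i ≤ ⟪u i, y⟫} := by
      intro y hy
      by_cases hyI : y ∈ I s
      · exact Or.inl hyI
      · right
        simp only [hI, mem_ofPred_eq, not_forall, not_le] at hyI
        obtain ⟨i, hi⟩ := hyI
        exact mem_iUnion.2 ⟨i, hy, hi.le⟩
    have hUK : ⋃ i, {y ∈ K | h i - s * l i ≤ ⟪u i, y⟫} ⊆ K := iUnion_subset fun i => sep_subset _ _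
    have hfin : μ (I s ∪ ⋃ i, {y ∈ K | h i - s * l i ≤ ⟪u i, y⟫}) ≠ ⊤ :=
      ((measure_mono (union_subset (hIK s hs0'.le) hUK)).trans_lt
        hK.isCompact.measure_lt_top).ne
    have h1 : V ≤ μ.real (I s) + ∑ i, s * l i * (a i + ε) := by
      refine (measureReal_mono hcov hfin).trans ((measureReal_union_le _ _).trans ?_)
      gcongr
      exact (measureReal_iUnion_fintype_le _).trans (Finset.sum_le_sum fun i _ => hs i)
    have h2 : ∑ i, s * l i * (a i + ε) = s * (∑ i, l i * a i + ε * ∑ i, l i) := by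
      rw [Finset.mul_sum, ← Finset.sum_add_distrib, Finset.mul_sum]
      exact Finset.sum_congr rfl fun i _ => by ring
    have h3 : ε * ∑ i, l i ≤ η * V := by
      rw [hε, div_mul_eq_mul_div, div_le_iff₀ (by positivity)]
      gcongr
      linarith
    have h4 : s * (∑ i, l i * a i + ε * ∑ i, l i) ≤ s * (n * V + η * V) := by gcongr
    rw [h2] at h1
    linarith
  have hlog : ∀ η > 0, Real.log D ≤ Real.log V + η := by
    intro η hη
    have hc1 : 0 < n + η := by positivity
    have hev : ∀ᶠ s in 𝓝[>] (0 : ℝ), (1 - s) * n - Real.log V -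
        (1 - s) * ((n + η) / (1 - s * (n + η))) + Real.log D ≤ 0 := by
      filter_upwards [hIbody, hvol η hη, Ioo_mem_nhdsGT (one_pos : (0 : ℝ) < 1),
        Ioo_mem_nhdsGT (inv_pos.2 hc1)] with s hb hs hs1 hs2
      obtain ⟨hs0, hs1⟩ := hs1
      have h1s : 0 < 1 - s := by linarith
      have hx : 0 < 1 - s * (n + η) := by
        have := mul_lt_mul_of_pos_right hs2.2 hc1
        rw [inv_mul_cancel₀ hc1.ne'] at this
        linarith
      have hbody : IsBody ((1 - s)⁻¹ • I s) := by
        refine ⟨hb.convex.smul _, hb.isCompact.smul _, ?_⟩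
        rw [interior_smul₀ (inv_ne_zero h1s.ne')]
        exact hb.interior_nonempty.smul_set
      have hBM := logBrunnMinkowski μ _ _ _ hbody hD hK.isCompact s ⟨hs0, hs1⟩ (by
        rintro _ ⟨y, hy, rfl⟩ d hd
        simp only [smul_smul, mul_inv_cancel₀ h1s.ne', one_smul]
        exact hcombo s hs0 y hy d hd)
      have hIpos := hb.measureReal_pos μ
      have hbpos := hbody.measureReal_pos μ
      have hmul : μ.real ((1 - s)⁻¹ • I s) = ((1 - s) ^ (m + 1))⁻¹ * μ.real (I s) := by
        rw [measureReal_def, Measure.addHaar_smul, hm, ENNReal.toReal_mul, inv_pow,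
          abs_of_pos (by positivity), ENNReal.toReal_ofReal (by positivity), measureReal_def]
      have h2 := Real.log_le_log (by positivity) hBM
      rw [Real.log_mul (by positivity) (by positivity), Real.log_rpow hbpos, Real.log_rpow hDpos,
        hmul, Real.log_mul (by positivity) hIpos.ne', Real.log_inv, Real.log_pow] at h2
      have h3 := Real.log_le_log (by positivity) hs
      rw [Real.log_mul hV.ne' hx.ne'] at h3
      have h4 := Real.one_sub_inv_le_log_of_pos hx
      have h5 := Real.log_le_sub_one_of_pos h1s
      push_cast at h2
      rw [← hn] at h2
      have hn0 : 0 < n := by positivity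
      have h6 : n * s ≤ -(n * Real.log (1 - s)) := by nlinarith
      have h7 : 1 - (1 - s * (n + η))⁻¹ = -(s * ((n + η) / (1 - s * (n + η)))) := by
        field_simp
        ring
      rw [h7] at h4
      have h8 : (1 - s) * (n * s + (Real.log V - s * ((n + η) / (1 - s * (n + η))))) ≤
          (1 - s) * (-(n * Real.log (1 - s)) + Real.log (μ.real (I s))) :=
        mul_le_mul_of_nonneg_left (by linarith) h1s.le
      have h9 : s * ((1 - s) * n - Real.log V -
          (1 - s) * ((n + η) / (1 - s * (n + η))) + Real.log D) ≤ 0 := by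
        linarith
      exact nonpos_of_mul_nonpos_right h9 hs0
    have hlim : Tendsto (fun s => (1 - s) * n - Real.log V -
        (1 - s) * ((n + η) / (1 - s * (n + η))) + Real.log D) (𝓝[>] (0 : ℝ))
        (𝓝 ((1 - 0) * n - Real.log V - (1 - 0) * ((n + η) / (1 - 0 * (n + η))) + Real.log D)) := by
      refine tendsto_nhdsWithin_of_tendsto_nhds (ContinuousAt.tendsto ?_)
      have : (1 : ℝ) - 0 * (n + η) ≠ 0 := by simp
      fun_prop (disch := assumption)
    have := le_of_tendsto hlim hev
    simp only [sub_zero, one_mul, zero_mul, div_one] at this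
    linarith
  exact (Real.log_le_log_iff hDpos hV).1 (le_of_forall_pos_le_add hlog)

end ConeSums

section Minkowski

variable {E : Type*} [NormedAddCommGroup E] [InnerProductSpace ℝ E]

theorem exists_unit_halfSpaces {ι : Type*} [Finite ι] {K : Set E} (hne : K.Nonempty) {a : ι → E}
    {c : ι → ℝ} (hK : ∀ x, x ∈ K ↔ ∀ i, ⟪a i, x⟫ ≤ c i) :
    ∃ A : Set (E × ℝ), A.Finite ∧ (∀ a ∈ A, ‖a.1‖ = 1) ∧ K = halfSpaces A := by
  refine ⟨(fun i => (‖a i‖⁻¹ • a i, ‖a i‖⁻¹ * c i)) '' {i | a i ≠ 0}, (toFinite _).image _, ?_, ?_⟩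
  · rintro _ ⟨i, hi, rfl⟩
    exact norm_smul_inv_norm hi
  · ext x
    rw [hK]
    simp only [halfSpaces, forall_mem_image, mem_ofPred_eq, real_inner_smul_left]
    refine forall_congr' fun i => ?_
    constructor
    · intro h _
      gcongr
    · intro h
      by_cases h0 : a i = 0
      · obtain ⟨y, hy⟩ := hne
        have := (hK y).1 hy i
        rw [h0, inner_zero_left] at this ⊢
        exact this
      · exact le_of_mul_le_mul_left (h h0) (inv_pos.2 (norm_pos_iff.2 h0))

variable [FiniteDimensional ℝ E] [MeasurableSpace E] [BorelSpace E]

theorem IsBody.exists_center_of_zero_mem {μ : Measure E} [μ.IsAddHaarMeasure] {K : Set E}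
    (hK : IsBody K) (hpoly : ∃ A : Set (E × ℝ), A.Finite ∧ (∀ a ∈ A, ‖a.1‖ = 1) ∧ K = halfSpaces A)
    (h0 : 0 ∈ interior K)
    (hends : ∀ u : E, ‖u‖ = 1 → ∀ ν : Measure (ℝ ∙ u)ᗮ, ν.IsAddHaarMeasure →
      (∀ A : Set E, MeasurableSet A →
        (Measurable fun τ => ν (slice u A τ)) ∧ μ A = ∫⁻ τ, ν (slice u A τ)) →
      ∀ a b, IsExtent u K a b → ν.real (slice u K a) = ν.real (slice u K b)) :
    ∃ c, ∀ x ∈ K, c - x ∈ K := by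
  rcases Nat.eq_zero_or_pos (Module.finrank ℝ E) with hd | hd
  · have := Module.finrank_zero_iff.1 hd
    exact ⟨0, fun x hx => by rwa [Subsingleton.elim (0 - x) x]⟩
  obtain ⟨m, hm⟩ : ∃ m, Module.finrank ℝ E = m + 1 := ⟨_, (Nat.succ_pred_eq_of_pos hd).symm⟩
  obtain ⟨A, hA, hA1, hKA⟩ := hpoly
  obtain ⟨B, hBA, hB⟩ := exists_isFacetRep hK.interior_nonempty hA hA1 hKA
  have : Finite B := hA.subset hBA
  choose a b hab using fun i : B => hK.exists_isExtent (hB.norm_eq i)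
  have hbi : ∀ i : B, b i = i.1.2 := by
    intro i
    obtain ⟨x, hx, hxb⟩ := (hab i).exists_right
    obtain ⟨y, hy, hy'⟩ := hB.exists_facet_point i
    refine le_antisymm (hxb ▸ hB.le hx i) ?_
    rw [← hy]
    exact ((hab i).mem_Icc y (hB.mem_of_facet_point hy hy')).2
  have hle := diffBody_le (μ := μ) (g := fun i => - a i) hm hK hB.norm_eq hB.injective h0
    hB.mem_iff (fun i => by rw [neg_neg, ← hbi]; exact hab i)
    (fun i ν hν hμ => by
      rw [neg_neg, ← hbi]
      exact hends _ (hB.norm_eq i) ν hν hμ _ _ (hab i))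
  have hDc := isCompact_diffBody hK.isCompact
  exact hK.symmetric_of_le (μ := μ) hDc (fun x hx y hy => ⟨(x, y), ⟨hx, hy⟩, rfl⟩)
    ((ENNReal.toReal_le_toReal hDc.measure_lt_top.ne hK.isCompact.measure_lt_top.ne).1 hle)

theorem IsBody.preimage_add {K : Set E} (hK : IsBody K) (z : E) : IsBody ((· + z) ⁻¹' K) := by
  refine ⟨hK.convex.translate_preimage_left z, (Homeomorph.addRight z).isCompact_preimage.2
    hK.isCompact, ?_⟩
  obtain ⟨x, hx⟩ := hK.interior_nonempty
  rw [show (· + z) ⁻¹' K = (Homeomorph.addRight z) ⁻¹' K from rfl,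
    ← (Homeomorph.addRight z).preimage_interior]
  exact ⟨x - z, by simpa using hx⟩

/-- A convex polytope whose two extremal slices in every direction have equal volume is centrally
symmetric. -/
theorem IsBody.exists_center_of_slice_ends {μ : Measure E} [μ.IsAddHaarMeasure] {K : Set E}
    (hK : IsBody K) (hpoly : ∃ A : Set (E × ℝ), A.Finite ∧ (∀ a ∈ A, ‖a.1‖ = 1) ∧ K = halfSpaces A)
    (hends : ∀ u : E, ‖u‖ = 1 → ∀ ν : Measure (ℝ ∙ u)ᗮ, ν.IsAddHaarMeasure →
      (∀ A : Set E, MeasurableSet A →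
        (Measurable fun τ => ν (slice u A τ)) ∧ μ A = ∫⁻ τ, ν (slice u A τ)) →
      ∀ a b, IsExtent u K a b → ν.real (slice u K a) = ν.real (slice u K b)) :
    ∃ c, ∀ x ∈ K, c - x ∈ K := by
  obtain ⟨z, hz⟩ := hK.interior_nonempty
  obtain ⟨A, hA, hA1, hKA⟩ := hpoly
  obtain ⟨c, hc⟩ := (hK.preimage_add z).exists_center_of_zero_mem (μ := μ)
    ⟨(fun a => (a.1, a.2 - ⟪a.1, z⟫)) '' A, hA.image _, by
      rintro _ ⟨a, ha, rfl⟩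
      exact hA1 a ha, by
      ext x
      simp only [hKA, halfSpaces, forall_mem_image, mem_preimage, mem_ofPred_eq, inner_add_right,
        le_sub_iff_add_le]⟩
    (by
      rw [show (· + z) ⁻¹' K = (Homeomorph.addRight z) ⁻¹' K from rfl,
        ← (Homeomorph.addRight z).preimage_interior]
      simpa using hz)
    (by
      intro u hu ν hν hμ a b hab
      obtain ⟨w, hw⟩ := exists_smul_add hu z
      have hs : ∀ τ, ν.real (slice u ((· + z) ⁻¹' K) τ) = ν.real (slice u K (τ + ⟪u, z⟫)) := by
        intro τ
        have : slice u ((· + z) ⁻¹' K) τ = (· + w) ⁻¹' slice u K (τ + ⟪u, z⟫) := by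
          ext v
          have e : τ • u + (v : E) + z = (τ + ⟪u, z⟫) • u + ((v + w : (ℝ ∙ u)ᗮ) : E) := by
            nth_rewrite 1 [← hw]
            rw [Submodule.coe_add]
            module
          simp only [slice, mem_preimage, mem_ofPred_eq, e]
        rw [this, measureReal_def, measure_preimage_add_right, measureReal_def]
      rw [hs, hs]
      refine hends u hu ν hν hμ _ _ ⟨by linarith [hab.lt], fun x hx => ?_, ?_, ?_⟩
      · have := hab.mem_Icc (x - z) (by simpa using hx)
        rw [inner_sub_right] at this
        exact ⟨by linarith [this.1], by linarith [this.2]⟩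
      · obtain ⟨x, hx, hxa⟩ := hab.exists_left
        exact ⟨x + z, hx, by rw [inner_add_right, hxa]⟩
      · obtain ⟨x, hx, hxa⟩ := hab.exists_right
        exact ⟨x + z, hx, by rw [inner_add_right, hxa]⟩)
  refine ⟨c + z + z, fun x hx => ?_⟩
  have := hc (x - z) (by simpa using hx)
  rw [mem_preimage] at this
  rwa [show c + z + z - x = c - (x - z) + z by abel]

end Minkowski

section Dissection

variable {E : Type*} [NormedAddCommGroup E] [InnerProductSpace ℝ E] [FiniteDimensional ℝ E]
  [MeasurableSpace E] [BorelSpace E]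

/-- A convex polytope that is dissected into finitely many centrally symmetric convex bodies is
centrally symmetric. -/
theorem IsBody.exists_center_of_dissection {μ : Measure E} [μ.IsAddHaarMeasure] {K : Set E}
    (hK : IsBody K) (hpoly : ∃ A : Set (E × ℝ), A.Finite ∧ (∀ a ∈ A, ‖a.1‖ = 1) ∧ K = halfSpaces A)
    {κ : Type*} [Finite κ] {Q : κ → Set E} {c : κ → E} (hQ : ∀ k, IsBody (Q k))
    (hc : ∀ k, ∀ x ∈ Q k, c k - x ∈ Q k) (hsub : ∀ k, Q k ⊆ K)
    (hcov : μ (K \ ⋃ k, Q k) = 0) (hdisj : ∀ k l, k ≠ l → μ (Q k ∩ Q l) = 0) :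
    ∃ c, ∀ x ∈ K, c - x ∈ K :=
  hK.exists_center_of_slice_ends (μ := μ) hpoly fun _ hu _ _ hμ _ _ h =>
    h.slice_ends_eq_of_dissection hμ hu hK hQ hc hsub hcov hdisj

end Dissection

section Facets

variable {E : Type*} [NormedAddCommGroup E] [InnerProductSpace ℝ E] [FiniteDimensional ℝ E]
variable {ι : Type*} [Finite ι] {P S : Set E} {u : ι → E} {h : ι → ℝ} {opp : ι → ι}

/-- In the relative interior of a facet only one inequality is tight. -/
theorem IsFacetRep.lt_of_mem_interior_slice (hP : IsFacetRep P u h) {j k : ι} (hkj : k ≠ j)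
    {v e : E}
    (hv : v = u j ∨ v = -u j) (he : ⟪u j, e⟫ = h j) {T : Set (ℝ ∙ v)ᗮ}
    (hT : ∀ w ∈ T, e + (w : E) ∈ P) {w : (ℝ ∙ v)ᗮ} (hw : w ∈ interior T) :
    ⟪u k, e + (w : E)⟫ < h k := by
  obtain ⟨y, hy, hy'⟩ := hP.exists_facet_point j
  have hye : y - e ∈ (ℝ ∙ v)ᗮ := by
    rw [Submodule.mem_orthogonal_singleton_iff_inner_right]
    rcases hv with rfl | rfl
    · rw [inner_sub_right, hy, he, sub_self]
    · rw [inner_neg_left, inner_sub_right, hy, he, sub_self, neg_zero]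
  set z : (ℝ ∙ v)ᗮ := ⟨y - e, hye⟩
  have hlim : Tendsto (fun ε : ℝ => w + ε • (w - z)) (𝓝[>] 0) (𝓝 w) := by
    have : Tendsto (fun ε : ℝ => w + ε • (w - z)) (𝓝 0) (𝓝 (w + (0 : ℝ) • (w - z))) :=
      Continuous.tendsto (by fun_prop) 0
    rw [zero_smul, add_zero] at this
    exact tendsto_nhdsWithin_of_tendsto_nhds this
  obtain ⟨ε, hε, hpos⟩ := ((hlim.eventually (mem_interior_iff_mem_nhds.1 hw)).and
    self_mem_nhdsWithin).exists
  have hpos' : (0 : ℝ) < ε := hpos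
  have h1 := hP.le (hT _ hε) k
  have h2 := hy' k hkj
  have e1 : e + ((w + ε • (w - z) : (ℝ ∙ v)ᗮ) : E) = (1 + ε) • (e + (w : E)) - ε • y := by
    simp only [z, Submodule.coe_add, Submodule.coe_smul, Submodule.coe_sub]
    module
  rw [e1, inner_sub_right, real_inner_smul_right, real_inner_smul_right] at h1
  have h3 := mul_lt_mul_of_pos_left h2 hpos'
  by_contra hcon
  push Not at hcon
  nlinarith

theorem IsFacetRep.isBody_facet (hP : IsFacetRep P u h) (hb : Bornology.IsBounded P) (i : ι) :
    IsBody (slice (u i) P (h i)) := by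
  refine ⟨convex_slice hP.convex _ _,
    isCompact_slice (Metric.isCompact_of_isClosed_isBounded hP.isClosed hb) _ _, ?_⟩
  obtain ⟨y, hy, hy'⟩ := hP.exists_facet_point i
  obtain ⟨w, hw⟩ := exists_smul_add (hP.norm_eq i) y
  rw [hy] at hw
  refine ⟨w, mem_interior.2 ⟨{w | ∀ k, k ≠ i → ⟪u k, h i • u i + (w : E)⟫ < h k}, ?_, ?_, ?_⟩⟩
  · intro w hw
    refine hP.mem_of_facet_point (inner_smul_add (hP.norm_eq i) _ _) hw
  · simp only [ofPred_forall]
    exact isOpen_iInter_of_finite fun k => isOpen_iInter_of_finite fun _ =>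
      isOpen_lt (by fun_prop) continuous_const
  · intro k hk
    rw [hw]
    exact hy' k hk

theorem IsFacetRep.facet_halfSpaces (hP : IsFacetRep P u h) (hb : Bornology.IsBounded P) (i : ι) :
    ∃ A : Set ((ℝ ∙ u i)ᗮ × ℝ), A.Finite ∧ (∀ a ∈ A, ‖a.1‖ = 1) ∧
      slice (u i) P (h i) = halfSpaces A := by
  refine exists_unit_halfSpaces (hP.isBody_facet hb i).nonempty
    (a := fun k => (ℝ ∙ u i)ᗮ.orthogonalProjectionOnto (u k))
    (c := fun k => h k - ⟪u k, h i • u i⟫) fun w => ?_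
  rw [slice, mem_ofPred_eq, hP.mem_iff]
  refine forall_congr' fun k => ?_
  have : ⟪(ℝ ∙ u i)ᗮ.orthogonalProjectionOnto (u k), w⟫ = ⟪u k, (w : E)⟫ :=
    Submodule.inner_orthogonalProjectionOnto_eq_of_mem_right w (u k)
  rw [this, inner_add_right]
  constructor <;> intro <;> linarith

/-- The tile across the facet `i` at a point in the relative interior of that facet. -/
theorem TranslateTiling.exists_opposite (hT : TranslateTiling P S)
    (hP : IsSymmetricRep P u h opp) (h0 : (0 : E) ∈ S) {i : ι} {p : E} (hp : ⟪u i, p⟫ = h i)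
    (hp' : ∀ k, k ≠ i → ⟪u k, p⟫ < h k) :
    ∃ s ∈ S, p - s ∈ P ∧ ⟪u i, s⟫ = 2 * h i := by
  obtain ⟨s, hs, hps, hact⟩ := hT.local_cover hP p (u i)
  have hpP := hP.mem_of_facet_point hp hp'
  have hs0 : (0 : E) ≠ s := by
    rintro rfl
    have := hact i (by simpa [active] using hp)
    rw [real_inner_self_eq_norm_sq, hP.norm_eq] at this
    norm_num at this
  have hge : ∀ q ∈ interior P, ⟪u i, p - s⟫ ≤ ⟪u i, q⟫ := by
    intro q hq
    by_contra hlt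
    push Not at hlt
    refine hs0 (hT.local_disjoint hP (p := p) (v := q - (p - s)) h0 hs (by simpa using hpP) hps
      ?_ ?_)
    · intro k hk
      have hki : k = i := by
        by_contra hki
        have h1 := hp' k hki
        simp only [active, sub_zero, mem_ofPred_eq] at hk
        linarith
      rw [hki, inner_sub_right]
      linarith
    · intro k hk
      simp only [active, mem_ofPred_eq] at hk
      have := hP.mem_interior_iff.1 hq k
      rw [inner_sub_right, hk]
      linarith
  obtain ⟨y, hy, hy'⟩ := hP.exists_facet_point (opp i)
  have hyP := hP.mem_of_facet_point hy hy'
  have hcl : y ∈ closure (interior P) := by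
    rw [hP.convex.closure_interior_eq_closure_of_nonempty_interior ⟨0, hP.zero_mem_interior⟩]
    exact subset_closure hyP
  have h1 : ⟪u i, p - s⟫ ≤ ⟪u i, y⟫ := by
    have hc : IsClosed {q | ⟪u i, p - s⟫ ≤ ⟪u i, q⟫} := isClosed_le continuous_const (by fun_prop)
    exact closure_minimal (fun q hq => hge q hq) hc hcl
  have h2 := hP.le hps (opp i)
  rw [hP.u_opp, hP.h_opp, inner_neg_left] at h2 hy
  refine ⟨s, hs, hps, ?_⟩
  rw [inner_sub_right] at h1 h2
  linarith

/-- The facets of a polytope that tiles by translates are centrally symmetric. -/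
theorem TranslateTiling.exists_facet_center (hT : TranslateTiling P S)
    (hP : IsSymmetricRep P u h opp) (i : ι) :
    ∃ c, ∀ w ∈ slice (u i) P (h i), c - w ∈ slice (u i) P (h i) := by
  wlog h0 : (0 : E) ∈ S generalizing S
  · obtain ⟨s, hs, -⟩ := hT.cover 0
    exact this (hT.translate s) ⟨s, hs, sub_self s⟩
  borelize E
  have hcomp : IsCompact P := Metric.isCompact_of_isClosed_isBounded hP.isClosed hP.bounded
  have hPint : (interior P).Nonempty := ⟨0, hP.zero_mem_interior⟩
  set ν : Measure (ℝ ∙ u i)ᗮ := Measure.addHaar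
  have hF := hP.isBody_facet hP.bounded i
  set F := slice (u i) P (h i) with hFdef
  set N : Set E := {s | s ∈ S ∧ ⟪u i, s⟫ = 2 * h i ∧ ∃ x ∈ P, x - s ∈ P} with hN
  have hNfin : N.Finite := (hT.finite_near hPint hP.bounded hP.bounded).subset
    fun s hs => ⟨hs.1, hs.2.2⟩
  set Q : E → Set (ℝ ∙ u i)ᗮ := fun s => {w | w ∈ F ∧ h i • u i - s + (w : E) ∈ P} with hQ
  have hQF : ∀ s, Q s ⊆ F := fun s w hw => hw.1
  have hQcomp : ∀ s, IsCompact (Q s) := fun s => hF.isCompact.inter_right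
    (hP.isClosed.preimage (f := fun w : (ℝ ∙ u i)ᗮ => h i • u i - s + (w : E)) (by fun_prop))
  have hQconv : ∀ s, Convex ℝ (Q s) := fun s => hF.convex.inter
    ((hP.convex.translate_preimage_right (h i • u i - s)).linear_preimage
      (ℝ ∙ u i)ᗮ.subtype)
  choose e he using fun s => exists_smul_add (hP.norm_eq i) s
  have hei : ∀ s ∈ N, (e s : E) = s - (2 * h i) • u i := fun s hs => by
    rw [← hs.2.1]
    exact eq_sub_of_add_eq' (he s)
  set κ : Set E := {s | s ∈ N ∧ ν (Q s) ≠ 0} with hκ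
  have : Finite κ := hNfin.subset fun s hs => hs.1
  refine hF.exists_center_of_dissection (μ := ν) (hP.facet_halfSpaces hP.bounded i)
    (κ := κ) (Q := fun s => Q s.1) (c := fun s => e s.1)
    (fun s => isBody_of_measure_pos (hQconv _) (hQcomp _) s.2.2) ?_ (fun s => hQF _) ?_ ?_
  · rintro ⟨s, hs, _⟩ w ⟨hw1, hw2⟩
    have e1 : ((e s - w : (ℝ ∙ u i)ᗮ) : E) = s - (2 * h i) • u i - (w : E) := by
      rw [Submodule.coe_sub, hei s hs]
    constructor
    · have := hP.neg_mem hw2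
      simp only [hFdef, slice, mem_ofPred_eq, e1]
      convert this using 1
      module
    · have := hP.neg_mem hw1
      simp only [e1]
      convert this using 1
      module
  · have h1 : F \ ⋃ s : κ, Q s.1 ⊆ frontier F ∪ ⋃ s ∈ N \ κ, Q s := by
      rintro w ⟨hw, hwn⟩
      by_cases hwi : w ∈ interior F
      · right
        obtain ⟨s, hs, hps, hus⟩ := hT.exists_opposite hP h0 (i := i)
          (p := h i • u i + (w : E)) (inner_smul_add (hP.norm_eq i) _ _) fun k hk =>
          hP.lt_of_mem_interior_slice hk (Or.inl rfl)
            (by rw [real_inner_smul_right, real_inner_self_eq_norm_sq, hP.norm_eq]; simp)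
            (fun w hw => hw) hwi
        have hsN : s ∈ N := ⟨hs, hus, _, hw, hps⟩
        have hwQ : w ∈ Q s := ⟨hw, by rwa [sub_add_eq_add_sub]⟩
        exact mem_biUnion (⟨hsN, fun hsκ => hwn (mem_iUnion.2 ⟨⟨s, hsκ⟩, hwQ⟩)⟩ : s ∈ N \ κ) hwQ
      · exact Or.inl ⟨subset_closure hw, hwi⟩
    refine measure_mono_null h1 (measure_union_null (hF.convex.addHaar_frontier ν) ?_)
    rw [measure_biUnion_null_iff (hNfin.subset sdiff_subset).countable]
    rintro s ⟨hs, hsκ⟩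
    by_contra hne
    exact hsκ ⟨hs, hne⟩
  · rintro ⟨s, hs, _⟩ ⟨s', hs', _⟩ hne
    by_contra hpos
    obtain ⟨w, hw⟩ := (isBody_of_measure_pos ((hQconv s).inter (hQconv s'))
      ((hQcomp s).inter (hQcomp s')) hpos).interior_nonempty
    have hstrict : ∀ r ∈ N, interior (Q s ∩ Q s') ⊆ interior (Q r) →
        h i • u i + (w : E) - r ∈ P ∧
          ∀ k ∈ active u h (h i • u i + (w : E) - r), ⟪u k, u i⟫ < 0 := by
      intro r hr hsub
      rw [add_sub_right_comm]
      refine ⟨(interior_subset (hsub hw)).2, fun k hk => ?_⟩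
      by_cases hki : k = opp i
      · rw [hki, hP.u_opp, inner_neg_left, real_inner_self_eq_norm_sq, hP.norm_eq]
        norm_num
      · have := hP.lt_of_mem_interior_slice hki (v := u i) (e := h i • u i - r)
          (Or.inr (by rw [hP.u_opp, neg_neg])) (by
            rw [hP.u_opp, hP.h_opp, inner_neg_left, inner_sub_right, hr.2.1, real_inner_smul_right,
              real_inner_self_eq_norm_sq, hP.norm_eq]
            ring) (fun w hw => hw.2) (hsub hw)
        exact absurd hk this.ne
    obtain ⟨a1, a2⟩ := hstrict s hs (interior_mono inter_subset_left)
    obtain ⟨b1, b2⟩ := hstrict s' hs' (interior_mono inter_subset_right)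
    exact hne (Subtype.ext (hT.local_disjoint hP hs.1 hs'.1 a1 b1 a2 b2))

theorem TranslateTiling.exists_facet_vector (hT : TranslateTiling P S)
    (hP : IsSymmetricRep P u h opp) (i : ι) :
    ∃ t, ⟪u i, t⟫ = 2 * h i ∧ ∀ x ∈ P, i ∈ active u h x → x - t ∈ P := by
  obtain ⟨c, hc⟩ := hT.exists_facet_center hP i
  refine ⟨(2 * h i) • u i + (c : E), inner_smul_add (hP.norm_eq i) _ _, fun x hx hxi => ?_⟩
  obtain ⟨w, hw⟩ := exists_smul_add (hP.norm_eq i) x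
  rw [show ⟪u i, x⟫ = h i from hxi] at hw
  have h1 := hP.neg_mem (hc w (by rw [slice, mem_ofPred_eq, hw]; exact hx))
  rw [← hw]
  convert h1 using 1
  rw [Submodule.coe_sub]
  module

theorem TranslateTiling.exists_isBelted (hT : TranslateTiling P S)
    (hP : IsSymmetricRep P u h opp) : ∃ t, IsBelted P u h opp t := by
  choose t ht hsub using hT.exists_facet_vector hP
  refine ⟨fun i => (1 / 2 : ℝ) • (t i - t (opp i)), hP.toIsFacetRep, hP.bounded, hP.pos, hP.u_opp,
    hP.h_opp, fun i => ?_, fun i => ?_, fun i x hx hxi => ?_, fun i j hij => hT.belt hP hij⟩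
  · rw [hP.opp_opp]
    module
  · have := ht (opp i)
    rw [hP.u_opp, hP.h_opp, inner_neg_left] at this
    rw [real_inner_smul_right, inner_sub_right, ht]
    linarith
  · have h1 := hsub i x hx hxi
    have h2 := hP.neg_mem (hsub (opp i) (-x) (hP.neg_mem hx) (by
      simpa [active, hP.u_opp, hP.h_opp] using hxi))
    have h3 := hP.convex h1 h2 (a := 1 / 2) (b := 1 / 2) (by norm_num) (by norm_num) (by norm_num)
    convert h3 using 1
    module

end Facets

section LatticeTiling

variable {E : Type*} [NormedAddCommGroup E] [InnerProductSpace ℝ E] [FiniteDimensional ℝ E]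
  {P S : Set E}

/-- The translates of `P` by `L` form a locally finite face-to-face tiling. -/
structure IsFaceToFaceLattice (P : Set E) (L : AddSubgroup E) : Prop where
  cover : ∀ x, ∃ l ∈ L, x - l ∈ P
  disjoint : ∀ l ∈ L, ∀ x ∈ interior P, x - l ∈ interior P → l = 0
  finite_inter : ∀ K : Set E, Bornology.IsBounded K → (K ∩ L).Finite
  extreme : ∀ l ∈ L, ∀ x ∈ P, ∀ y ∈ P, ∀ z ∈ openSegment ℝ x y, z - l ∈ P → x - l ∈ P

theorem mem_interior_preimage_add {z x : E} :
    x ∈ interior ((· + z) ⁻¹' P) ↔ x + z ∈ interior P := by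
  rw [show (· + z) ⁻¹' P = Homeomorph.addRight z ⁻¹' P from rfl,
    ← (Homeomorph.addRight z).preimage_interior]
  rfl

theorem TranslateTiling.preimage_add (hT : TranslateTiling P S) (z : E) :
    TranslateTiling ((· + z) ⁻¹' P) S where
  cover x := by
    obtain ⟨s, hs, h⟩ := hT.cover (x + z)
    exact ⟨s, hs, by rwa [mem_preimage, sub_add_eq_add_sub]⟩
  disjoint s hs s' hs' x h h' := by
    rw [mem_interior_preimage_add, sub_add_eq_add_sub] at h h'
    exact hT.disjoint s hs s' hs' _ h h'

theorem IsFaceToFaceLattice.of_preimage_add {L : AddSubgroup E} {z : E}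
    (h : IsFaceToFaceLattice ((· + z) ⁻¹' P) L) : IsFaceToFaceLattice P L where
  cover x := by
    obtain ⟨l, hl, hx⟩ := h.cover (x - z)
    exact ⟨l, hl, by rwa [mem_preimage, show x - z - l + z = x - l by abel] at hx⟩
  disjoint l hl x hx hxl := h.disjoint l hl (x - z)
    (by rwa [mem_interior_preimage_add, sub_add_cancel])
    (by rwa [mem_interior_preimage_add, show x - z - l + z = x - l by abel])
  finite_inter := h.finite_inter
  extreme l hl x hx y hy w hw hwl := by
    have := h.extreme l hl (x - z) (by rwa [mem_preimage, sub_add_cancel]) (y - z)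
      (by rwa [mem_preimage, sub_add_cancel]) (w - z) (by
        obtain ⟨a, b, ha, hb, hab, rfl⟩ := hw
        refine ⟨a, b, ha, hb, hab, ?_⟩
        obtain rfl : b = 1 - a := by linarith
        module) (by rwa [mem_preimage, show w - z - l + z = w - l by abel])
    rwa [mem_preimage, show x - z - l + z = x - l by abel] at this

theorem TranslateTiling.exists_isSymmetricRep (hT : TranslateTiling P S) (hP : IsBody P)
    (hneg : ∀ x ∈ P, -x ∈ P) : ∃ (A : Set (E × ℝ)) (opp : A → A), A.Finite ∧
      IsSymmetricRep P (fun a : A => a.1.1) (fun a : A => a.1.2) opp := by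
  obtain ⟨A, hA, hA1, hPA⟩ := hT.exists_halfSpaces hP.convex hP.isCompact hP.interior_nonempty
  obtain ⟨B, hBA, hB⟩ := exists_isFacetRep hP.interior_nonempty hA hA1 hPA
  have hfin := hA.subset hBA
  have := hfin.to_subtype
  choose opp hopp using hB.exists_opp hneg
  refine ⟨B, opp, hfin, hB, hP.isCompact.isBounded, fun i => ?_, fun i => (hopp i).1,
    fun i => (hopp i).2⟩
  obtain ⟨z, hz⟩ := hP.interior_nonempty
  have h1 := inner_lt_of_mem_interior (a := i.1.1) (c := i.1.2)
    (norm_ne_zero_iff.1 (by rw [hB.norm_eq i]; exact one_ne_zero))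
    (fun y hy => (hB.mem_iff y).1 hy i) hz
  have h2 := (hB.mem_iff _).1 (hneg z (interior_subset hz)) i
  rw [inner_neg_right] at h2
  linarith

/-- A convex body that tiles by translates has a face-to-face lattice tiling. -/
theorem TranslateTiling.exists_isFaceToFaceLattice (hT : TranslateTiling P S) (hP : IsBody P) :
    ∃ b : Fin (Module.finrank ℝ E) → E, LinearIndependent ℝ b ∧
      IsFaceToFaceLattice P (Submodule.span ℤ (range b)).toAddSubgroup := by
  borelize E
  obtain ⟨c, hc⟩ := hT.exists_center hP
  obtain ⟨A, opp, hA, hsym⟩ := (hT.preimage_add ((1 / 2 : ℝ) • c)).exists_isSymmetricRep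
    (hP.preimage_add _) fun x hx => by
      rw [mem_preimage, show -x + (1 / 2 : ℝ) • c = c - (x + (1 / 2 : ℝ) • c) by module]
      exact hc _ hx
  have := hA.to_subtype
  obtain ⟨t, ht⟩ := (hT.preimage_add ((1 / 2 : ℝ) • c)).exists_isBelted hsym
  obtain ⟨b, hb, hbL⟩ := ht.exists_basis
  have hL : (Submodule.span ℤ (range b)).toAddSubgroup = facetGroup t := SetLike.coe_injective hbL
  refine ⟨b, hb, .of_preimage_add (z := (1 / 2 : ℝ) • c) ?_⟩
  rw [hL]
  exact ⟨ht.exists_mem_translate, fun l hl x hx => ht.interiors_disjoint hl hx,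
    fun K hK => ht.finite_inter hK, fun l hl x hx y hy z => ht.sub_mem_of_openSegment hl hx hy⟩

end LatticeTiling

section Translates

variable {E : Type*} [NormedAddCommGroup E] [InnerProductSpace ℝ E] {P : Set E}

theorem mem_image_add {s x : E} : x ∈ (s + ·) '' P ↔ x - s ∈ P :=
  ⟨by rintro ⟨y, hy, rfl⟩; simpa using hy, fun h => ⟨x - s, h, by simp⟩⟩

theorem mem_interior_image_add {s x : E} :
    x ∈ interior ((s + ·) '' P) ↔ x - s ∈ interior P := by
  rw [show (s + ·) '' P = Homeomorph.addLeft s '' P from rfl,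
    ← (Homeomorph.addLeft s).image_interior]
  exact mem_image_add

namespace IsFaceToFaceLattice

variable {L : AddSubgroup E}

theorem interior_inter (h : IsFaceToFaceLattice P L) {l m : E} (hl : l ∈ L) (hm : m ∈ L)
    (hlm : (l + ·) '' P ≠ (m + ·) '' P) :
    interior ((l + ·) '' P) ∩ interior ((m + ·) '' P) = ∅ := by
  refine eq_empty_of_forall_notMem fun x hx => hlm ?_
  rw [mem_inter_iff, mem_interior_image_add, mem_interior_image_add] at hx
  have := h.disjoint (m - l) (L.sub_mem hm hl) (x - l) hx.1 (by
    rw [sub_sub_sub_cancel_right]; exact hx.2)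
  rw [sub_eq_zero.1 this]

theorem isExtreme (h : IsFaceToFaceLattice P L) {l m : E} (hl : l ∈ L) (hm : m ∈ L) :
    IsExtreme ℝ ((l + ·) '' P) ((l + ·) '' P ∩ (m + ·) '' P) := by
  refine ⟨inter_subset_left, fun x hx y hy z hz hzo => ⟨hx, ?_⟩⟩
  have hz2 := hz.2
  rw [mem_image_add] at hx hy hz2 ⊢
  have := h.extreme (m - l) (L.sub_mem hm hl) (x - l) hx (y - l) hy (z - l) (by
    obtain ⟨a, b, ha, hb, hab, rfl⟩ := hzo
    refine ⟨a, b, ha, hb, hab, ?_⟩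
    obtain rfl : b = 1 - a := by linarith
    module) (by rwa [sub_sub_sub_cancel_right])
  rwa [sub_sub_sub_cancel_right] at this

theorem finite_meeting (h : IsFaceToFaceLattice P L) (hP : IsCompact P) {K : Set E}
    (hK : IsCompact K) :
    {T ∈ (fun l => (l + ·) '' P) '' (L : Set E) | (T ∩ K).Nonempty}.Finite := by
  have hbdd : Bornology.IsBounded ((fun p : E × E => p.1 - p.2) '' K ×ˢ P) :=
    ((hK.prod hP).image (by fun_prop)).isBounded
  refine ((h.finite_inter _ hbdd).image fun l => (l + ·) '' P).subset ?_
  rintro _ ⟨⟨l, hl, rfl⟩, x, hx, hxK⟩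
  exact ⟨l, ⟨⟨(x, x - l), ⟨hxK, mem_image_add.1 hx⟩, by simp⟩, hl⟩, rfl⟩

end IsFaceToFaceLattice

end Translates

end TranslationTiling

/-- McMullen; Venkov: a convex polytope tiling `ℝ^d` by translates
admits a face-to-face lattice tiling. -/
theorem mcmullen_venkov (d : ℕ) (P : Set (Euc d)) (hP : IsConvexPolytope P)
    (S : Set (Euc d))
    (hcover : (⋃ s ∈ S, (s + ·) '' P) = Set.univ)
    (hdisj : ∀ s ∈ S, ∀ t ∈ S, s ≠ t →
      interior ((s + ·) '' P) ∩ interior ((t + ·) '' P) = ∅) :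
    ∃ b : Fin d → Euc d, LinearIndependent ℝ b ∧
      IsTiling ((fun l => (l + ·) '' P) ''
        ((Submodule.span ℤ (Set.range b) : Submodule ℤ (Euc d)) : Set (Euc d))) ∧
      LocallyFiniteTiling ((fun l => (l + ·) '' P) ''
        ((Submodule.span ℤ (Set.range b) : Submodule ℤ (Euc d)) : Set (Euc d))) ∧
      FaceToFace ((fun l => (l + ·) '' P) ''
        ((Submodule.span ℤ (Set.range b) : Submodule ℤ (Euc d)) : Set (Euc d))) := by
  obtain ⟨⟨V, hV⟩, hne⟩ := hP
  have hbody : TranslationTiling.IsBody P :=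
    ⟨hV ▸ convex_convexHull ℝ _, hV ▸ V.finite_toSet.isCompact_convexHull ℝ, hne⟩
  have hT : TranslationTiling.TranslateTiling P S := by
    refine ⟨fun x => ?_, fun s hs s' hs' x hx hx' => ?_⟩
    · obtain ⟨s, hs, hx⟩ := mem_iUnion₂.1 (hcover ▸ mem_univ x)
      exact ⟨s, hs, TranslationTiling.mem_image_add.1 hx⟩
    · by_contra hss
      exact (hdisj s hs s' hs' hss).le ⟨TranslationTiling.mem_interior_image_add.2 hx,
        TranslationTiling.mem_interior_image_add.2 hx'⟩
  obtain ⟨b, hb, hL⟩ : ∃ b : Fin d → Euc d, LinearIndependent ℝ b ∧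
      TranslationTiling.IsFaceToFaceLattice P (Submodule.span ℤ (range b)).toAddSubgroup := by
    have := hT.exists_isFaceToFaceLattice hbody
    rwa [finrank_euclideanSpace_fin] at this
  refine ⟨b, hb, ⟨?_, ?_, ?_⟩, fun K hK => hL.finite_meeting hbody.isCompact hK, ?_⟩
  · rintro _ ⟨l, _, rfl⟩
    exact (hbody.isCompact.image (continuous_const_add l)).isClosed
  · refine eq_univ_of_forall fun x => ?_
    obtain ⟨l, hl, hx⟩ := hL.cover x
    exact ⟨_, mem_image_of_mem _ hl, TranslationTiling.mem_image_add.2 hx⟩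
  · rintro _ ⟨l, hl, rfl⟩ _ ⟨m, hm, rfl⟩ hlm
    exact hL.interior_inter hl hm hlm
  · rintro _ ⟨l, hl, rfl⟩ _ ⟨m, hm, rfl⟩ _
    exact ⟨hL.isExtreme hl hm, by rw [inter_comm]; exact hL.isExtreme hm hl⟩
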